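/- arXiv:1909.05570 — 4 statements merged into one kernel-verified Lean document; each statement's English description precedes it below -/
import Mathlib

section
/- Let ρ, c ∈ ℝ with 0 ≤ ρ < c < 1 and ρ ≤ ρ_0 = √(3+2√3)/3. Let (X_i)_{1≤i≤n} and (Z_i)_{1≤i≤n} be i.i.d. standard Gaussian random variables, all independent, set Y_i = ρ X_i + √(1-ρ²) Z_i, and let r_n = Σ_i (X_i - X̄_n)(Y_i - Ȳ_n)/√(Σ_i (X_i - X̄_n)² · Σ_i (Y_i - Ȳ_n)²). Then as n → ∞, P(r_n ≥ c) = [ ḡ_ρ(c) / √(|h̄''(c)|) ] · ( √(1-ρ²) √(1-c²) / (1-ρc) )^{n} / ( λ_c σ_c √(2πn) ) · (1 + o(1)), where λ_c = c/(1-c²) - ρ/(1-ρc), σ_c² = 1/|h̄''(c)|, h̄''(c) = ρ²/(1-ρc)² - (1+c²)/(1-c²)², and ( √(1-ρ²)√(1-c²)/(1-ρc) )^n = e^{-n L*(c)} with rate function L*(c) = log( (1-ρc)/(√(1-ρ²)√(1-c²)) ). -/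
open Real Filter MeasureTheory ProbabilityTheory

/-- The law of `n` i.i.d. pairs of independent standard Gaussians `(Xᵢ, Zᵢ)`. -/
noncomputable def gaussPair (n : ℕ) : Measure ((Fin n → ℝ) × (Fin n → ℝ)) :=
  (Measure.pi fun _ : Fin n => gaussianReal 0 1).prod
    (Measure.pi fun _ : Fin n => gaussianReal 0 1)

/-- The empirical Pearson correlation coefficient of the sample `(Xᵢ, Yᵢ)` with
`Xᵢ = ω.1 i` and `Yᵢ = ρ Xᵢ + √(1-ρ²) Zᵢ`, `Zᵢ = ω.2 i`. -/
noncomputable def pearson (ρ : ℝ) (n : ℕ) (ω : (Fin n → ℝ) × (Fin n → ℝ)) : ℝ :=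
  let X : Fin n → ℝ := ω.1
  let Y : Fin n → ℝ := fun i => ρ * ω.1 i + Real.sqrt (1 - ρ ^ 2) * ω.2 i
  let Xbar : ℝ := (∑ i, X i) / n
  let Ybar : ℝ := (∑ i, Y i) / n
  (∑ i, (X i - Xbar) * (Y i - Ybar)) /
    Real.sqrt ((∑ i, (X i - Xbar) ^ 2) * (∑ i, (Y i - Ybar) ^ 2))

/-- The amplitude `ḡ_ρ(r) = (1-ρ²)^{-1/2} (1-ρr)^{3/2} (1-r²)^{-2}`. -/
noncomputable def gbar (ρ r : ℝ) : ℝ :=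
  (1 - ρ ^ 2) ^ (-(1 / 2) : ℝ) * (1 - ρ * r) ^ ((3 : ℝ) / 2) * ((1 - r ^ 2) ^ 2)⁻¹

open scoped ENNReal

lemma lintegral_gaussianReal_eq (f : ℝ → ℝ≥0∞) (hf : Measurable f) :
    ∫⁻ x, f x ∂(gaussianReal 0 1) = ∫⁻ x, gaussianPDF 0 1 x * f x := by
  rw [gaussianReal_of_var_ne_zero _ one_ne_zero,
    lintegral_withDensity_eq_lintegral_mul _ (by fun_prop) hf]
  rfl

lemma lintegral_pi_gaussianReal_eq (m : ℕ) (f : (Fin m → ℝ) → ℝ≥0∞) (hf : Measurable f) :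
    ∫⁻ z, f z ∂(Measure.pi fun _ : Fin m => gaussianReal 0 1)
      = ∫⁻ z, (∏ i, gaussianPDF 0 1 (z i)) * f z := by
  induction m with
  | zero =>
    rw [Measure.pi_of_empty, volume_pi, Measure.pi_of_empty (fun _ => (volume : Measure ℝ))]
    simp
  | succ m ih =>
    rw [← (measurePreserving_piFinSuccAbove (fun _ : Fin (m + 1) => gaussianReal 0 1)
      0).symm.lintegral_comp hf]
    rw [← (volume_preserving_piFinSuccAbove (fun _ : Fin (m + 1) => ℝ) 0).symm.lintegral_comp
      (by fun_prop)]
    have h1 : Measurable fun p : ℝ × (Fin m → ℝ) =>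
        f ((MeasurableEquiv.piFinSuccAbove (fun _ : Fin (m + 1) => ℝ) 0).symm p) := by
      fun_prop
    rw [lintegral_prod _ h1.aemeasurable, Measure.volume_eq_prod, lintegral_prod _ (by fun_prop),
      lintegral_gaussianReal_eq _ h1.lintegral_prod_right']
    refine lintegral_congr fun x => ?_
    rw [ih _ (by fun_prop), ← lintegral_const_mul _ (by fun_prop)]
    refine lintegral_congr fun y => ?_
    simp [MeasurableEquiv.piFinSuccAbove, Fin.prod_univ_succ, Fin.insertNthEquiv]
    ring

lemma lintegral_norm_addHaar {E : Type*} [NormedAddCommGroup E] [NormedSpace ℝ E]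
    [MeasurableSpace E] [Nontrivial E] (μ : Measure E) [FiniteDimensional ℝ E] [BorelSpace E] [μ.IsAddHaarMeasure]
    (f : ℝ → ℝ≥0∞) (hf : Measurable f) :
    ∫⁻ x, f ‖x‖ ∂μ = μ.toSphere Set.univ *
      ∫⁻ y in Set.Ioi (0 : ℝ), ENNReal.ofReal (y ^ (Module.finrank ℝ E - 1)) * f y := by
  calc
    ∫⁻ x, f (‖x‖) ∂μ = ∫⁻ x : ({(0)}ᶜ : Set E), f (‖x.1‖) ∂(μ.comap (↑)) := by
      rw [lintegral_subtype_comap (measurableSet_singleton _).compl fun x ↦ f (‖x‖),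
        restrict_compl_singleton]
    _ = ∫⁻ x, f x.2 ∂μ.toSphere.prod (.volumeIoiPow (Module.finrank ℝ E - 1)) := by
      simpa using μ.measurePreserving_homeomorphUnitSphereProd.lintegral_comp_emb
        (Homeomorph.measurableEmbedding _) (f ∘ Subtype.val ∘ Prod.snd)
    _ = μ.toSphere Set.univ * ∫⁻ x : Set.Ioi (0 : ℝ), f x ∂.volumeIoiPow (Module.finrank ℝ E - 1) := by
      rw [lintegral_prod _ (by fun_prop)]
      simp [mul_comm]
    _ = _ := by
      simp only [Measure.volumeIoiPow]
      rw [lintegral_withDensity_eq_lintegral_mul _ (by fun_prop) (by fun_prop)]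
      rw [← lintegral_subtype_comap measurableSet_Ioi]
      rfl

noncomputable def radialMass (d : ℕ) : ℝ := ∫ y in Set.Ioi (0 : ℝ), y ^ d * exp (-y ^ 2 / 2)

lemma integral_pow_mul_exp_neg_mul_sq (d : ℕ) {q : ℝ} (hq : 0 < q) :
    ∫ y in Set.Ioi (0 : ℝ), y ^ d * exp (-(q * y ^ 2))
      = q ^ (-((d : ℝ) + 1) / 2) * (1 / 2) * Gamma (((d : ℝ) + 1) / 2) := by
  rw [← integral_rpow_mul_exp_neg_mul_rpow two_pos (by linarith [d.cast_nonneg (α := ℝ)]) hq]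
  refine setIntegral_congr_fun measurableSet_Ioi fun y _ => ?_
  simp only [rpow_natCast, rpow_two, neg_mul]

lemma integrableOn_pow_mul_exp_neg_mul_sq (d : ℕ) {q : ℝ} (hq : 0 < q) :
    IntegrableOn (fun y : ℝ => y ^ d * exp (-(q * y ^ 2))) (Set.Ioi 0) := by
  refine ((integrable_rpow_mul_exp_neg_mul_sq hq (s := d)
    (by linarith [d.cast_nonneg (α := ℝ)])).integrableOn).congr_fun (fun y _ => ?_) measurableSet_Ioi
  simp only [rpow_natCast, neg_mul]

lemma lintegral_pow_mul_exp_neg_mul_sq (d : ℕ) {q : ℝ} (hq : 0 < q) :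
    ∫⁻ y in Set.Ioi (0 : ℝ), ENNReal.ofReal (y ^ d * exp (-(q * y ^ 2)))
      = ENNReal.ofReal (q ^ (-((d : ℝ) + 1) / 2) * (1 / 2) * Gamma (((d : ℝ) + 1) / 2)) := by
  rw [← integral_pow_mul_exp_neg_mul_sq d hq,
    ofReal_integral_eq_lintegral_ofReal (integrableOn_pow_mul_exp_neg_mul_sq d hq)]
  filter_upwards [ae_restrict_mem measurableSet_Ioi] with y hy
  have : 0 < y := hy
  positivity

lemma radialMass_eq (d : ℕ) :
    radialMass d = (1 / 2 : ℝ) ^ (-((d : ℝ) + 1) / 2) * (1 / 2) * Gamma (((d : ℝ) + 1) / 2) := by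
  rw [← integral_pow_mul_exp_neg_mul_sq d one_half_pos, radialMass]
  refine setIntegral_congr_fun measurableSet_Ioi fun y _ => ?_
  congr 2
  ring

lemma radialMass_pos (d : ℕ) : 0 < radialMass d := by
  rw [radialMass_eq]
  have : 0 < Gamma (((d : ℝ) + 1) / 2) := Gamma_pos_of_pos (by positivity)
  positivity

lemma lintegral_radialMass (d : ℕ) :
    ∫⁻ y in Set.Ioi (0 : ℝ), ENNReal.ofReal (y ^ d * exp (-y ^ 2 / 2))
      = ENNReal.ofReal (radialMass d) := by
  rw [radialMass_eq, ← lintegral_pow_mul_exp_neg_mul_sq d one_half_pos]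
  refine setLIntegral_congr_fun measurableSet_Ioi fun y _ => ?_
  congr 3
  ring

lemma radialMass_succ_mul (d : ℕ) :
    radialMass (d + 1) * radialMass d = √(π / 2) * d.factorial := by
  rw [radialMass_eq, radialMass_eq]
  have h := Gamma_mul_Gamma_add_half (((d : ℝ) + 1) / 2)
  rw [show 2 * (((d : ℝ) + 1) / 2) = d + 1 by ring, Gamma_nat_eq_factorial] at h
  have e : ((d : ℝ) + 1) / 2 + 1 / 2 = (((d + 1 : ℕ) : ℝ) + 1) / 2 := by push_cast; ring
  rw [e] at h
  rw [show ∀ a b c d e f: ℝ, a * b * c * (d * e * f) = (a * d) * (b * e) * (f * c) by intros; ring, h,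
    ← rpow_add (by norm_num)]
  have e2 : (1 / 2 : ℝ) ^ (-(((d + 1 : ℕ) : ℝ) + 1) / 2 + -((d : ℝ) + 1) / 2)
      = 2 ^ ((d : ℝ) + 3 / 2) := by
    rw [one_div, inv_rpow (by norm_num), ← rpow_neg (by norm_num)]
    congr 1
    push_cast
    ring
  have e3 : (2 : ℝ) ^ ((d : ℝ) + 3 / 2) * 2 ^ (1 - ((d : ℝ) + 1)) = 2 * √2 := by
    rw [← rpow_add (by norm_num), show (d : ℝ) + 3 / 2 + (1 - (d + 1)) = 1 + 1 / 2 by ring,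
      rpow_add (by norm_num), rpow_one, sqrt_eq_rpow]
  have h2 : √2 * √2 = 2 := mul_self_sqrt (by norm_num)
  rw [e2, sqrt_div' _ (by norm_num)]
  calc _ = ((2 : ℝ) ^ ((d : ℝ) + 3 / 2) * 2 ^ (1 - ((d : ℝ) + 1))) * (1 / 4) * d.factorial * √π := by ring
    _ = _ := by
      rw [e3]
      field_simp
      nlinarith

lemma lintegral_pi_gaussianReal_norm (d : ℕ) (f : ℝ → ℝ≥0∞) (hf : Measurable f) :
    ∫⁻ z, f (√(∑ i, z i ^ 2)) ∂(Measure.pi fun _ : Fin (d + 1) => gaussianReal 0 1)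
      = ENNReal.ofReal (radialMass d)⁻¹ *
        ∫⁻ y in Set.Ioi (0 : ℝ), ENNReal.ofReal (y ^ d * exp (-y ^ 2 / 2)) * f y := by
  obtain ⟨K, hK⟩ : ∃ K : ℝ≥0∞, ∀ f : ℝ → ℝ≥0∞, Measurable f →
      ∫⁻ z, f (√(∑ i, z i ^ 2)) ∂(Measure.pi fun _ : Fin (d + 1) => gaussianReal 0 1)
      = K * ∫⁻ y in Set.Ioi (0 : ℝ), ENNReal.ofReal (y ^ d * exp (-y ^ 2 / 2)) * f y := by
    refine ⟨ENNReal.ofReal ((√(2 * π))⁻¹ ^ (d + 1)) *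
      (volume : Measure (EuclideanSpace ℝ (Fin (d + 1)))).toSphere Set.univ, fun f hf => ?_⟩
    have h := lintegral_norm_addHaar (volume : Measure (EuclideanSpace ℝ (Fin (d + 1))))
      (fun y => ENNReal.ofReal (exp (-y ^ 2 / 2)) * f y) (by fun_prop)
    rw [← (PiLp.volume_preserving_toLp (Fin (d + 1))).lintegral_comp (by fun_prop)] at h
    rw [lintegral_pi_gaussianReal_eq _ _ (by fun_prop), mul_assoc]
    have e : ∀ y : ℝ, ENNReal.ofReal (y ^ d * exp (-y ^ 2 / 2)) * f y
        = ENNReal.ofReal (y ^ d) * (ENNReal.ofReal (exp (-y ^ 2 / 2)) * f y) := by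
      intro y
      rw [ENNReal.ofReal_mul' (exp_pos _).le, mul_assoc]
    simp_rw [e]
    simp only [finrank_euclideanSpace, Fintype.card_fin, Nat.add_sub_cancel] at h
    rw [← h, ← lintegral_const_mul _ (by fun_prop)]
    refine lintegral_congr fun z => ?_
    rw [EuclideanSpace.norm_eq, ← mul_assoc, ← ENNReal.ofReal_mul (by positivity)]
    simp only [norm_eq_abs, sq_abs]
    congr 1
    simp only [gaussianPDF]
    rw [← ENNReal.ofReal_prod_of_nonneg fun i _ => gaussianPDFReal_nonneg _ _ _]
    congr 1
    simp only [gaussianPDFReal, Finset.prod_mul_distrib, ← exp_sum]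
    rw [sq_sqrt (by positivity)]
    simp [Finset.sum_neg_distrib, Finset.sum_div, neg_div]
  rw [hK f hf]
  congr 1
  have h1 := hK (fun _ => 1) measurable_const
  simp only [lintegral_one, measure_univ, mul_one, lintegral_radialMass] at h1
  rw [ENNReal.ofReal_inv_of_pos (radialMass_pos d)]
  exact ENNReal.eq_inv_of_mul_eq_one_left h1.symm

lemma measurePreserving_inner_orthonormalBasis {ι : Type*} [Fintype ι]
    (b : OrthonormalBasis ι ℝ (EuclideanSpace ℝ ι)) :
    MeasurePreserving (fun (z : ι → ℝ) i => inner ℝ (b i) (WithLp.toLp 2 z))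
      (Measure.pi fun _ => gaussianReal 0 1) (Measure.pi fun _ => gaussianReal 0 1) := by
  refine ⟨by fun_prop, ?_⟩
  have e : (fun (z : ι → ℝ) i => inner ℝ (b i) (WithLp.toLp 2 z))
      = (WithLp.ofLp ∘ b.repr) ∘ WithLp.toLp 2 := by
    ext z i
    simp [b.repr_apply_apply]
  have h : (stdGaussian (EuclideanSpace ℝ ι)).map WithLp.ofLp
      = Measure.pi fun _ : ι => gaussianReal 0 1 := by
    rw [← map_pi_eq_stdGaussian, Measure.map_map (by fun_prop) (by fun_prop)]
    exact Measure.map_id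
  rw [e, ← Measure.map_map (by fun_prop) (by fun_prop), map_pi_eq_stdGaussian,
    ← Measure.map_map (by fun_prop) (by fun_prop), stdGaussian_map, h]

noncomputable def centeredSumSq {n : ℕ} (x : Fin n → ℝ) : ℝ :=
  ∑ i, (x i - (∑ j, x j) / n) ^ 2

lemma sum_sub_mean {n : ℕ} [NeZero n] (x : Fin n → ℝ) : ∑ i, (x i - (∑ j, x j) / n) = 0 := by
  have : (n : ℝ) ≠ 0 := NeZero.ne _
  simp [Finset.sum_sub_distrib]
  field_simp
  simp

lemma centeredSumSq_eq {n : ℕ} [NeZero n] (x : Fin n → ℝ) :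
    centeredSumSq x = ∑ i, x i ^ 2 - (∑ i, x i) ^ 2 / n := by
  have : (n : ℝ) ≠ 0 := NeZero.ne _
  simp only [centeredSumSq, sub_sq, Finset.sum_add_distrib, Finset.sum_sub_distrib, ← Finset.sum_mul,
    ← Finset.mul_sum]
  simp
  field_simp
  ring

lemma centeredSumSq_nonneg {n : ℕ} (x : Fin n → ℝ) : 0 ≤ centeredSumSq x :=
  Finset.sum_nonneg fun _ _ => sq_nonneg _

/-- In an orthonormal basis whose first vector is `(1, …, 1) / √n`, the centered sum of squares is
the sum of squares of the remaining coordinates. -/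
lemma centeredSumSq_eq_sum_inner {n : ℕ}
    (b : OrthonormalBasis (Fin (n + 1)) ℝ (EuclideanSpace ℝ (Fin (n + 1))))
    (hb : b 0 = WithLp.toLp 2 fun _ => (√((n + 1 : ℕ) : ℝ))⁻¹) (z : Fin (n + 1) → ℝ) :
    centeredSumSq z = ∑ i : Fin n, inner ℝ (b i.succ) (WithLp.toLp 2 z) ^ 2 := by
  have h := b.sum_sq_inner_right (WithLp.toLp 2 z)
  rw [Fin.sum_univ_succ, EuclideanSpace.real_norm_sq_eq] at h
  have h0 : inner ℝ (b 0) (WithLp.toLp 2 z) ^ 2 = (∑ i, z i) ^ 2 / (n + 1 : ℕ) := by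
    rw [hb]
    simp only [PiLp.inner_apply, RCLike.inner_apply, conj_trivial, ← Finset.sum_mul]
    rw [mul_pow, inv_pow, sq_sqrt (by positivity), div_eq_mul_inv]
  simp only [h0] at h
  rw [centeredSumSq_eq, ← h]
  ring

lemma norm_toLp_inv_sqrt (n : ℕ) :
    ‖(WithLp.toLp 2 fun _ => (√((n + 1 : ℕ) : ℝ))⁻¹ : EuclideanSpace ℝ (Fin (n + 1)))‖ = 1 := by
  rw [EuclideanSpace.norm_eq]
  simp only [norm_eq_abs, sq_abs, Finset.sum_const, Finset.card_univ, Fintype.card_fin, nsmul_eq_mul]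
  rw [inv_pow, sq_sqrt (by positivity), mul_inv_cancel₀ (by positivity), sqrt_one]

lemma exists_orthonormalBasis_mean (n : ℕ) :
    ∃ b : OrthonormalBasis (Fin (n + 1)) ℝ (EuclideanSpace ℝ (Fin (n + 1))),
      b 0 = WithLp.toLp 2 fun _ => (√((n + 1 : ℕ) : ℝ))⁻¹ := by
  obtain ⟨b, hb⟩ := Orthonormal.exists_orthonormalBasis_extension_of_card_eq
    (𝕜 := ℝ) (E := EuclideanSpace ℝ (Fin (n + 1))) (ι := Fin (n + 1)) (by simp)
    (v := fun _ => WithLp.toLp 2 fun _ => (√((n + 1 : ℕ) : ℝ))⁻¹) (s := {0}) (by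
      constructor
      · intro i
        exact norm_toLp_inv_sqrt n
      · intro i j hij
        exact absurd (Subsingleton.elim i j) hij)
  exact ⟨b, hb 0 rfl⟩

lemma exists_orthonormalBasis_mean_direction (n : ℕ) (x : Fin (n + 2) → ℝ)
    (hx : 0 < centeredSumSq x) :
    ∃ b : OrthonormalBasis (Fin (n + 2)) ℝ (EuclideanSpace ℝ (Fin (n + 2))),
      (b 0 = WithLp.toLp 2 fun _ => (√((n + 2 : ℕ) : ℝ))⁻¹) ∧
      b 1 = WithLp.toLp 2 fun i => (x i - (∑ j, x j) / (n + 2 : ℕ)) / √(centeredSumSq x) := by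
  have hs : √(centeredSumSq x) ^ 2 = centeredSumSq x := sq_sqrt hx.le
  set v : Fin (n + 2) → EuclideanSpace ℝ (Fin (n + 2)) := fun k =>
    if k = 0 then WithLp.toLp 2 fun _ => (√((n + 2 : ℕ) : ℝ))⁻¹
    else WithLp.toLp 2 fun i => (x i - (∑ j, x j) / (n + 2 : ℕ)) / √(centeredSumSq x) with hv
  have h01 : inner ℝ (v 0) (v 1) = 0 := by
    simp only [hv, PiLp.inner_apply, RCLike.inner_apply, conj_trivial]
    simp only [one_ne_zero, if_true, if_false, ← Finset.sum_mul, ← Finset.sum_div, sum_sub_mean]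
    simp
  obtain ⟨b, hb⟩ := Orthonormal.exists_orthonormalBasis_extension_of_card_eq
    (𝕜 := ℝ) (E := EuclideanSpace ℝ (Fin (n + 2))) (ι := Fin (n + 2)) (by simp)
    (v := v) (s := {0, 1}) (by
      constructor
      · rintro ⟨i, rfl | rfl⟩
        · exact norm_toLp_inv_sqrt (n + 1)
        · simp only [Set.domRestrict, hv]
          rw [if_neg one_ne_zero, EuclideanSpace.norm_eq]
          simp only [norm_eq_abs, sq_abs, div_pow, hs, ← Finset.sum_div]
          rw [← centeredSumSq, div_self hx.ne', sqrt_one]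
      · rintro ⟨i, rfl | rfl⟩ ⟨j, rfl | rfl⟩ hij
        · exact absurd rfl hij
        · exact h01
        · rw [real_inner_comm]
          exact h01
        · exact absurd rfl hij)
  refine ⟨b, ?_, ?_⟩
  · simpa [hv] using hb 0 (by simp)
  · simpa [hv] using hb 1 (by simp)

lemma lintegral_pi_gaussianReal_succ {m : ℕ} (f : ℝ × (Fin m → ℝ) → ℝ≥0∞) (hf : Measurable f) :
    ∫⁻ z, f (z 0, fun i => z i.succ) ∂(Measure.pi fun _ : Fin (m + 1) => gaussianReal 0 1)
      = ∫⁻ y, ∫⁻ t, f (t, y) ∂(gaussianReal 0 1) ∂(Measure.pi fun _ : Fin m => gaussianReal 0 1) := by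
  rw [← lintegral_prod_symm _ hf.aemeasurable,
    ← (measurePreserving_piFinSuccAbove (fun _ : Fin (m+1) => gaussianReal 0 1) 0).lintegral_comp hf]
  rfl

noncomputable def reducedCorr (ρ a y t : ℝ) : ℝ :=
  (ρ * a + √(1 - ρ ^ 2) * t) / √((ρ * a + √(1 - ρ ^ 2) * t) ^ 2 + (1 - ρ ^ 2) * y ^ 2)

@[fun_prop]
lemma measurable_reducedCorr {α : Type*} [MeasurableSpace α] {ρ : ℝ} {a y t : α → ℝ}
    (ha : Measurable a) (hy : Measurable y) (ht : Measurable t) :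
    Measurable fun x => reducedCorr ρ (a x) (y x) (t x) := by
  unfold reducedCorr
  fun_prop

lemma measurable_pearson (ρ : ℝ) (n : ℕ) : Measurable (pearson ρ n) := by
  unfold pearson
  fun_prop

lemma pearson_eq_reducedCorr {m : ℕ} {ρ : ℝ} (hρ : 0 ≤ 1 - ρ ^ 2) (x z : Fin (m + 2) → ℝ)
    (hx : 0 < centeredSumSq x)
    (b : OrthonormalBasis (Fin (m + 2)) ℝ (EuclideanSpace ℝ (Fin (m + 2))))
    (h0 : b 0 = WithLp.toLp 2 fun _ => (√((m + 2 : ℕ) : ℝ))⁻¹)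
    (h1 : b 1 = WithLp.toLp 2 fun i => (x i - (∑ j, x j) / (m + 2 : ℕ)) / √(centeredSumSq x)) :
    pearson ρ (m + 2) (x, z) = reducedCorr ρ (√(centeredSumSq x))
      (√(∑ i : Fin m, inner ℝ (b i.succ.succ) (WithLp.toLp 2 z) ^ 2))
      (inner ℝ (b 1) (WithLp.toLp 2 z)) := by
  have hS : 0 < √(centeredSumSq x) := sqrt_pos.2 hx
  have hz := centeredSumSq_eq_sum_inner b h0 z
  rw [Fin.sum_univ_succ, Fin.succ_zero_eq_one'] at hz
  have hV : √(∑ i : Fin m, inner ℝ (b i.succ.succ) (WithLp.toLp 2 z) ^ 2) ^ 2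
      = centeredSumSq z - inner ℝ (b 1) (WithLp.toLp 2 z) ^ 2 := by
    rw [sq_sqrt (Finset.sum_nonneg fun _ _ => sq_nonneg _), hz]
    ring
  have hxz : ∑ i, (x i - (∑ j, x j) / (m + 2 : ℕ)) * (z i - (∑ j, z j) / (m + 2 : ℕ))
      = √(centeredSumSq x) * inner ℝ (b 1) (WithLp.toLp 2 z) := by
    rw [Finset.sum_congr rfl fun i _ => mul_sub (x i - (∑ j, x j) / (m + 2 : ℕ)) (z i) _,
      Finset.sum_sub_distrib, ← Finset.sum_mul, sum_sub_mean, zero_mul, sub_zero, h1]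
    simp only [PiLp.inner_apply, RCLike.inner_apply, conj_trivial, Finset.mul_sum]
    refine Finset.sum_congr rfl fun i _ => ?_
    field_simp
  set ζ := inner ℝ (b 1) (WithLp.toLp 2 z)
  set S := √(centeredSumSq x) with hSdef
  have hSS : centeredSumSq x = S ^ 2 := (sq_sqrt hx.le).symm
  obtain ⟨p, hpdef⟩ : ∃ p, p = √(1 - ρ ^ 2) := ⟨_, rfl⟩
  have hp : p ^ 2 = 1 - ρ ^ 2 := hpdef ▸ sq_sqrt hρ
  have hY : ∀ i, (ρ * x i + p * z i) - (∑ j, (ρ * x j + p * z j)) / (m + 2 : ℕ)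
      = ρ * (x i - (∑ j, x j) / (m + 2 : ℕ)) + p * (z i - (∑ j, z j) / (m + 2 : ℕ)) := by
    intro i
    rw [Finset.sum_add_distrib, ← Finset.mul_sum, ← Finset.mul_sum]
    ring
  have hXX : ∑ i, (x i - (∑ j, x j) / (m + 2 : ℕ)) ^ 2 = S ^ 2 := hSS
  have hZZ : ∑ i, (z i - (∑ j, z j) / (m + 2 : ℕ)) ^ 2 = centeredSumSq z := rfl
  have hXY : ∑ i, (x i - (∑ j, x j) / (m + 2 : ℕ)) * (ρ * (x i - (∑ j, x j) / (m + 2 : ℕ))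
      + p * (z i - (∑ j, z j) / (m + 2 : ℕ))) = ρ * S ^ 2 + p * (S * ζ) := by
    rw [← hXX, ← hxz, Finset.mul_sum, Finset.mul_sum, ← Finset.sum_add_distrib]
    exact Finset.sum_congr rfl fun i _ => by ring
  have hYY : ∑ i, (ρ * (x i - (∑ j, x j) / (m + 2 : ℕ))
      + p * (z i - (∑ j, z j) / (m + 2 : ℕ))) ^ 2
      = ρ ^ 2 * S ^ 2 + 2 * ρ * p * (S * ζ) + p ^ 2 * centeredSumSq z := by
    rw [← hXX, ← hxz, ← hZZ, Finset.mul_sum, Finset.mul_sum, Finset.mul_sum,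
      ← Finset.sum_add_distrib, ← Finset.sum_add_distrib]
    exact Finset.sum_congr rfl fun i _ => by ring
  simp only [pearson, reducedCorr, ← hpdef, hY]
  rw [hXX, hXY, hYY, hV, ← hp, sqrt_mul (sq_nonneg S), sqrt_sq hS.le,
    show ρ * S ^ 2 + p * (S * ζ) = S * (ρ * S + p * ζ) by ring, mul_div_mul_left _ _ hS.ne']
  congr 2
  ring

lemma measure_pearson_ge_of_pos {m : ℕ} {ρ c : ℝ} (hρ : 0 ≤ 1 - ρ ^ 2) (x : Fin (m + 3) → ℝ)
    (hx : 0 < centeredSumSq x) :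
    (Measure.pi fun _ : Fin (m + 3) => gaussianReal 0 1) {z | c ≤ pearson ρ (m + 3) (x, z)}
      = ENNReal.ofReal (radialMass m)⁻¹ *
        ∫⁻ y in Set.Ioi (0 : ℝ), ENNReal.ofReal (y ^ m * exp (-y ^ 2 / 2)) *
          gaussianReal 0 1 {t | c ≤ reducedCorr ρ (√(centeredSumSq x)) y t} := by
  obtain ⟨b, h0, h1⟩ := exists_orthonormalBasis_mean_direction (m + 1) x hx
  set a := √(centeredSumSq x)
  set T : Set (ℝ × ℝ) := {q | c ≤ reducedCorr ρ a q.1 q.2}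
  have hT : MeasurableSet T := measurableSet_le measurable_const (by fun_prop)
  have hi : Measurable (T.indicator (1 : ℝ × ℝ → ℝ≥0∞)) := measurable_one.indicator hT
  set g : ℝ × (Fin (m + 1) → ℝ) → ℝ≥0∞ := fun q => T.indicator 1 (√(∑ i, q.2 i ^ 2), q.1)
  have hg : Measurable g := hi.comp (by fun_prop)
  have hmeas : MeasurableSet {z | c ≤ pearson ρ (m + 3) (x, z)} :=
    measurableSet_le measurable_const ((measurable_pearson _ _).comp (by fun_prop))
  rw [← lintegral_indicator_one hmeas]
  calc _ = ∫⁻ z, g (inner ℝ (b 1) (WithLp.toLp 2 z),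
        fun i => inner ℝ (b i.succ.succ) (WithLp.toLp 2 z))
          ∂(Measure.pi fun _ : Fin (m + 3) => gaussianReal 0 1) := by
        refine lintegral_congr fun z => ?_
        have := pearson_eq_reducedCorr hρ x z hx b h0 h1
        simp only [Set.indicator_apply, Set.mem_ofPred_eq, this, g, T]
        rfl
    _ = ∫⁻ z, g (z 1, fun i => z i.succ.succ)
          ∂(Measure.pi fun _ : Fin (m + 3) => gaussianReal 0 1) :=
        (measurePreserving_inner_orthonormalBasis b).lintegral_comp
          (f := fun z => g (z 1, fun i => z i.succ.succ)) (hg.comp (by fun_prop))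
    _ = ∫⁻ z, g (z 0, fun i => z i.succ)
          ∂(Measure.pi fun _ : Fin (m + 2) => gaussianReal 0 1) := by
        have := lintegral_pi_gaussianReal_succ (m := m + 2)
          (fun q => g (q.2 0, fun i => q.2 i.succ)) (hg.comp (by fun_prop))
        simpa using this
    _ = _ := by
        rw [lintegral_pi_gaussianReal_succ g hg]
        have := lintegral_pi_gaussianReal_norm m
          (fun y => ∫⁻ t, T.indicator 1 (y, t) ∂(gaussianReal 0 1)) hi.lintegral_prod_right'
        rw [this]
        congr 1
        refine lintegral_congr fun y => ?_
        congr 1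
        have hm : MeasurableSet {t | c ≤ reducedCorr ρ a y t} :=
          measurableSet_le measurable_const (by fun_prop)
        rw [← lintegral_indicator_one hm]
        rfl

lemma lintegral_centeredSumSq (m : ℕ) (f : ℝ → ℝ≥0∞) (hf : Measurable f) :
    ∫⁻ x, f (√(centeredSumSq x)) ∂(Measure.pi fun _ : Fin (m + 2) => gaussianReal 0 1)
      = ENNReal.ofReal (radialMass m)⁻¹ *
        ∫⁻ a in Set.Ioi (0 : ℝ), ENNReal.ofReal (a ^ m * exp (-a ^ 2 / 2)) * f a := by
  obtain ⟨b, h0⟩ := exists_orthonormalBasis_mean (m + 1)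
  rw [← lintegral_pi_gaussianReal_norm m f hf]
  calc _ = ∫⁻ x, f (√(∑ i : Fin (m + 1), inner ℝ (b i.succ) (WithLp.toLp 2 x) ^ 2))
          ∂(Measure.pi fun _ : Fin (m + 2) => gaussianReal 0 1) :=
        lintegral_congr fun x => by rw [centeredSumSq_eq_sum_inner b h0]
    _ = ∫⁻ x, f (√(∑ i : Fin (m + 1), x i.succ ^ 2))
          ∂(Measure.pi fun _ : Fin (m + 2) => gaussianReal 0 1) :=
        (measurePreserving_inner_orthonormalBasis b).lintegral_comp
          (f := fun x => f (√(∑ i : Fin (m + 1), x i.succ ^ 2))) (by fun_prop)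
    _ = _ := by
        have := lintegral_pi_gaussianReal_succ (m := m + 1)
          (fun q => f (√(∑ i, q.2 i ^ 2))) (by fun_prop)
        simpa using this

lemma ae_centeredSumSq_pos (m : ℕ) :
    ∀ᵐ x ∂(Measure.pi fun _ : Fin (m + 2) => gaussianReal 0 1), 0 < centeredSumSq x := by
  have h := lintegral_centeredSumSq m (Set.indicator {0} 1)
    (measurable_one.indicator (measurableSet_singleton 0))
  have h0 : ∫⁻ a in Set.Ioi (0 : ℝ), ENNReal.ofReal (a ^ m * exp (-a ^ 2 / 2)) *
      Set.indicator {0} (1 : ℝ → ℝ≥0∞) a = 0 := by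
    rw [setLIntegral_congr_fun (g := 0) measurableSet_Ioi]
    · simp
    · intro a ha
      have : a ≠ 0 := ne_of_gt ha
      simp [this]
  have hm : Measurable fun x : Fin (m + 2) → ℝ => √(centeredSumSq x) := by
    unfold centeredSumSq
    fun_prop
  have hm' : Measurable fun x : Fin (m + 2) → ℝ =>
      Set.indicator {0} (1 : ℝ → ℝ≥0∞) (√(centeredSumSq x)) :=
    (measurable_one.indicator (measurableSet_singleton 0)).comp hm
  rw [h0, mul_zero, lintegral_eq_zero_iff hm'] at h
  filter_upwards [h] with x hx
  by_contra hc
  have : centeredSumSq x = 0 := le_antisymm (not_lt.1 hc) (centeredSumSq_nonneg x)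
  simp [this] at hx

lemma gaussPair_pearson_ge (m : ℕ) {ρ c : ℝ} (hρ : 0 ≤ 1 - ρ ^ 2) :
    gaussPair (m + 3) {ω | c ≤ pearson ρ (m + 3) ω}
      = ENNReal.ofReal (radialMass (m + 1))⁻¹ * ∫⁻ a in Set.Ioi (0 : ℝ),
        ENNReal.ofReal (a ^ (m + 1) * exp (-a ^ 2 / 2)) *
        (ENNReal.ofReal (radialMass m)⁻¹ *
        ∫⁻ y in Set.Ioi (0 : ℝ), ENNReal.ofReal (y ^ m * exp (-y ^ 2 / 2)) *
          gaussianReal 0 1 {t | c ≤ reducedCorr ρ a y t}) := by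
  have hm : Measurable fun q : ℝ × ℝ => gaussianReal 0 1 {t | c ≤ reducedCorr ρ q.1 q.2 t} := by
    have : MeasurableSet {q : (ℝ × ℝ) × ℝ | c ≤ reducedCorr ρ q.1.1 q.1.2 q.2} :=
      measurableSet_le measurable_const (by fun_prop)
    exact measurable_measure_prodMk_left this
  rw [gaussPair, Measure.prod_apply (measurableSet_le measurable_const (measurable_pearson _ _)),
    ← lintegral_centeredSumSq (m + 1)]
  · refine lintegral_congr_ae ?_
    filter_upwards [ae_centeredSumSq_pos (m + 1)] with x hx
    exact measure_pearson_ge_of_pos hρ x hx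
  · refine Measurable.const_mul ?_ _
    refine Measurable.lintegral_prod_right'
      (f := fun q : ℝ × ℝ => ENNReal.ofReal (q.2 ^ m * exp (-q.2 ^ 2 / 2)) *
          gaussianReal 0 1 {t | c ≤ reducedCorr ρ q.1 q.2 t}) ?_
    fun_prop

lemma le_div_sqrt_one_add_sq_iff {c s : ℝ} (hc0 : 0 < c) (hc : c < 1) :
    c ≤ s / √(1 + s ^ 2) ↔ c / √(1 - c ^ 2) ≤ s := by
  have hs : 0 < 1 + s ^ 2 := by positivity
  have hq : 0 < 1 - c ^ 2 := by nlinarith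
  rw [le_div_iff₀ (sqrt_pos.2 hs), div_le_iff₀ (sqrt_pos.2 hq)]
  have e1 := sq_sqrt hs.le
  have e2 := sq_sqrt hq.le
  have p1 := sqrt_pos.2 hs
  have p2 := sqrt_pos.2 hq
  constructor
  · intro h
    have h0 : 0 < s := lt_of_lt_of_le (by positivity) h
    refine le_of_sq_le_sq ?_ (by positivity)
    have := pow_le_pow_left₀ (by positivity) h 2
    rw [mul_pow, e1] at this
    rw [mul_pow, e2]
    linarith
  · intro h
    have h0 : 0 < s := by
      by_contra hn
      nlinarith [not_lt.1 hn]
    refine le_of_sq_le_sq ?_ h0.le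
    have := pow_le_pow_left₀ (by positivity) h 2
    rw [mul_pow, e2] at this
    rw [mul_pow, e1]
    linarith

lemma reducedCorr_eq {ρ a y s : ℝ} (hρ : 0 < 1 - ρ ^ 2) (hy : 0 < y) :
    reducedCorr ρ a y (s * y - ρ / √(1 - ρ ^ 2) * a) = s / √(1 + s ^ 2) := by
  have hp := sqrt_pos.2 hρ
  have e : ρ * a + √(1 - ρ ^ 2) * (s * y - ρ / √(1 - ρ ^ 2) * a) = (√(1 - ρ ^ 2) * y) * s := by
    field_simp
    ring
  have e2 : ((√(1 - ρ ^ 2) * y) * s) ^ 2 + (1 - ρ ^ 2) * y ^ 2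
      = (√(1 - ρ ^ 2) * y) ^ 2 * (1 + s ^ 2) := by
    rw [← sq_sqrt hρ.le, sqrt_sq hp.le]
    ring
  rw [reducedCorr, e, e2, sqrt_mul (sq_nonneg _), sqrt_sq (by positivity),
    mul_div_mul_left _ _ (by positivity)]

lemma gaussianReal_reducedCorr_ge {ρ c a y : ℝ} (hρ : 0 < 1 - ρ ^ 2) (hc0 : 0 < c) (hc : c < 1)
    (hy : 0 < y) :
    gaussianReal 0 1 {t | c ≤ reducedCorr ρ a y t}
      = ∫⁻ s in Set.Ici (c / √(1 - c ^ 2)),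
          ENNReal.ofReal (y * ((√(2 * π))⁻¹ * exp (-(s * y - ρ / √(1 - ρ ^ 2) * a) ^ 2 / 2))) := by
  have e : {t | c ≤ reducedCorr ρ a y t}
      = (fun s => s * y - ρ / √(1 - ρ ^ 2) * a) '' Set.Ici (c / √(1 - c ^ 2)) := by
    ext t
    constructor
    · intro ht
      refine ⟨(t + ρ / √(1 - ρ ^ 2) * a) / y, ?_, by field_simp; ring⟩
      rw [Set.mem_Ici, ← le_div_sqrt_one_add_sq_iff hc0 hc, ← reducedCorr_eq (a := a) hρ hy]
      rw [div_mul_cancel₀ _ hy.ne', add_sub_cancel_right]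
      exact ht
    · rintro ⟨s, hs, rfl⟩
      change c ≤ _
      rw [reducedCorr_eq hρ hy, le_div_sqrt_one_add_sq_iff hc0 hc]
      exact hs
  rw [e, gaussianReal_apply _ one_ne_zero,
    lintegral_image_eq_lintegral_abs_deriv_mul (f' := fun _ => y) measurableSet_Ici]
  · refine lintegral_congr fun s => ?_
    rw [gaussianPDF, ← ENNReal.ofReal_mul (abs_nonneg _), abs_of_pos hy, gaussianPDFReal]
    simp
  · intro s _
    simpa using (((hasDerivAt_id s).mul_const y).sub_const (ρ / √(1 - ρ ^ 2) * a)).hasDerivWithinAt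
  · intro s _ s' _ h
    have : s * y = s' * y := by simpa using h
    exact mul_right_cancel₀ hy.ne' this

/-- The base of the power appearing in the double integral representation of the tail of the
correlation coefficient. -/
noncomputable def corrKernel (τ s w : ℝ) : ℝ := √(1 + τ ^ 2) * √(1 + s ^ 2) * cosh w - τ * s

lemma mul_lt_sqrt_mul_sqrt (τ s : ℝ) : τ * s < √(1 + τ ^ 2) * √(1 + s ^ 2) := by
  rw [← sqrt_mul (by positivity)]
  refine lt_sqrt_of_sq_lt ?_
  nlinarith [sq_nonneg τ, sq_nonneg s]

lemma corrKernel_pos (τ s w : ℝ) : 0 < corrKernel τ s w := by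
  have h := mul_lt_sqrt_mul_sqrt τ s
  have h2 : √(1 + τ ^ 2) * √(1 + s ^ 2) * 1 ≤ √(1 + τ ^ 2) * √(1 + s ^ 2) * cosh w := by
    gcongr
    exact one_le_cosh w
  unfold corrKernel
  linarith

lemma lintegral_Ioi_eq_lintegral_exp {k : ℝ} (hk : 0 < k) (g : ℝ → ℝ≥0∞) :
    ∫⁻ y in Set.Ioi (0 : ℝ), g y = ∫⁻ w, ENNReal.ofReal (k * exp w) * g (k * exp w) := by
  have e : Set.Ioi (0 : ℝ) = (fun w => k * exp w) '' Set.univ := by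
    ext y
    constructor
    · intro hy
      refine ⟨log (y / k), trivial, ?_⟩
      simp only
      rw [exp_log (div_pos hy hk)]
      field_simp
    · rintro ⟨w, -, rfl⟩
      exact mul_pos hk (exp_pos w)
  rw [e, lintegral_image_eq_lintegral_abs_deriv_mul (f' := fun w => k * exp w) MeasurableSet.univ]
  · rw [Measure.restrict_univ]
    refine lintegral_congr fun w => ?_
    rw [abs_of_pos (by positivity)]
  · intro w _
    exact ((hasDerivAt_exp w).const_mul k).hasDerivWithinAt
  · intro w _ w' _ h
    exact exp_injective (mul_left_cancel₀ hk.ne' h)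

lemma sqrt_one_add_sq_pos (s : ℝ) : 0 < √(1 + s ^ 2) := sqrt_pos.2 (by positivity)

lemma lintegral_lintegral_gaussian (m : ℕ) (τ s : ℝ) :
    ∫⁻ a in Set.Ioi (0 : ℝ), ∫⁻ y in Set.Ioi (0 : ℝ),
      ENNReal.ofReal (a ^ (m + 1) * y ^ (m + 1) *
        exp (-(a ^ 2 + y ^ 2 + (s * y - τ * a) ^ 2) / 2))
      = ENNReal.ofReal ((m + 1).factorial / 2) *
        ∫⁻ w, ENNReal.ofReal ((corrKernel τ s w ^ (m + 2))⁻¹) := by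
  have hT := sqrt_one_add_sq_pos τ
  have hR := sqrt_one_add_sq_pos s
  have eT : √(1 + τ ^ 2) ^ 2 = 1 + τ ^ 2 := sq_sqrt (by positivity)
  have eR : √(1 + s ^ 2) ^ 2 = 1 + s ^ 2 := sq_sqrt (by positivity)
  set T := √(1 + τ ^ 2) with hTd
  set R := √(1 + s ^ 2) with hRd
  calc _ = ∫⁻ a in Set.Ioi (0 : ℝ), ∫⁻ w, ENNReal.ofReal ((T / R * exp w) ^ (m + 2)) *
        ENNReal.ofReal (a ^ (2 * m + 3) *
          exp (-(T / R * exp w * corrKernel τ s w * a ^ 2))) := by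
        refine setLIntegral_congr_fun measurableSet_Ioi fun a ha => ?_
        have ha : 0 < a := ha
        rw [lintegral_Ioi_eq_lintegral_exp (k := a * T / R) (by positivity)]
        refine lintegral_congr fun w => ?_
        rw [← ENNReal.ofReal_mul (by positivity), ← ENNReal.ofReal_mul (by positivity)]
        have e : -(a ^ 2 + (a * T / R * exp w) ^ 2 + (s * (a * T / R * exp w) - τ * a) ^ 2) / 2
            = -(T / R * exp w * corrKernel τ s w * a ^ 2) := by
          have e1 : a ^ 2 + (a * T / R * exp w) ^ 2 + (s * (a * T / R * exp w) - τ * a) ^ 2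
            = a ^ 2 * (1 + τ ^ 2) + (1 + s ^ 2) * (a * T / R * exp w) ^ 2
              - 2 * τ * s * a * (a * T / R * exp w) := by ring
          have e2 : exp w * cosh w = (exp w ^ 2 + 1) / 2 := by
            have : exp w * exp (-w) = 1 := by rw [← exp_add]; simp
            rw [cosh_eq]
            linear_combination this / 2
          have e3 : T / R * exp w * corrKernel τ s w * a ^ 2
            = T ^ 2 * a ^ 2 * ((exp w * cosh w)) - T / R * exp w * τ * s * a ^ 2 := by
            rw [corrKernel, ← hTd, ← hRd]
            field_simp
          rw [e1, e3, e2, ← eT, ← eR]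
          field_simp
          ring
        rw [e]
        congr 1
        ring
    _ = ∫⁻ w, ∫⁻ a in Set.Ioi (0 : ℝ), ENNReal.ofReal ((T / R * exp w) ^ (m + 2)) *
        ENNReal.ofReal (a ^ (2 * m + 3) *
          exp (-(T / R * exp w * corrKernel τ s w * a ^ 2))) := by
        refine lintegral_lintegral_swap ?_
        unfold corrKernel
        fun_prop
    _ = _ := by
        rw [← lintegral_const_mul _ (by unfold corrKernel; fun_prop)]
        refine lintegral_congr fun w => ?_
        have hD := corrKernel_pos τ s w
        rw [lintegral_const_mul _ (by fun_prop),
          lintegral_pow_mul_exp_neg_mul_sq _ (by positivity), ← ENNReal.ofReal_mul (by positivity),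
          ← ENNReal.ofReal_mul (by positivity)]
        congr 1
        have e1 : (((2 * m + 3 : ℕ) : ℝ) + 1) / 2 = ((m + 1 : ℕ) : ℝ) + 1 := by push_cast; ring
        have e2 : -(((2 * m + 3 : ℕ) : ℝ) + 1) / 2 = -((m + 2 : ℕ) : ℝ) := by push_cast; ring
        rw [e1, e2, Gamma_nat_eq_factorial, rpow_neg (by positivity), rpow_natCast,
          mul_pow (T / R * exp w)]
        field_simp

lemma gaussPair_pearson_ge_eq (m : ℕ) {ρ c : ℝ} (hρ : 0 < 1 - ρ ^ 2) (hc0 : 0 < c) (hc : c < 1) :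
    gaussPair (m + 3) {ω | c ≤ pearson ρ (m + 3) ω}
      = ENNReal.ofReal ((m + 1) / (2 * π)) * ∫⁻ s in Set.Ioi (c / √(1 - c ^ 2)), ∫⁻ w,
          ENNReal.ofReal ((corrKernel (ρ / √(1 - ρ ^ 2)) s w ^ (m + 2))⁻¹) := by
  set κ := c / √(1 - c ^ 2)
  set τ := ρ / √(1 - ρ ^ 2)
  have hr := radialMass_pos m
  have hr' := radialMass_pos (m + 1)
  set K := (radialMass (m + 1))⁻¹ * (radialMass m)⁻¹ * (√(2 * π))⁻¹ with hK
  have hKpos : 0 < K := by positivity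
  rw [gaussPair_pearson_ge m hρ.le]
  calc _ = ENNReal.ofReal K * ∫⁻ a in Set.Ioi (0 : ℝ), ∫⁻ y in Set.Ioi (0 : ℝ), ∫⁻ s in Set.Ici κ,
        ENNReal.ofReal (a ^ (m + 1) * y ^ (m + 1) *
        exp (-(a ^ 2 + y ^ 2 + (s * y - τ * a) ^ 2) / 2)) := by
        rw [← lintegral_const_mul' _ _ ENNReal.ofReal_ne_top,
          ← lintegral_const_mul' _ _ ENNReal.ofReal_ne_top]
        refine setLIntegral_congr_fun measurableSet_Ioi fun a ha => ?_
        have ha : 0 < a := ha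
        rw [← mul_assoc, ← mul_assoc, ← ENNReal.ofReal_mul (by positivity),
          ← ENNReal.ofReal_mul (by positivity), ← lintegral_const_mul' _ _ ENNReal.ofReal_ne_top,
          ← lintegral_const_mul' _ _ ENNReal.ofReal_ne_top]
        refine setLIntegral_congr_fun measurableSet_Ioi fun y hy => ?_
        have hy : 0 < y := hy
        rw [gaussianReal_reducedCorr_ge hρ hc0 hc hy, ← mul_assoc,
          ← ENNReal.ofReal_mul (by positivity), ← lintegral_const_mul' _ _ ENNReal.ofReal_ne_top,
          ← lintegral_const_mul' _ _ ENNReal.ofReal_ne_top]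
        refine lintegral_congr fun s => ?_
        rw [← ENNReal.ofReal_mul (by positivity), ← ENNReal.ofReal_mul (by positivity)]
        congr 1
        have e : exp (-(a ^ 2 + y ^ 2 + (s * y - τ * a) ^ 2) / 2)
            = exp (-a ^ 2 / 2) * exp (-y ^ 2 / 2) * exp (-(s * y - τ * a) ^ 2 / 2) := by
          rw [← exp_add, ← exp_add]
          congr 1
          ring
        rw [e, hK]
        ring
    _ = ENNReal.ofReal K * ∫⁻ s in Set.Ici κ, ∫⁻ a in Set.Ioi (0 : ℝ), ∫⁻ y in Set.Ioi (0 : ℝ),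
        ENNReal.ofReal (a ^ (m + 1) * y ^ (m + 1) *
        exp (-(a ^ 2 + y ^ 2 + (s * y - τ * a) ^ 2) / 2)) := by
        congr 1
        exact (lintegral_congr fun a => lintegral_lintegral_swap (by fun_prop)).trans
          (lintegral_lintegral_swap (by fun_prop))
    _ = _ := by
        simp only [lintegral_lintegral_gaussian]
        rw [lintegral_const_mul' _ _ ENNReal.ofReal_ne_top, ← mul_assoc,
          ← ENNReal.ofReal_mul hKpos.le, Measure.restrict_congr_set Ioi_ae_eq_Ici.symm]
        congr 2
        have h2 : √(π / 2) * √(2 * π) = π := by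
          rw [← sqrt_mul (by positivity), show π / 2 * (2 * π) = π ^ 2 by ring, sqrt_sq pi_pos.le]
        have hf : (0 : ℝ) < m.factorial := by positivity
        have e : K = (π * m.factorial)⁻¹ := by
          rw [hK, ← mul_inv, ← mul_inv, radialMass_succ_mul]
          congr 1
          linear_combination (m.factorial : ℝ) * h2
        rw [e, Nat.factorial_succ]
        push_cast
        field_simp

lemma cosh_sub_one_eq (w : ℝ) : cosh w - 1 = 2 * sinh (w / 2) ^ 2 := by
  have h := cosh_two_mul (w / 2)
  rw [show 2 * (w / 2) = w by ring, cosh_sq] at h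
  linarith

lemma sq_half_le_cosh_sub_one (w : ℝ) : w ^ 2 / 2 ≤ cosh w - 1 := by
  have h : |w / 2| ≤ |sinh (w / 2)| := by
    rw [abs_sinh]
    exact self_le_sinh_iff.2 (abs_nonneg _)
  have := sq_le_sq.2 h
  rw [cosh_sub_one_eq]
  linarith

lemma HasDerivAt.tendsto_mul_sub_of_tendsto_atTop {h : ℝ → ℝ} {d x : ℝ} (hd : HasDerivAt h d x)
    (σ : ℝ) {r : ℕ → ℝ} (hr : Tendsto r atTop atTop) :
    Tendsto (fun n => r n * (h (x + σ / r n) - h x)) atTop (nhds (d * σ)) := by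
  have h1 : HasDerivAt (fun t => h (x + σ * t)) (d * σ) 0 := by
    have h2 : HasDerivAt (fun t => x + σ * t) σ 0 := by
      simpa using ((hasDerivAt_id (0 : ℝ)).const_mul σ).const_add x
    have h3 : HasDerivAt h d (x + σ * 0) := by simpa using hd
    exact h3.comp 0 h2
  have h4 := h1.tendsto_slope_zero_right.comp (tendsto_inv_atTop_nhdsGT_zero.comp hr)
  refine h4.congr fun n => ?_
  simp [div_eq_mul_inv]

section
variable {τ κ : ℝ}

/-- The exponential rates of the two coordinates in the rescaled kernel. -/
noncomputable def slopeRate (τ κ : ℝ) : ℝ :=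
  (√(1 + τ ^ 2) * (κ / √(1 + κ ^ 2)) - τ) / corrKernel τ κ 0

noncomputable def curvatureRate (τ κ : ℝ) : ℝ :=
  √(1 + τ ^ 2) * √(1 + κ ^ 2) / corrKernel τ κ 0

noncomputable def scaledKernel (τ κ : ℝ) (n : ℕ) (q : ℝ × ℝ) : ℝ :=
  ((corrKernel τ (κ + q.1 / n) (q.2 / √n) / corrKernel τ κ 0) ^ n)⁻¹

lemma slopeRate_pos (hτ : 0 ≤ τ) (hκ : τ < κ) : 0 < slopeRate τ κ := by
  refine div_pos (sub_pos.2 ?_) (corrKernel_pos _ _ _)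
  have hR := sqrt_one_add_sq_pos κ
  rw [← mul_div_assoc, lt_div_iff₀ hR]
  have hT := sqrt_one_add_sq_pos τ
  have eT : √(1 + τ ^ 2) ^ 2 = 1 + τ ^ 2 := sq_sqrt (by positivity)
  have eR : √(1 + κ ^ 2) ^ 2 = 1 + κ ^ 2 := sq_sqrt (by positivity)
  have hκ0 : 0 < κ := hτ.trans_lt hκ
  refine lt_of_pow_lt_pow_left₀ 2 (by positivity) ?_
  rw [mul_pow, mul_pow, eT, eR]
  nlinarith

lemma curvatureRate_pos (τ κ : ℝ) : 0 < curvatureRate τ κ :=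
  div_pos (mul_pos (sqrt_one_add_sq_pos _) (sqrt_one_add_sq_pos _)) (corrKernel_pos _ _ _)

lemma corrKernel_eq_add (τ s w : ℝ) :
    corrKernel τ s w = corrKernel τ s 0 + √(1 + τ ^ 2) * √(1 + s ^ 2) * (cosh w - 1) := by
  simp only [corrKernel, cosh_zero]
  ring

lemma one_add_le_corrKernel_div (hκ : 0 ≤ κ) {s : ℝ} (hs : κ ≤ s) (w : ℝ) :
    1 + (slopeRate τ κ * (s - κ) + curvatureRate τ κ * (w ^ 2 / 2))
      ≤ corrKernel τ s w / corrKernel τ κ 0 := by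
  have hD := corrKernel_pos τ κ 0
  rw [le_div_iff₀ hD, slopeRate, curvatureRate]
  have hR := sqrt_one_add_sq_pos κ
  have hT := sqrt_one_add_sq_pos τ
  have eR : √(1 + κ ^ 2) ^ 2 = 1 + κ ^ 2 := sq_sqrt (by positivity)
  have e : (1 + ((√(1 + τ ^ 2) * (κ / √(1 + κ ^ 2)) - τ) / corrKernel τ κ 0 * (s - κ)
      + √(1 + τ ^ 2) * √(1 + κ ^ 2) / corrKernel τ κ 0 * (w ^ 2 / 2))) * corrKernel τ κ 0
      = corrKernel τ κ 0 + (√(1 + τ ^ 2) * (κ / √(1 + κ ^ 2)) - τ) * (s - κ)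
        + √(1 + τ ^ 2) * √(1 + κ ^ 2) * (w ^ 2 / 2) := by
    field_simp
    ring
  rw [e, corrKernel_eq_add τ s w]
  have h1 : √(1 + κ ^ 2) + κ / √(1 + κ ^ 2) * (s - κ) ≤ √(1 + s ^ 2) := by
    have h3 : 1 + κ * s ≤ √(1 + κ ^ 2) * √(1 + s ^ 2) := by
      rw [← sqrt_mul (by positivity)]
      refine le_sqrt_of_sq_le ?_
      nlinarith [sq_nonneg (κ - s)]
    have h4 : √(1 + κ ^ 2) + κ / √(1 + κ ^ 2) * (s - κ) = (1 + κ * s) / √(1 + κ ^ 2) := by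
      field_simp
      rw [eR]
      ring
    rw [h4, div_le_iff₀ hR]
    linarith
  have h2 : √(1 + κ ^ 2) ≤ √(1 + s ^ 2) := by gcongr
  have h5 : √(1 + κ ^ 2) * (w ^ 2 / 2) ≤ √(1 + s ^ 2) * (cosh w - 1) := by
    gcongr
    exact sq_half_le_cosh_sub_one w
  simp only [corrKernel, cosh_zero]
  nlinarith [mul_le_mul_of_nonneg_left h1 hT.le, mul_le_mul_of_nonneg_left h5 hT.le]

lemma tendsto_scaledKernel (τ κ σ v : ℝ) :
    Tendsto (fun n : ℕ => scaledKernel τ κ n (σ, v)) atTop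
      (nhds (exp (-(slopeRate τ κ * σ)) * exp (-(curvatureRate τ κ / 2) * v ^ 2))) := by
  have hD := corrKernel_pos τ κ 0
  have hR := sqrt_one_add_sq_pos κ
  have hn : Tendsto (fun n : ℕ => (n : ℝ)) atTop atTop := tendsto_natCast_atTop_atTop
  have hsn : Tendsto (fun n : ℕ => √(n : ℝ)) atTop atTop := tendsto_sqrt_atTop.comp hn
  have h1 : Tendsto (fun n : ℕ => (n : ℝ) * (corrKernel τ (κ + σ / n) 0 - corrKernel τ κ 0))
      atTop (nhds ((√(1 + τ ^ 2) * (κ / √(1 + κ ^ 2)) - τ) * σ)) := by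
    refine HasDerivAt.tendsto_mul_sub_of_tendsto_atTop (h := fun s => corrKernel τ s 0) ?_ σ hn
    simp only [corrKernel, cosh_zero, mul_one]
    have hs : HasDerivAt (fun s : ℝ => √(1 + s ^ 2)) (κ / √(1 + κ ^ 2)) κ := by
      have h := ((hasDerivAt_pow 2 κ).const_add 1).sqrt (by positivity)
      convert! h using 1
      simp only [Nat.cast_ofNat, Nat.add_one_sub_one, pow_one]
      field_simp
    convert! (hs.const_mul _).sub ((hasDerivAt_id κ).const_mul τ) using 1
    simp
  have h2 : Tendsto (fun n : ℕ => (n : ℝ) * (cosh (v / √n) - 1)) atTop (nhds (v ^ 2 / 2)) := by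
    have h := HasDerivAt.tendsto_mul_sub_of_tendsto_atTop (hasDerivAt_sinh 0) (v / 2) hsn
    have h' := (h.pow 2).const_mul 2
    rw [cosh_zero, show 2 * (1 * (v / 2)) ^ 2 = v ^ 2 / 2 by ring] at h'
    refine h'.congr fun n => ?_
    rw [cosh_sub_one_eq, sinh_zero, mul_pow, sq_sqrt (by positivity), zero_add, sub_zero]
    rw [show v / 2 / √(n : ℝ) = v / √n / 2 by ring]
    ring
  have h3 : Tendsto (fun n : ℕ => √(1 + (κ + σ / n) ^ 2)) atTop (nhds √(1 + κ ^ 2)) := by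
    have h : Tendsto (fun n : ℕ => κ + σ / n) atTop (nhds (κ + 0)) :=
      (tendsto_const_div_atTop_nhds_zero_nat σ).const_add κ
    rw [add_zero] at h
    exact (continuous_sqrt.tendsto _).comp ((h.pow 2).const_add 1)
  have h4 : Tendsto (fun n : ℕ => (n : ℝ) *
      (corrKernel τ (κ + σ / n) (v / √n) / corrKernel τ κ 0 - 1)) atTop
      (nhds (slopeRate τ κ * σ + curvatureRate τ κ / 2 * v ^ 2)) := by
    have h := (h1.add (((h3.const_mul √(1 + τ ^ 2))).mul h2)).div_const (corrKernel τ κ 0)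
    have e : ((√(1 + τ ^ 2) * (κ / √(1 + κ ^ 2)) - τ) * σ
        + √(1 + τ ^ 2) * √(1 + κ ^ 2) * (v ^ 2 / 2)) / corrKernel τ κ 0
        = slopeRate τ κ * σ + curvatureRate τ κ / 2 * v ^ 2 := by
      rw [slopeRate, curvatureRate]
      ring
    rw [e] at h
    refine h.congr fun n => ?_
    rw [corrKernel_eq_add τ (κ + σ / n) (v / √n)]
    field_simp
    ring
  have h5 := (tendsto_one_add_pow_exp_of_tendsto h4).inv₀ (exp_ne_zero _)
  rw [← exp_neg, show -(slopeRate τ κ * σ + curvatureRate τ κ / 2 * v ^ 2)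
    = -(slopeRate τ κ * σ) + -(curvatureRate τ κ / 2) * v ^ 2 by ring, exp_add] at h5
  refine h5.congr fun n => ?_
  simp [scaledKernel]

lemma one_add_div_four_pow_le {x : ℝ} (hx : 0 ≤ x) {n : ℕ} (hn : 4 ≤ n) :
    (1 + x / 4) ^ 4 ≤ (1 + x / n) ^ n := by
  have hn' : (4 : ℝ) ≤ n := by exact_mod_cast hn
  have hxn : 0 ≤ x / n := by positivity
  have h := one_add_mul_self_le_rpow_one_add (s := x / n) (by linarith) (p := n / 4)
    (by rw [le_div_iff₀ (by norm_num)]; linarith)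
  have e : (n : ℝ) / 4 * (x / n) = x / 4 := by field_simp
  rw [e] at h
  calc (1 + x / 4) ^ 4 ≤ ((1 + x / n) ^ ((n : ℝ) / 4)) ^ 4 := by gcongr
    _ = (1 + x / n) ^ n := by
      rw [← rpow_natCast, ← rpow_mul (by positivity), ← rpow_natCast]
      congr 1
      push_cast
      ring

lemma scaledKernel_le (hτ : 0 ≤ τ) (hκ : τ < κ) {n : ℕ} (hn : 4 ≤ n) {σ : ℝ} (hσ : 0 ≤ σ) (v : ℝ) :
    scaledKernel τ κ n (σ, v) ≤ (1 + (slopeRate τ κ / 4 * σ) ^ 2)⁻¹ *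
      (1 + (√(curvatureRate τ κ) / 2 * v) ^ 2)⁻¹ := by
  have hα := slopeRate_pos hτ hκ
  have hβ := curvatureRate_pos τ κ
  have hn0 : (0 : ℝ) < n := by
    have : 0 < n := by omega
    exact_mod_cast this
  rw [scaledKernel, ← mul_inv]
  refine inv_anti₀ (by positivity) ?_
  have h := one_add_le_corrKernel_div (τ := τ) (hτ.trans hκ.le)
    (s := κ + σ / n) (by linarith [div_nonneg hσ hn0.le]) (v / √n)
  have hx : 0 ≤ slopeRate τ κ * σ + curvatureRate τ κ * (v ^ 2 / 2) := by positivity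
  have e : slopeRate τ κ * (κ + σ / n - κ) + curvatureRate τ κ * ((v / √n) ^ 2 / 2)
      = (slopeRate τ κ * σ + curvatureRate τ κ * (v ^ 2 / 2)) / n := by
    rw [div_pow, sq_sqrt hn0.le]
    field_simp
    ring
  rw [e] at h
  refine le_trans ?_ ((one_add_div_four_pow_le hx hn).trans (pow_le_pow_left₀ (by positivity) h n))
  have e2 : (√(curvatureRate τ κ) / 2 * v) ^ 2 = curvatureRate τ κ * (v ^ 2 / 2) / 2 := by
    rw [mul_pow, div_pow, sq_sqrt hβ.le]
    ring
  rw [e2]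
  set a := slopeRate τ κ * σ with ha
  have ha0 : 0 ≤ a := by positivity
  set b := curvatureRate τ κ * (v ^ 2 / 2)
  have hb0 : 0 ≤ b := by positivity
  have e3 : slopeRate τ κ / 4 * σ = a / 4 := by rw [ha]; ring
  rw [e3]
  calc (1 + (a / 4) ^ 2) * (1 + b / 2) ≤ (1 + a / 4) ^ 2 * (1 + b / 4) ^ 2 := by
        gcongr
        · nlinarith
        · nlinarith
    _ ≤ (1 + (a + b) / 4) ^ 2 * (1 + (a + b) / 4) ^ 2 := by
        gcongr <;> linarith
    _ = _ := by ring

lemma tendsto_lintegral_scaledKernel (hτ : 0 ≤ τ) (hκ : τ < κ) :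
    Tendsto (fun n : ℕ => ∫⁻ q, ENNReal.ofReal (scaledKernel τ κ n q)
        ∂((volume.restrict (Set.Ioi (0 : ℝ))).prod (volume : Measure ℝ))) atTop
      (nhds (ENNReal.ofReal ((slopeRate τ κ)⁻¹ * √(2 * π / curvatureRate τ κ)))) := by
  have hα := slopeRate_pos hτ hκ
  have hβ := curvatureRate_pos τ κ
  have hpos : ∀ᵐ q ∂((volume.restrict (Set.Ioi (0 : ℝ))).prod (volume : Measure ℝ)), 0 < q.1 :=
    Measure.quasiMeasurePreserving_fst.ae (ae_restrict_mem measurableSet_Ioi)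
  have hlim : ∫⁻ q, ENNReal.ofReal
      (exp (-(slopeRate τ κ * q.1)) * exp (-(curvatureRate τ κ / 2) * q.2 ^ 2))
        ∂((volume.restrict (Set.Ioi (0 : ℝ))).prod (volume : Measure ℝ))
      = ENNReal.ofReal ((slopeRate τ κ)⁻¹ * √(2 * π / curvatureRate τ κ)) := by
    have i1 : IntegrableOn (fun σ : ℝ => exp (-(slopeRate τ κ * σ))) (Set.Ioi 0) := by
      simpa using exp_neg_integrableOn_Ioi 0 hα
    have i2 : Integrable fun v : ℝ => exp (-(curvatureRate τ κ / 2) * v ^ 2) :=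
      integrable_exp_neg_mul_sq (by positivity)
    rw [← ofReal_integral_eq_lintegral_ofReal (Integrable.mul_prod i1 i2)
      (Eventually.of_forall fun q => by positivity)]
    rw [integral_prod_mul (fun σ => exp (-(slopeRate τ κ * σ)))
      (fun v => exp (-(curvatureRate τ κ / 2) * v ^ 2)), integral_gaussian]
    have h := integral_exp_mul_Ioi (neg_lt_zero.2 hα) 0
    simp only [neg_mul, mul_zero, exp_zero] at h
    rw [h]
    congr 2
    · rw [neg_div_neg_eq, one_div]
    · congr 1
      field_simp
  rw [← hlim]
  refine tendsto_lintegral_filter_of_dominated_convergence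
    (fun q => ENNReal.ofReal ((1 + (slopeRate τ κ / 4 * q.1) ^ 2)⁻¹ *
      (1 + (√(curvatureRate τ κ) / 2 * q.2) ^ 2)⁻¹)) ?_ ?_ ?_ ?_
  · refine Eventually.of_forall fun n => ?_
    unfold scaledKernel corrKernel
    fun_prop
  · filter_upwards [eventually_ge_atTop 4] with n hn
    filter_upwards [hpos] with q hq
    exact ENNReal.ofReal_le_ofReal (scaledKernel_le hτ hκ hn hq.le q.2)
  · have i1 : Integrable (fun σ : ℝ => (1 + (slopeRate τ κ / 4 * σ) ^ 2)⁻¹)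
        (volume.restrict (Set.Ioi 0)) :=
      (integrable_inv_one_add_sq.comp_mul_left' (by positivity)).restrict
    have i2 : Integrable fun v : ℝ => (1 + (√(curvatureRate τ κ) / 2 * v) ^ 2)⁻¹ :=
      integrable_inv_one_add_sq.comp_mul_left' (by positivity)
    exact (Integrable.mul_prod i1 i2).lintegral_lt_top.ne
  · exact Eventually.of_forall fun q =>
      (ENNReal.continuous_ofReal.tendsto _).comp (tendsto_scaledKernel τ κ q.1 q.2)

lemma lintegral_Ioi_eq_lintegral_add_div (κ : ℝ) {r : ℝ} (hr : 0 < r) (g : ℝ → ℝ≥0∞) :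
    ∫⁻ s in Set.Ioi κ, g s = ENNReal.ofReal r⁻¹ * ∫⁻ σ in Set.Ioi (0 : ℝ), g (κ + σ / r) := by
  have e : Set.Ioi κ = (fun σ => κ + σ / r) '' Set.Ioi 0 := by
    ext s
    constructor
    · intro hs
      refine ⟨(s - κ) * r, mul_pos (sub_pos.2 hs) hr, ?_⟩
      field_simp
      ring
    · rintro ⟨σ, hσ, rfl⟩
      exact lt_add_of_pos_right _ (div_pos hσ hr)
  rw [e, lintegral_image_eq_lintegral_abs_deriv_mul (f' := fun _ => r⁻¹) measurableSet_Ioi,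
    lintegral_const_mul' _ _ ENNReal.ofReal_ne_top, abs_of_pos (by positivity)]
  · intro σ _
    simpa using (((hasDerivAt_id σ).div_const r).const_add κ).hasDerivWithinAt
  · intro σ _ σ' _ h
    have : σ / r = σ' / r := add_left_cancel h
    exact (div_left_inj' hr.ne').1 this

lemma lintegral_eq_lintegral_div {r : ℝ} (hr : 0 < r) (g : ℝ → ℝ≥0∞) :
    ∫⁻ w, g w = ENNReal.ofReal r⁻¹ * ∫⁻ v, g (v / r) := by
  have e : (Set.univ : Set ℝ) = (fun v => v / r) '' Set.univ := by
    rw [Set.image_univ, eq_comm, Set.range_eq_univ]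
    exact fun w => ⟨w * r, by field_simp⟩
  rw [← setLIntegral_univ, e,
    lintegral_image_eq_lintegral_abs_deriv_mul (f' := fun _ => r⁻¹) MeasurableSet.univ,
    lintegral_const_mul' _ _ ENNReal.ofReal_ne_top, abs_of_pos (by positivity), setLIntegral_univ]
  · intro v _
    simpa using (hasDerivAt_id v).div_const r
  · intro v _ v' _ h
    exact (div_left_inj' hr.ne').1 h

lemma lintegral_corrKernel_eq (τ κ : ℝ) {n : ℕ} (hn : 0 < n) :
    ∫⁻ s in Set.Ioi κ, ∫⁻ w, ENNReal.ofReal ((corrKernel τ s w ^ n)⁻¹)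
      = ENNReal.ofReal (((n : ℝ) * √n * corrKernel τ κ 0 ^ n)⁻¹) *
        ∫⁻ q, ENNReal.ofReal (scaledKernel τ κ n q)
          ∂((volume.restrict (Set.Ioi (0 : ℝ))).prod (volume : Measure ℝ)) := by
  have hn' : (0 : ℝ) < n := by exact_mod_cast hn
  have hD := corrKernel_pos τ κ 0
  have hs : 0 < √(n : ℝ) := sqrt_pos.2 hn'
  rw [lintegral_Ioi_eq_lintegral_add_div κ hn', lintegral_prod _ (by
    unfold scaledKernel corrKernel; fun_prop)]
  rw [← lintegral_const_mul' _ _ ENNReal.ofReal_ne_top,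
    ← lintegral_const_mul' _ _ ENNReal.ofReal_ne_top]
  refine lintegral_congr fun σ => ?_
  rw [lintegral_eq_lintegral_div hs, ← mul_assoc, ← ENNReal.ofReal_mul (by positivity),
    ← lintegral_const_mul' _ _ ENNReal.ofReal_ne_top,
    ← lintegral_const_mul' _ _ ENNReal.ofReal_ne_top]
  refine lintegral_congr fun v => ?_
  rw [← ENNReal.ofReal_mul (by positivity), ← ENNReal.ofReal_mul (by positivity)]
  congr 1
  rw [scaledKernel, div_pow]
  have := corrKernel_pos τ (κ + σ / n) (v / √n)
  field_simp

end

lemma sqrt_one_add_div_sqrt_sq {x : ℝ} (hx : 0 < 1 - x ^ 2) :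
    √(1 + (x / √(1 - x ^ 2)) ^ 2) = (√(1 - x ^ 2))⁻¹ := by
  rw [div_pow, sq_sqrt hx.le, ← sqrt_inv]
  congr 1
  field_simp
  ring

lemma corrKernel_div_sqrt {ρ c : ℝ} (hρ : 0 < 1 - ρ ^ 2) (hc : 0 < 1 - c ^ 2) :
    corrKernel (ρ / √(1 - ρ ^ 2)) (c / √(1 - c ^ 2)) 0
      = (1 - ρ * c) / (√(1 - ρ ^ 2) * √(1 - c ^ 2)) := by
  have hp := sqrt_pos.2 hρ
  have hq := sqrt_pos.2 hc
  rw [corrKernel, sqrt_one_add_div_sqrt_sq hρ, sqrt_one_add_div_sqrt_sq hc, cosh_zero]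
  field_simp

lemma curvatureRate_div_sqrt {ρ c : ℝ} (hρ : 0 < 1 - ρ ^ 2) (hc : 0 < 1 - c ^ 2) :
    curvatureRate (ρ / √(1 - ρ ^ 2)) (c / √(1 - c ^ 2)) = (1 - ρ * c)⁻¹ := by
  have hp := sqrt_pos.2 hρ
  have hq := sqrt_pos.2 hc
  rw [curvatureRate, corrKernel_div_sqrt hρ hc, sqrt_one_add_div_sqrt_sq hρ,
    sqrt_one_add_div_sqrt_sq hc]
  field_simp

lemma slopeRate_div_sqrt {ρ c : ℝ} (hρ : 0 < 1 - ρ ^ 2) (hc : 0 < 1 - c ^ 2) :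
    slopeRate (ρ / √(1 - ρ ^ 2)) (c / √(1 - c ^ 2))
      = (c - ρ) * √(1 - c ^ 2) / (1 - ρ * c) := by
  have hp := sqrt_pos.2 hρ
  have hq := sqrt_pos.2 hc
  rw [slopeRate, corrKernel_div_sqrt hρ hc, sqrt_one_add_div_sqrt_sq hρ,
    sqrt_one_add_div_sqrt_sq hc]
  field_simp

lemma gbar_eq {ρ c : ℝ} (hρ : 0 < 1 - ρ ^ 2) (hρc : 0 < 1 - ρ * c) :
    gbar ρ c = (1 - ρ * c) * √(1 - ρ * c) / (√(1 - ρ ^ 2) * (1 - c ^ 2) ^ 2) := by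
  have h : (1 - ρ * c) ^ ((3 : ℝ) / 2) = (1 - ρ * c) * √(1 - ρ * c) := by
    rw [show (3 : ℝ) / 2 = 1 + 1 / 2 by norm_num, rpow_add hρc, rpow_one, ← sqrt_eq_rpow]
  rw [gbar, h, rpow_neg hρ.le, ← sqrt_eq_rpow, div_eq_mul_inv, mul_inv]
  ring

lemma tendsto_gaussPair_pearson_ge_mul {ρ c : ℝ} (hρ : 0 ≤ ρ) (hρc : ρ < c) (hc : c < 1) :
    Tendsto (fun n : ℕ => (gaussPair n {ω | c ≤ pearson ρ n ω}).toReal * √n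
        * ((1 - ρ * c) / (√(1 - ρ ^ 2) * √(1 - c ^ 2))) ^ n) atTop
      (nhds ((1 - ρ * c) ^ 2 * √(1 - ρ * c)
        / (√(1 - ρ ^ 2) * (1 - c ^ 2) * (c - ρ) * √(2 * π)))) := by
  have hp2 : 0 < 1 - ρ ^ 2 := by nlinarith
  have hq2 : 0 < 1 - c ^ 2 := by nlinarith
  have hu : 0 < 1 - ρ * c := by nlinarith
  have hp := sqrt_pos.2 hp2
  have hq := sqrt_pos.2 hq2
  have hτ : 0 ≤ ρ / √(1 - ρ ^ 2) := by positivity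
  have hτκ : ρ / √(1 - ρ ^ 2) < c / √(1 - c ^ 2) :=
    div_lt_div₀ hρc (sqrt_le_sqrt (by nlinarith)) (by linarith) hq
  have hJ := (ENNReal.tendsto_toReal ENNReal.ofReal_ne_top).comp
    (tendsto_lintegral_scaledKernel hτ hτκ)
  set D := (1 - ρ * c) / (√(1 - ρ ^ 2) * √(1 - c ^ 2)) with hDdef
  have hD : 0 < D := by positivity
  set J : ℕ → ℝ≥0∞ := fun n => ∫⁻ q, ENNReal.ofReal
    (scaledKernel (ρ / √(1 - ρ ^ 2)) (c / √(1 - c ^ 2)) n q)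
      ∂((volume.restrict (Set.Ioi (0 : ℝ))).prod (volume : Measure ℝ)) with hJdef
  have hα := slopeRate_pos hτ hτκ
  have hβ := curvatureRate_pos (ρ / √(1 - ρ ^ 2)) (c / √(1 - c ^ 2))
  rw [ENNReal.toReal_ofReal (by positivity), curvatureRate_div_sqrt hp2 hq2,
    slopeRate_div_sqrt hp2 hq2] at hJ
  rw [← tendsto_add_atTop_iff_nat 3]
  have hP : ∀ m : ℕ, (gaussPair (m + 3) {ω | c ≤ pearson ρ (m + 3) ω}).toReal * √((m + 3 : ℕ) : ℝ)
      * D ^ (m + 3) = D / (2 * π) * ((((m : ℝ) + 1) / (m + 2)) * √(((m : ℝ) + 3) / (m + 2)))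
        * (J (m + 2)).toReal := by
    intro m
    rw [gaussPair_pearson_ge_eq m hp2 (hρ.trans_lt hρc) hc,
      lintegral_corrKernel_eq _ _ (by omega : 0 < m + 2), corrKernel_div_sqrt hp2 hq2, ← hDdef,
      ENNReal.toReal_mul, ENNReal.toReal_mul, ENNReal.toReal_ofReal (by positivity),
      ENNReal.toReal_ofReal (by positivity), sqrt_div (by positivity)]
    push_cast
    rw [pow_succ D (m + 2)]
    have : 0 < √((m : ℝ) + 2) := by positivity
    field_simp
    simp [hJdef]
  simp_rw [hP]
  have hN : Tendsto (fun m : ℕ => (m : ℝ) + 2) atTop atTop :=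
    tendsto_atTop_add_const_right _ _ tendsto_natCast_atTop_atTop
  have hi := hN.inv_tendsto_atTop
  have h1 : Tendsto (fun m : ℕ => ((m : ℝ) + 1) / (m + 2)) atTop (nhds 1) := by
    have := (tendsto_const_nhds (x := (1 : ℝ))).sub hi
    rw [sub_zero] at this
    refine this.congr fun m => ?_
    have : (m : ℝ) + 2 ≠ 0 := by positivity
    simp only [Pi.inv_apply]
    field_simp
    ring
  have h2 : Tendsto (fun m : ℕ => √(((m : ℝ) + 3) / (m + 2))) atTop (nhds 1) := by
    have := ((tendsto_const_nhds (x := (1 : ℝ))).add hi).sqrt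
    rw [add_zero, sqrt_one] at this
    refine this.congr fun m => ?_
    have : (m : ℝ) + 2 ≠ 0 := by positivity
    simp only [Pi.inv_apply]
    congr 1
    field_simp
    ring
  have hJ2 : Tendsto (fun m : ℕ => (J (m + 2)).toReal) atTop _ :=
    hJ.comp (tendsto_add_atTop_nat 2)
  have hlim := ((h1.mul h2).const_mul (D / (2 * π))).mul hJ2
  convert! hlim using 2
  have e : √(2 * π / (1 - ρ * c)⁻¹) = √(2 * π) * √(1 - ρ * c) := by
    rw [div_inv_eq_mul, sqrt_mul (by positivity)]
  have hs : √(2 * π) ^ 2 = 2 * π := sq_sqrt (by positivity)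
  have hs0 : 0 < √(2 * π) := by positivity
  have hcρ : 0 < c - ρ := sub_pos.2 hρc
  have hqq : √(1 - c ^ 2) ^ 2 = 1 - c ^ 2 := sq_sqrt hq2.le
  rw [e, hDdef]
  nth_rewrite 2 [← hs]
  field_simp
  rw [hqq]

theorem stmt_13 (ρ c : ℝ) (hρ : 0 ≤ ρ) (hρc : ρ < c) (hc : c < 1)
    (hρ0 : ρ ≤ Real.sqrt (3 + 2 * Real.sqrt 3) / 3) :
    ∃ ε : ℕ → ℝ, Tendsto ε atTop (nhds 0) ∧
      ∀ᶠ n : ℕ in atTop,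
        (gaussPair n {ω | c ≤ pearson ρ n ω}).toReal
          = gbar ρ c /
                Real.sqrt |ρ ^ 2 / (1 - ρ * c) ^ 2 - (1 + c ^ 2) / (1 - c ^ 2) ^ 2|
              * (Real.sqrt (1 - ρ ^ 2) * Real.sqrt (1 - c ^ 2) / (1 - ρ * c)) ^ n
              / ((c / (1 - c ^ 2) - ρ / (1 - ρ * c))
                  * Real.sqrt
                      (1 / |ρ ^ 2 / (1 - ρ * c) ^ 2 - (1 + c ^ 2) / (1 - c ^ 2) ^ 2|)
                  * Real.sqrt (2 * π * n))
              * (1 + ε n) := by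
  have hp2 : 0 < 1 - ρ ^ 2 := by nlinarith
  have hq2 : 0 < 1 - c ^ 2 := by nlinarith
  have hu : 0 < 1 - ρ * c := by nlinarith
  have hp := sqrt_pos.2 hp2
  have hq := sqrt_pos.2 hq2
  have hcρ : 0 < c - ρ := sub_pos.2 hρc
  have hH : 0 < |ρ ^ 2 / (1 - ρ * c) ^ 2 - (1 + c ^ 2) / (1 - c ^ 2) ^ 2| := by
    rw [abs_pos, sub_ne_zero]
    refine ne_of_lt ?_
    have h : ρ / (1 - ρ * c) ≤ c / (1 - c ^ 2) := by
      rw [div_le_div_iff₀ hu hq2]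
      nlinarith
    calc ρ ^ 2 / (1 - ρ * c) ^ 2 = (ρ / (1 - ρ * c)) ^ 2 := (div_pow _ _ _).symm
      _ ≤ (c / (1 - c ^ 2)) ^ 2 := by gcongr
      _ = c ^ 2 / (1 - c ^ 2) ^ 2 := div_pow _ _ _
      _ < (1 + c ^ 2) / (1 - c ^ 2) ^ 2 := by gcongr; linarith
  set H := |ρ ^ 2 / (1 - ρ * c) ^ 2 - (1 + c ^ 2) / (1 - c ^ 2) ^ 2|
  have hlim := tendsto_gaussPair_pearson_ge_mul hρ hρc hc
  set L := (1 - ρ * c) ^ 2 * √(1 - ρ * c) / (√(1 - ρ ^ 2) * (1 - c ^ 2) * (c - ρ) * √(2 * π))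
    with hL
  have hL0 : 0 < L := by positivity
  refine ⟨fun n => (gaussPair n {ω | c ≤ pearson ρ n ω}).toReal * √n
        * ((1 - ρ * c) / (√(1 - ρ ^ 2) * √(1 - c ^ 2))) ^ n / L - 1, ?_, ?_⟩
  · have := (hlim.div_const L).sub_const 1
    rwa [div_self hL0.ne', sub_self] at this
  filter_upwards [eventually_gt_atTop 0] with n hn
  have hn' : (0 : ℝ) < √n := sqrt_pos.2 (by exact_mod_cast hn)
  have hH' := sqrt_pos.2 hH
  have hlam : c / (1 - c ^ 2) - ρ / (1 - ρ * c) = (c - ρ) / ((1 - c ^ 2) * (1 - ρ * c)) := by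
    rw [div_sub_div _ _ hq2.ne' hu.ne']
    ring
  have hpi : 0 < √(2 * π) := by positivity
  have hv : 0 < 1 - c * ρ := by linarith
  have hv' := sqrt_pos.2 hv
  rw [gbar_eq hp2 hu, hlam, sqrt_div zero_le_one, sqrt_one, sqrt_mul (by positivity), hL,
    add_sub_cancel, div_pow, div_pow]
  field_simp
end

section
/- Let X = (X_1,…,X_n) and Y = (Y_1,…,Y_n) be two independent standard Gaussian random vectors in ℝⁿ and set r̃_n = Σ_i X_i Y_i / √(Σ_i X_i² · Σ_i Y_i²). Then for every c ∈ (0,1), as n → ∞, P(r̃_n ≥ c) = (1-c²)^{n/2} · (1+4λ_c²)^{-1/4} · ((1+√(1+4λ_c²))/2) / (λ_c σ_c √(2πn)) · (1 + o(1)), where λ_c = c/(1-c²), σ_c = (1-c²)/√(1+c²), and (1-c²)^{n/2} = e^{-n L*(c)} with L*(c) = -(1/2) log(1-c²). -/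
open Real Filter MeasureTheory ProbabilityTheory

/-- The known-expectation empirical correlation coefficient
`r̃ₙ = ⟨X,Y⟩/(‖X‖‖Y‖)`. -/
noncomputable def rtilde (n : ℕ) (ω : (Fin n → ℝ) × (Fin n → ℝ)) : ℝ :=
  (∑ i, ω.1 i * ω.2 i) / Real.sqrt ((∑ i, ω.1 i ^ 2) * (∑ i, ω.2 i ^ 2))

lemma integrable_one_add_sq_rpow_neg {p : ℝ} (hp : 1 / 2 < p) :
    Integrable fun t : ℝ => (1 + t ^ 2) ^ (-p) := by
  have := integrable_rpow_neg_one_add_norm_sq (E := ℝ) (μ := volume) (r := 2 * p)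
    (by simp; linarith)
  simpa [neg_div] using this

lemma tendsto_one_add_sq_rpow_atTop {q : ℝ} (hq : q < 0) :
    Tendsto (fun t : ℝ => (1 + t ^ 2) ^ q) atTop (nhds 0) := by
  have h := tendsto_rpow_neg_atTop (neg_pos.2 hq)
  simp only [neg_neg] at h
  exact h.comp (tendsto_atTop_add_const_left _ _ (tendsto_pow_atTop two_ne_zero))

lemma hasDerivAt_one_add_sq_rpow {p : ℝ} (hp : 1 < p) (t : ℝ) :
    HasDerivAt (fun t : ℝ => -((1 + t ^ 2) ^ (1 - p) / (2 * (p - 1))))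
      (t * (1 + t ^ 2) ^ (-p)) t := by
  have h1 : HasDerivAt (fun t : ℝ => 1 + t ^ 2) (2 * t) t := by
    simpa using (hasDerivAt_pow 2 t).const_add 1
  have h := ((h1.rpow_const (p := 1 - p) (Or.inl (by positivity))).div_const (2 * (p - 1))).neg
  convert! h using 1
  have : p - 1 ≠ 0 := by linarith
  rw [show 1 - p - 1 = -p by ring]
  field_simp
  ring

lemma setIntegral_Ioi_one_add_sq_rpow_neg_le {a p : ℝ} (ha : 0 < a) (hp : 1 < p) :
    ∫ t in Set.Ioi a, (1 + t ^ 2) ^ (-p) ≤ (1 + a ^ 2) ^ (1 - p) / (2 * (p - 1) * a) := by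
  have hlim : Tendsto (fun t : ℝ => -((1 + t ^ 2) ^ (1 - p) / (2 * (p - 1)))) atTop (nhds 0) := by
    simpa using ((tendsto_one_add_sq_rpow_atTop (q := 1 - p) (by linarith)).div_const
      (2 * (p - 1))).neg
  have hpos : ∀ t ∈ Set.Ioi a, 0 ≤ t * (1 + t ^ 2) ^ (-p) := fun t ht => by
    have : 0 < t := ha.trans ht
    positivity
  have h := integral_Ioi_of_hasDerivAt_of_nonneg' (fun t _ => hasDerivAt_one_add_sq_rpow hp t)
    hpos hlim
  have hi := integrableOn_Ioi_deriv_of_nonneg' (fun t _ => hasDerivAt_one_add_sq_rpow hp t)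
    hpos hlim
  have hle : ∫ t in Set.Ioi a, a * (1 + t ^ 2) ^ (-p) ≤
      ∫ t in Set.Ioi a, t * (1 + t ^ 2) ^ (-p) := by
    refine setIntegral_mono_on
      ((integrable_one_add_sq_rpow_neg (by linarith)).const_mul a).integrableOn hi
      measurableSet_Ioi fun t ht => ?_
    exact mul_le_mul_of_nonneg_right (le_of_lt ht) (by positivity)
  rw [integral_const_mul, h] at hle
  have : 0 < p - 1 := by linarith
  rw [← div_div, le_div_iff₀ ha]
  linarith

lemma le_setIntegral_Ioi_one_add_sq_rpow_neg {a p : ℝ} (ha : 0 < a) (hp : 1 < p) :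
    (1 + a ^ 2) ^ (1 - p) / (2 * (p - 1) * a) ≤
      (1 + (1 + a ^ 2) / a ^ 2 / (2 * (p - 1))) * ∫ t in Set.Ioi a, (1 + t ^ 2) ^ (-p) := by
  have hp' : 0 < p - 1 := by linarith
  have hlim : Tendsto (fun t : ℝ => -((1 + t ^ 2) ^ (1 - p) / (2 * (p - 1))) / t) atTop
      (nhds 0) := by
    have := ((tendsto_one_add_sq_rpow_atTop (q := 1 - p) (by linarith)).div_const
      (2 * (p - 1))).neg
    simpa [div_eq_mul_inv] using this.mul tendsto_inv_atTop_zero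
  have hder : ∀ t ∈ Set.Ici a, HasDerivAt
      (fun t : ℝ => -((1 + t ^ 2) ^ (1 - p) / (2 * (p - 1))) / t)
      ((1 + t ^ 2) ^ (-p) * (1 + (1 + t ^ 2) / t ^ 2 / (2 * (p - 1)))) t := fun t ht => by
    have ht0 : 0 < t := ha.trans_le ht
    convert! (hasDerivAt_one_add_sq_rpow hp t).div (hasDerivAt_id t) ht0.ne' using 1
    rw [show 1 - p = -p + 1 by ring, rpow_add_one (by positivity)]
    simp only [id]
    field_simp
    ring
  have hpos : ∀ t ∈ Set.Ioi a,
      0 ≤ (1 + t ^ 2) ^ (-p) * (1 + (1 + t ^ 2) / t ^ 2 / (2 * (p - 1))) := fun t _ => by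
    positivity
  have h := integral_Ioi_of_hasDerivAt_of_nonneg' hder hpos hlim
  have hi := integrableOn_Ioi_deriv_of_nonneg' hder hpos hlim
  rw [← integral_const_mul]
  have hle : ∫ t in Set.Ioi a, (1 + t ^ 2) ^ (-p) * (1 + (1 + t ^ 2) / t ^ 2 / (2 * (p - 1))) ≤
      ∫ t in Set.Ioi a, (1 + (1 + a ^ 2) / a ^ 2 / (2 * (p - 1))) * (1 + t ^ 2) ^ (-p) := by
    refine setIntegral_mono_on hi
      ((integrable_one_add_sq_rpow_neg (by linarith)).const_mul _).integrableOn
      measurableSet_Ioi fun t ht => ?_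
    have ht0 : 0 < t := ha.trans ht
    have hat : a < t := ht
    rw [mul_comm]
    have hmono : (1 + t ^ 2) / t ^ 2 ≤ (1 + a ^ 2) / a ^ 2 := by
      rw [div_le_div_iff₀ (by positivity) (by positivity)]
      nlinarith
    gcongr
  rw [h] at hle
  refine le_trans (le_of_eq ?_) hle
  field_simp
  ring

lemma tendsto_sqrt_mul_integral_one_add_sq_rpow_neg :
    Tendsto (fun n : ℕ => √n * ∫ t : ℝ, (1 + t ^ 2) ^ (-((n : ℝ) / 2))) atTop
      (nhds √(2 * π)) := by
  have hlim : Tendsto (fun n : ℕ => ∫ s : ℝ, (1 + s ^ 2 / n) ^ (-((n : ℝ) / 2))) atTop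
      (nhds (∫ s : ℝ, exp (-(1 / 2) * s ^ 2))) := by
    refine tendsto_integral_filter_of_dominated_convergence (fun s => (1 + (s / √2) ^ 2)⁻¹)
      (.of_forall fun n => Measurable.aestronglyMeasurable (by fun_prop)) ?_ ?_ (.of_forall fun s => ?_)
    · filter_upwards [eventually_ge_atTop 2] with n hn
      have hn' : (2 : ℝ) ≤ n := by exact_mod_cast hn
      refine .of_forall fun s => ?_
      rw [norm_of_nonneg (by positivity), rpow_neg (by positivity)]
      refine inv_anti₀ (by positivity) ?_
      have h0 : 0 ≤ s ^ 2 / n := by positivity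
      have := one_add_mul_self_le_rpow_one_add (s := s ^ 2 / n) (by linarith)
        (p := (n : ℝ) / 2) (by linarith)
      refine le_trans (le_of_eq ?_) this
      rw [div_pow, sq_sqrt (by norm_num)]
      field_simp
    · exact integrable_inv_one_add_sq.comp_div (by positivity)
    · have h := (tendsto_one_add_div_rpow_exp (s ^ 2)).comp (tendsto_natCast_atTop_atTop (R := ℝ))
      have h2 := h.rpow_const (p := -(1 / 2)) (Or.inl (exp_pos _).ne')
      rw [← exp_mul] at h2
      convert h2 using 2 with n
      · simp only [Function.comp]
        rw [← rpow_mul (by positivity)]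
        ring_nf
      · ring_nf
  rw [integral_gaussian, show π / (1 / 2) = 2 * π by ring] at hlim
  refine hlim.congr' ?_
  filter_upwards [eventually_gt_atTop 0] with n hn
  have hn' : (0 : ℝ) < n := by exact_mod_cast hn
  have := Measure.integral_comp_div (fun t : ℝ => (1 + t ^ 2) ^ (-((n : ℝ) / 2))) √n
  rw [abs_of_nonneg (by positivity), smul_eq_mul] at this
  rw [← this]
  simp [div_pow]

lemma lintegral_fin_prod_eq_prod {n : ℕ} {α : Type*} [MeasurableSpace α] (μ : Fin n → Measure α)
    [∀ i, SigmaFinite (μ i)] {f : α → ENNReal} (hf : Measurable f) :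
    ∫⁻ x, ∏ i, f (x i) ∂(Measure.pi μ) = ∏ i, ∫⁻ x, f x ∂(μ i) := by
  induction n with
  | zero => simp
  | succ n ih =>
    have hp : Measurable fun x : Fin n → α => ∏ i, f (x i) := by fun_prop
    rw [← (measurePreserving_piFinSuccAbove μ 0).symm.lintegral_comp_emb
      (MeasurableEquiv.measurableEmbedding _), Fin.prod_univ_succ, ← ih (fun i => μ i.succ),
      ← lintegral_prod_mul hf.aemeasurable hp.aemeasurable]
    simp [MeasurableEquiv.piFinSuccAbove_symm_apply, Fin.prod_univ_succ]

lemma pi_withDensity {n : ℕ} {α : Type*} [MeasurableSpace α] (μ : Measure α) [SigmaFinite μ]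
    {f : α → ENNReal} (hf : Measurable f) [SigmaFinite (μ.withDensity f)] :
    Measure.pi (fun _ : Fin n => μ.withDensity f) =
      (Measure.pi fun _ : Fin n => μ).withDensity fun x => ∏ i, f (x i) := by
  refine Measure.pi_eq fun s hs => ?_
  rw [withDensity_apply _ (MeasurableSet.univ_pi hs), Measure.restrict_pi_pi,
    lintegral_fin_prod_eq_prod _ hf]
  exact Finset.prod_congr rfl fun i _ => (withDensity_apply _ (hs i)).symm

lemma pi_gaussianReal_eq_withDensity (n : ℕ) :
    Measure.pi (fun _ : Fin n => gaussianReal 0 1) =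
      volume.withDensity fun x : Fin n → ℝ =>
        ENNReal.ofReal (∏ i, gaussianPDFReal 0 1 (x i)) := by
  have h : gaussianReal 0 1 = volume.withDensity (gaussianPDF 0 1) :=
    gaussianReal_of_var_ne_zero _ one_ne_zero
  have : SigmaFinite (volume.withDensity (gaussianPDF 0 1)) := h ▸ inferInstance
  rw [h, pi_withDensity _ (measurable_gaussianPDF 0 1)]
  congr 1
  ext x
  rw [ENNReal.ofReal_prod_of_nonneg fun i _ => gaussianPDFReal_nonneg _ _ _]
  rfl

lemma lintegral_comp_const_smul {E : Type*} [NormedAddCommGroup E] [NormedSpace ℝ E]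
    [FiniteDimensional ℝ E] [MeasurableSpace E] [BorelSpace E] (μ : Measure E)
    [μ.IsAddHaarMeasure] {r : ℝ} (hr : 0 < r) {f : E → ENNReal} (hf : Measurable f) :
    ENNReal.ofReal (r ^ Module.finrank ℝ E) * ∫⁻ x, f (r • x) ∂μ = ∫⁻ x, f x ∂μ := by
  rw [← lintegral_map hf (measurable_const_smul r), Measure.map_addHaar_smul μ hr.ne',
    lintegral_smul_measure, smul_eq_mul, ← mul_assoc, ← ENNReal.ofReal_mul (by positivity),
    abs_of_pos (by positivity), mul_inv_cancel₀ (by positivity), ENNReal.ofReal_one, one_mul]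

lemma gaussianReal_div_mem {q : ℝ} (hq : 0 < q) {T : Set ℝ} (hT : MeasurableSet T) :
    gaussianReal 0 1 {u | u / q ∈ T} =
      ∫⁻ t in T, ENNReal.ofReal (q * gaussianPDFReal 0 1 (q * t)) := by
  have hm : MeasurableSet {u : ℝ | u / q ∈ T} := (measurable_id.div_const q) hT
  rw [gaussianReal_apply _ one_ne_zero, ← lintegral_indicator hm, ← lintegral_indicator hT,
    ← lintegral_comp_const_smul volume hq ((measurable_gaussianPDF 0 1).indicator hm),
    ← lintegral_const_mul _ (by
      exact ((measurable_gaussianPDF 0 1).indicator hm).comp (measurable_const_smul q))]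
  refine lintegral_congr fun t => ?_
  have : q * t / q = t := by field_simp
  by_cases ht : t ∈ T
  · simp [Set.indicator, this, ht, gaussianPDF, ENNReal.ofReal_mul hq.le]
  · simp [Set.indicator, this, ht]

lemma prod_gaussianPDFReal {n : ℕ} (y : Fin n → ℝ) :
    ∏ i, gaussianPDFReal 0 1 (y i) = (√(2 * π))⁻¹ ^ n * exp (-(∑ i, y i ^ 2) / 2) := by
  simp [gaussianPDFReal, Finset.prod_mul_distrib, ← exp_sum, neg_div, Finset.sum_div]

/-- The ratio of a standard Gaussian variable to the norm of an independent standard Gaussian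
vector has, up to normalization, density `(1 + t²)^(-(m + 1)/2)`. -/
lemma exists_pi_gaussianReal_ratio_eq {m : ℕ} (hm : m ≠ 0) :
    ∃ K : ENNReal, ∀ T : Set ℝ, MeasurableSet T →
      Measure.pi (fun _ : Fin (m + 1) => gaussianReal 0 1)
        {y | y 0 / √(∑ i : Fin m, y i.succ ^ 2) ∈ T} =
      K * ∫⁻ t in T, ENNReal.ofReal ((1 + t ^ 2) ^ (-(((m + 1 : ℕ) : ℝ) / 2))) := by
  let w : (Fin m → ℝ) → ENNReal := fun y => ENNReal.ofReal
    (√(∑ i, y i ^ 2) * (√(2 * π))⁻¹ * ∏ i, gaussianPDFReal 0 1 (y i))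
  have hw : Measurable w := by
    have := measurable_gaussianPDFReal 0 1
    fun_prop
  refine ⟨∫⁻ y, w y, fun T hT => ?_⟩
  have hS : MeasurableSet {z : ℝ × (Fin m → ℝ) | z.1 / √(∑ i, z.2 i ^ 2) ∈ T} := by
    have : Measurable fun z : ℝ × (Fin m → ℝ) => z.1 / √(∑ i, z.2 i ^ 2) := by fun_prop
    exact this hT
  have h1 := (measurePreserving_piFinSuccAbove (fun _ : Fin (m + 1) => gaussianReal 0 1)
    0).measure_preimage_equiv {z | z.1 / √(∑ i, z.2 i ^ 2) ∈ T}
  have h2 : (MeasurableEquiv.piFinSuccAbove (fun _ : Fin (m + 1) => ℝ) 0) ⁻¹'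
      {z | z.1 / √(∑ i, z.2 i ^ 2) ∈ T} = {y | y 0 / √(∑ i : Fin m, y i.succ ^ 2) ∈ T} := by
    ext y
    simp [Fin.tail]
  rw [← h2, h1, Measure.prod_apply_symm hS, pi_gaussianReal_eq_withDensity,
    lintegral_withDensity_eq_lintegral_mul _ _ (measurable_measure_prodMk_right hS)]
  rotate_left
  · have := measurable_gaussianPDFReal 0 1
    fun_prop
  have h3 : ∀ᵐ y : Fin m → ℝ, ((fun y : Fin m → ℝ =>
        ENNReal.ofReal (∏ i, gaussianPDFReal 0 1 (y i))) * fun y =>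
        gaussianReal 0 1 ((fun x => (x, y)) ⁻¹'
          {z : ℝ × (Fin m → ℝ) | z.1 / √(∑ i, z.2 i ^ 2) ∈ T})) y =
      ∫⁻ t in T, ENNReal.ofReal (√(∑ i, y i ^ 2) *
        gaussianPDFReal 0 1 (√(∑ i, y i ^ 2) * t) * ∏ i, gaussianPDFReal 0 1 (y i)) := by
    have : Nonempty (Fin m) := ⟨⟨0, Nat.pos_of_ne_zero hm⟩⟩
    have hne : ∀ᵐ y : Fin m → ℝ, y ≠ 0 := by
      simp [ae_iff]
    filter_upwards [hne] with y hy
    have hq : 0 < √(∑ i, y i ^ 2) := by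
      refine sqrt_pos.2 (lt_of_le_of_ne (by positivity) fun h => hy ?_)
      have := (Finset.sum_eq_zero_iff_of_nonneg fun i _ => sq_nonneg (y i)).1 h.symm
      ext i
      simpa using this i (Finset.mem_univ i)
    have hpos : 0 ≤ ∏ i, gaussianPDFReal 0 1 (y i) :=
      Finset.prod_nonneg fun i _ => gaussianPDFReal_nonneg _ _ _
    simp only [Pi.mul_apply, Set.preimage_ofPred_eq]
    rw [gaussianReal_div_mem hq hT, ← lintegral_const_mul _ (by
      have := measurable_gaussianPDFReal 0 1
      fun_prop)]
    refine lintegral_congr fun t => ?_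
    rw [← ENNReal.ofReal_mul hpos, mul_comm]
  rw [lintegral_congr_ae h3, lintegral_lintegral_swap (by
    have := measurable_gaussianPDFReal 0 1
    fun_prop), ← lintegral_const_mul _ (by fun_prop)]
  refine lintegral_congr fun t => ?_
  have hr : 0 < √(1 + t ^ 2) := sqrt_pos.2 (by positivity)
  have h4 := lintegral_comp_const_smul volume hr hw
  rw [Module.finrank_fintype_fun_eq_card, Fintype.card_fin] at h4
  have hA : ENNReal.ofReal (√(1 + t ^ 2) ^ (m + 1)) *
      ENNReal.ofReal ((1 + t ^ 2) ^ (-(((m + 1 : ℕ) : ℝ) / 2))) = 1 := by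
    rw [← ENNReal.ofReal_mul (by positivity), ← rpow_natCast, sqrt_eq_rpow,
      ← rpow_mul (by positivity), ← rpow_add (by positivity)]
    ring_nf
    simp
  have h5 : ∀ y : Fin m → ℝ, w (√(1 + t ^ 2) • y) = ENNReal.ofReal √(1 + t ^ 2) *
      ENNReal.ofReal (√(∑ i, y i ^ 2) *
        gaussianPDFReal 0 1 (√(∑ i, y i ^ 2) * t) * ∏ i, gaussianPDFReal 0 1 (y i)) := by
    intro y
    have hs : 0 ≤ ∑ i, y i ^ 2 := by positivity
    simp only [w]
    rw [← ENNReal.ofReal_mul hr.le, prod_gaussianPDFReal, prod_gaussianPDFReal]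
    simp only [Pi.smul_apply, smul_eq_mul, mul_pow, ← Finset.mul_sum]
    rw [sq_sqrt (by positivity), sqrt_mul (by positivity)]
    simp only [gaussianPDFReal, sub_zero, NNReal.coe_one, mul_one, mul_pow, sq_sqrt hs]
    rw [show -((1 + t ^ 2) * ∑ i, y i ^ 2) / 2 = -((∑ i, y i ^ 2) * t ^ 2) / 2 +
      -(∑ i, y i ^ 2) / 2 by ring, exp_add]
    ring_nf
  simp_rw [h5] at h4
  rw [lintegral_const_mul _ (by
    have := measurable_gaussianPDFReal 0 1
    fun_prop), ← mul_assoc, ← ENNReal.ofReal_mul (by positivity), ← pow_succ] at h4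
  rw [← h4, mul_comm, ← mul_assoc, mul_comm (ENNReal.ofReal _), hA, one_mul]

lemma stdGaussian_le_inner_div_norm_eq {E : Type*} [NormedAddCommGroup E] [InnerProductSpace ℝ E]
    [FiniteDimensional ℝ E] [MeasurableSpace E] [BorelSpace E] (c : ℝ) {u e : E}
    (hue : ‖u‖ = ‖e‖) :
    stdGaussian E {y | c ≤ inner ℝ u y / ‖y‖} = stdGaussian E {y | c ≤ inner ℝ e y / ‖y‖} := by
  let f : E ≃ₗᵢ[ℝ] E := (Submodule.span ℝ {u - e})ᗮ.reflection
  have hf : f u = e := Submodule.reflection_sub hue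
  have hmeas : MeasurableSet {y : E | c ≤ inner ℝ e y / ‖y‖} :=
    measurableSet_le measurable_const (by fun_prop)
  conv_rhs => rw [← stdGaussian_map f]
  rw [Measure.map_apply (by fun_prop) hmeas]
  congr 1
  ext v
  simp only [Set.preimage_ofPred_eq, ← hf, LinearIsometryEquiv.inner_map_map,
    LinearIsometryEquiv.norm_map]

lemma pi_gaussianReal_le_inner_div_norm_eq {ι : Type*} [Fintype ι] (c : ℝ)
    (v : EuclideanSpace ℝ ι) :
    Measure.pi (fun _ : ι => gaussianReal 0 1) {y | c ≤ (∑ i, v i * y i) / √(∑ i, y i ^ 2)} =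
      stdGaussian (EuclideanSpace ℝ ι) {y | c ≤ inner ℝ v y / ‖y‖} := by
  rw [← map_pi_eq_stdGaussian, Measure.map_apply (by fun_prop)
    (measurableSet_le measurable_const (by fun_prop))]
  congr 1
  ext y
  simp [EuclideanSpace.norm_eq, PiLp.inner_apply, mul_comm]

lemma pi_gaussianReal_correlation_eq {m : ℕ} (c : ℝ) {x : Fin (m + 1) → ℝ} (hx : x ≠ 0) :
    Measure.pi (fun _ : Fin (m + 1) => gaussianReal 0 1)
        {y | c ≤ (∑ i, x i * y i) / √((∑ i, x i ^ 2) * ∑ i, y i ^ 2)} =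
      Measure.pi (fun _ : Fin (m + 1) => gaussianReal 0 1) {y | c ≤ y 0 / √(∑ i, y i ^ 2)} := by
  let X : EuclideanSpace ℝ (Fin (m + 1)) := WithLp.toLp 2 x
  have hX : ‖X‖ ≠ 0 := norm_ne_zero_iff.2 fun h => hx (by simpa [X] using h)
  have hn : ‖X‖ = √(∑ i, x i ^ 2) := by simp [EuclideanSpace.norm_eq, X]
  have hue : ‖‖X‖⁻¹ • X‖ = ‖(EuclideanSpace.single 0 1 : EuclideanSpace ℝ (Fin (m + 1)))‖ := by
    simp [norm_smul, hX]
  have h := stdGaussian_le_inner_div_norm_eq c hue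
  rw [← pi_gaussianReal_le_inner_div_norm_eq, ← pi_gaussianReal_le_inner_div_norm_eq] at h
  convert h using 5 with y y
  · rw [hn, sqrt_mul (by positivity), ← div_div, Finset.sum_div]
    simp [X, div_eq_inv_mul, mul_assoc]
  · simp

lemma ae_pi_gaussianReal_ne_zero {m : ℕ} (hm : m ≠ 0) :
    ∀ᵐ x ∂(Measure.pi fun _ : Fin m => gaussianReal 0 1), x ≠ 0 := by
  have : Nonempty (Fin m) := ⟨⟨0, Nat.pos_of_ne_zero hm⟩⟩
  rw [pi_gaussianReal_eq_withDensity]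
  have h : ∀ᵐ x : Fin m → ℝ, x ≠ 0 := by simp [ae_iff]
  exact (withDensity_absolutelyContinuous _ _).ae_le h

lemma gaussPair_le_rtilde {m : ℕ} (c : ℝ) :
    gaussPair (m + 1) {ω | c ≤ rtilde (m + 1) ω} =
      Measure.pi (fun _ : Fin (m + 1) => gaussianReal 0 1) {y | c ≤ y 0 / √(∑ i, y i ^ 2)} := by
  have hS : MeasurableSet {ω | c ≤ rtilde (m + 1) ω} :=
    measurableSet_le measurable_const (by unfold rtilde; fun_prop)
  rw [gaussPair, Measure.prod_apply hS]
  have h : ∀ᵐ x ∂(Measure.pi fun _ : Fin (m + 1) => gaussianReal 0 1),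
      Measure.pi (fun _ : Fin (m + 1) => gaussianReal 0 1)
        (Prod.mk x ⁻¹' {ω | c ≤ rtilde (m + 1) ω}) =
      Measure.pi (fun _ : Fin (m + 1) => gaussianReal 0 1) {y | c ≤ y 0 / √(∑ i, y i ^ 2)} := by
    filter_upwards [ae_pi_gaussianReal_ne_zero m.succ_ne_zero] with x hx
    exact pi_gaussianReal_correlation_eq c hx
  rw [lintegral_congr_ae h, lintegral_const, measure_univ, mul_one]

lemma le_div_sqrt_add_sq_iff {c u s : ℝ} (hc : c ∈ Set.Ioo (0 : ℝ) 1) (hs : 0 < s) :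
    c ≤ u / √(u ^ 2 + s) ↔ c / √(1 - c ^ 2) ≤ u / √s := by
  obtain ⟨hc0, hc1⟩ := hc
  have h1 : 0 < 1 - c ^ 2 := by nlinarith
  rw [le_div_iff₀ (by positivity), div_le_div_iff₀ (by positivity) (by positivity),
    show c * √(u ^ 2 + s) = √(c ^ 2 * (u ^ 2 + s)) by
      rw [sqrt_mul (by positivity), sqrt_sq hc0.le],
    show c * √s = √(c ^ 2 * s) by rw [sqrt_mul (by positivity), sqrt_sq hc0.le],
    sqrt_le_iff, sqrt_le_iff, mul_nonneg_iff_of_pos_right (sqrt_pos.2 h1), mul_pow,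
    sq_sqrt h1.le]
  exact and_congr_right fun _ => ⟨fun h => by nlinarith, fun h => by nlinarith⟩

lemma gaussPair_toReal_eq {m : ℕ} (hm : 2 ≤ m + 1) {c : ℝ} (hc : c ∈ Set.Ioo (0 : ℝ) 1) :
    (gaussPair (m + 1) {ω | c ≤ rtilde (m + 1) ω}).toReal =
      (∫ t in Set.Ioi (c / √(1 - c ^ 2)), (1 + t ^ 2) ^ (-(((m + 1 : ℕ) : ℝ) / 2))) /
        ∫ t : ℝ, (1 + t ^ 2) ^ (-(((m + 1 : ℕ) : ℝ) / 2)) := by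
  have hm0 : m ≠ 0 := by lia
  have hcast : (2 : ℝ) ≤ ((m + 1 : ℕ) : ℝ) := by exact_mod_cast hm
  obtain ⟨K, hK⟩ := exists_pi_gaussianReal_ratio_eq hm0
  set p : ℝ := ((m + 1 : ℕ) : ℝ) / 2 with hp
  have hint := integrable_one_add_sq_rpow_neg (p := p) (by linarith)
  have hset : ∀ T : Set ℝ, ∫⁻ t in T, ENNReal.ofReal ((1 + t ^ 2) ^ (-p)) =
      ENNReal.ofReal (∫ t in T, (1 + t ^ 2) ^ (-p)) := fun T =>
    (ofReal_integral_eq_lintegral_ofReal hint.integrableOn (.of_forall fun t => by positivity)).symm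
  have hone := hK Set.univ MeasurableSet.univ
  rw [hset, setIntegral_univ] at hone
  simp only [Set.mem_univ, Set.ofPred_true, measure_univ] at hone
  have hone' := congrArg ENNReal.toReal hone
  rw [ENNReal.toReal_mul, ENNReal.toReal_ofReal (integral_nonneg fun t => by positivity),
    ENNReal.toReal_one] at hone'
  have hJ : ∫ t : ℝ, (1 + t ^ 2) ^ (-p) ≠ 0 := right_ne_zero_of_mul (hone' ▸ one_ne_zero)
  rw [gaussPair_le_rtilde, eq_div_iff hJ]
  have hae : Measure.pi (fun _ : Fin (m + 1) => gaussianReal 0 1)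
        {y | c ≤ y 0 / √(∑ i, y i ^ 2)} =
      Measure.pi (fun _ : Fin (m + 1) => gaussianReal 0 1)
        {y | y 0 / √(∑ i : Fin m, y i.succ ^ 2) ∈ Set.Ici (c / √(1 - c ^ 2))} := by
    refine measure_congr ?_
    have hq : ∀ᵐ y ∂(Measure.pi fun _ : Fin (m + 1) => gaussianReal 0 1),
        y (Fin.succ ⟨0, Nat.pos_of_ne_zero hm0⟩) ≠ 0 := by
      refine (Measure.quasiMeasurePreserving_eval (fun _ : Fin (m + 1) => gaussianReal 0 1)
        (Fin.succ ⟨0, Nat.pos_of_ne_zero hm0⟩)).ae (p := fun z => z ≠ 0) ?_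
      have := nullSingletonClass_gaussianReal (μ := 0) one_ne_zero
      simp [ae_iff]
    filter_upwards [hq] with y hy
    refine propext ?_
    have hs : 0 < ∑ i : Fin m, y i.succ ^ 2 :=
      Finset.sum_pos' (fun i _ => sq_nonneg _) ⟨_, Finset.mem_univ _, by positivity⟩
    change c ≤ y 0 / √(∑ i, y i ^ 2) ↔ c / √(1 - c ^ 2) ≤ y 0 / √(∑ i : Fin m, y i.succ ^ 2)
    rw [Fin.sum_univ_succ, le_div_sqrt_add_sq_iff hc hs]
  rw [hae, hK _ measurableSet_Ici, hset, ENNReal.toReal_mul,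
    ENNReal.toReal_ofReal (integral_nonneg fun t => by positivity), integral_Ici_eq_integral_Ioi]
  linear_combination -(∫ t in Set.Ioi (c / √(1 - c ^ 2)), (1 + t ^ 2) ^ (-p)) * hone'

lemma tendsto_setIntegral_Ioi_one_add_sq_rpow_neg_div {a : ℝ} (ha : 0 < a) :
    Tendsto (fun n : ℕ => (∫ t in Set.Ioi a, (1 + t ^ 2) ^ (-((n : ℝ) / 2))) /
      ((1 + a ^ 2) ^ (1 - (n : ℝ) / 2) / (2 * ((n : ℝ) / 2 - 1) * a))) atTop (nhds 1) := by
  have hlow : Tendsto (fun n : ℕ => (1 + (1 + a ^ 2) / a ^ 2 / (2 * ((n : ℝ) / 2 - 1)))⁻¹)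
      atTop (nhds 1) := by
    have h : Tendsto (fun n : ℕ => 2 * ((n : ℝ) / 2 - 1)) atTop atTop :=
      (tendsto_atTop_add_const_right _ (-1)
        (tendsto_natCast_atTop_atTop.atTop_div_const two_pos)).const_mul_atTop two_pos
    simpa using ((h.const_div_atTop ((1 + a ^ 2) / a ^ 2)).const_add 1).inv₀ (by simp)
  refine tendsto_of_tendsto_of_tendsto_of_le_of_le' hlow tendsto_const_nhds ?_ ?_
  all_goals
    filter_upwards [eventually_gt_atTop 2] with n hn
    have hn' : (2 : ℝ) < n := by exact_mod_cast hn
    have hp : 1 < (n : ℝ) / 2 := by linarith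
    have hp' : 0 < (n : ℝ) / 2 - 1 := by linarith
  · have h := le_setIntegral_Ioi_one_add_sq_rpow_neg ha hp
    rw [le_div_iff₀ (by positivity), inv_mul_le_iff₀ (by positivity)]
    exact h
  · exact (div_le_one₀ (by positivity)).2 (setIntegral_Ioi_one_add_sq_rpow_neg_le ha hp)

lemma correlation_tail_prefactor_eq {c : ℝ} (hc : c ∈ Set.Ioo (0 : ℝ) 1) {x : ℝ} (hx : 2 < x) :
    (1 - c ^ 2) ^ (x / 2)
        * (1 + 4 * (c / (1 - c ^ 2)) ^ 2) ^ (-(1 / 4) : ℝ)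
        * ((1 + √(1 + 4 * (c / (1 - c ^ 2)) ^ 2)) / 2)
        / ((c / (1 - c ^ 2)) * ((1 - c ^ 2) / √(1 + c ^ 2)) * √(2 * π * x)) =
      (1 + (c / √(1 - c ^ 2)) ^ 2) ^ (1 - x / 2) / (2 * (x / 2 - 1) * (c / √(1 - c ^ 2))) *
        (x - 2) / √(2 * π * x) := by
  obtain ⟨hc0, hc1⟩ := hc
  have hd : 0 < 1 - c ^ 2 := by nlinarith
  have hx' : x - 2 ≠ 0 := by linarith
  have e1 : 1 + 4 * (c / (1 - c ^ 2)) ^ 2 = ((1 + c ^ 2) / (1 - c ^ 2)) ^ 2 := by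
    field_simp
    ring
  have e2 : ((1 + c ^ 2) / (1 - c ^ 2)) ^ 2 = ((1 + c ^ 2) / (1 - c ^ 2)) ^ (2 : ℝ) := by
    norm_cast
  have e3 : 1 + (c / √(1 - c ^ 2)) ^ 2 = (1 - c ^ 2)⁻¹ := by
    rw [div_pow, sq_sqrt hd.le]
    field_simp
    ring
  have e4 : (1 - c ^ 2) ^ (x / 2) = (1 - c ^ 2) ^ (x / 2 - 1) * (1 - c ^ 2) := by
    rw [← rpow_add_one hd.ne']
    ring_nf
  rw [e1, sqrt_sq (by positivity), e3, inv_rpow hd.le, ← rpow_neg hd.le, e2,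
    ← rpow_mul (by positivity), show (2 : ℝ) * -(1 / 4) = -(1 / 2) by norm_num,
    rpow_neg (by positivity), ← sqrt_eq_rpow, sqrt_div (by positivity), neg_sub, e4,
    show 2 * (x / 2 - 1) = x - 2 by ring]
  have s1 : 0 < √(1 - c ^ 2) := sqrt_pos.2 hd
  have s2 : 0 < √(1 + c ^ 2) := sqrt_pos.2 (by positivity)
  have s3 : 0 < √(2 * π * x) := sqrt_pos.2 (by positivity)
  field_simp
  ring

theorem stmt_15 (c : ℝ) (hc : c ∈ Set.Ioo (0 : ℝ) 1) :
    ∃ ε : ℕ → ℝ, Tendsto ε atTop (nhds 0) ∧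
      ∀ᶠ n : ℕ in atTop,
        (gaussPair n {ω | c ≤ rtilde n ω}).toReal
          = (1 - c ^ 2) ^ ((n : ℝ) / 2)
              * (1 + 4 * (c / (1 - c ^ 2)) ^ 2) ^ (-(1 / 4) : ℝ)
              * ((1 + Real.sqrt (1 + 4 * (c / (1 - c ^ 2)) ^ 2)) / 2)
              / ((c / (1 - c ^ 2)) * ((1 - c ^ 2) / Real.sqrt (1 + c ^ 2))
                  * Real.sqrt (2 * π * n))
              * (1 + ε n) := by
  have hd : 0 < 1 - c ^ 2 := by nlinarith [hc.1, hc.2]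
  have ha : 0 < c / √(1 - c ^ 2) := div_pos hc.1 (sqrt_pos.2 hd)
  have hI := tendsto_setIntegral_Ioi_one_add_sq_rpow_neg_div ha
  have hJ := tendsto_sqrt_mul_integral_one_add_sq_rpow_neg
  have hpi : √(2 * π) ≠ 0 := by positivity
  have hJ' := (tendsto_const_nhds (x := √(2 * π))).div hJ hpi
  rw [div_self hpi] at hJ'
  have hn : Tendsto (fun n : ℕ => (1 - 2 / (n : ℝ))⁻¹) atTop (nhds 1) := by
    simpa using ((tendsto_const_div_atTop_nhds_zero_nat (2 : ℝ)).const_sub 1).inv₀ (by simp)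
  have hlim := ((hI.mul hJ').mul hn).sub_const 1
  norm_num only [mul_one, sub_self] at hlim
  refine ⟨_, hlim, ?_⟩
  filter_upwards [eventually_gt_atTop 2, hJ.eventually_ne hpi] with n hn2 hJn
  obtain ⟨m, rfl⟩ := Nat.exists_eq_add_of_le' (show 1 ≤ n by lia)
  have hx : (2 : ℝ) < ((m + 1 : ℕ) : ℝ) := by exact_mod_cast hn2
  rw [gaussPair_toReal_eq (by lia) hc, correlation_tail_prefactor_eq hc hx]
  simp only [Pi.div_apply]
  set x : ℝ := ((m + 1 : ℕ) : ℝ)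
  have hJ0 := right_ne_zero_of_mul hJn
  set M := (1 + (c / √(1 - c ^ 2)) ^ 2) ^ (1 - x / 2) / (2 * (x / 2 - 1) * (c / √(1 - c ^ 2)))
  have hM0 : M ≠ 0 := by
    have : 0 < x / 2 - 1 := by linarith
    positivity
  have hx0 : 0 < x := by linarith
  have hx2 : x - 2 ≠ 0 := by linarith
  have hsx : √x ≠ 0 := by positivity
  have hx3 : 1 - 2 / x = (x - 2) / x := by field_simp
  rw [hx3, sqrt_mul (by positivity) x, add_sub_cancel]
  have hsq : √x ^ 2 = x := sq_sqrt hx0.le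
  field_simp
  rw [hsq]
  ring
end

section
/- For every λ ∈ ℝ there exists a sequence of real numbers (R_p(λ))_{p≥0} with R_0(λ) = log c_0(λ), where c_0(λ) = √(2π/|h_λ''(r_0(λ))|) · (1-r_0(λ)²)^{-2}, such that for every integer P ≥ 0, the normalized cumulant generating function L_n(λ) := (1/n) log[ Γ_n ∫_{-1}^{1} e^{nλr} (1-r²)^{(n-4)/2} dr ], with Γ_n = Γ((n-1)/2)/(√π Γ((n-2)/2)), satisfies L_n(λ) = h_λ(r_0(λ)) + (1/n) log Γ_n - (1/(2n)) log n + (1/n) Σ_{p=0}^{P} R_p(λ)/(n^p p!) + O(n^{-(P+2)}) as n → ∞. -/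
open Real Filter Asymptotics

/-- The saddle point `r₀(λ)`, unique root of `h_λ'(r) = 0` in `(-1,1)`. -/
noncomputable def r0 (l : ℝ) : ℝ :=
  if l = 0 then 0 else (-1 + Real.sqrt (1 + 4 * l ^ 2)) / (2 * l)

/-- The phase function `h_λ(r) = λr + (1/2) log(1-r²)` evaluated at the saddle point,
i.e. the limiting normalized cumulant generating function. -/
noncomputable def hAtSaddle (l : ℝ) : ℝ :=
  l * r0 l + (1 / 2) * Real.log (1 - r0 l ^ 2)

/-- The normalizing Gamma factor `Γ_n = Γ((n-1)/2)/(√π Γ((n-2)/2))`. -/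
noncomputable def GammaBf (n : ℕ) : ℝ :=
  Real.Gamma (((n : ℝ) - 1) / 2) / (Real.sqrt π * Real.Gamma (((n : ℝ) - 2) / 2))

/-- The normalized cumulant generating function of the empirical Pearson correlation
coefficient in the spherical model. -/
noncomputable def Ln (n : ℕ) (l : ℝ) : ℝ :=
  (1 / (n : ℝ)) *
    Real.log (GammaBf n *
      ∫ r in (-1 : ℝ)..1, Real.exp ((n : ℝ) * l * r) * (1 - r ^ 2) ^ (((n : ℝ) - 4) / 2))

/-- The leading Laplace-method coefficient
`c₀(λ) = √(2π/|h_λ''(r₀(λ))|) (1-r₀(λ)²)^{-2}`, with `h_λ''(r) = -(1+r²)/(1-r²)²`. -/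
noncomputable def c0 (l : ℝ) : ℝ :=
  Real.sqrt (2 * π / |(-(1 + r0 l ^ 2) / (1 - r0 l ^ 2) ^ 2)|) * ((1 - r0 l ^ 2) ^ 2)⁻¹

open Set MeasureTheory Topology

/-! ### Analytic functions divided by a simple zero -/

lemma AnalyticOnNhd.dslope_self {f : ℝ → ℝ} {U : Set ℝ} (hf : AnalyticOnNhd ℝ f U) (x₀ : ℝ) :
    AnalyticOnNhd ℝ (dslope f x₀) U := by
  intro x hx
  by_cases h : x = x₀
  · subst h
    obtain ⟨p, hp⟩ := hf x hx
    exact ⟨_, hp.has_fpower_series_dslope_fslope⟩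
  · have h1 : AnalyticAt ℝ (fun y => (y - x₀)⁻¹ * (f y - f x₀)) x :=
      ((analyticAt_id.sub analyticAt_const).inv (sub_ne_zero.2 h)).mul
        ((hf x hx).sub analyticAt_const)
    refine h1.congr ?_
    filter_upwards [isOpen_ne.mem_nhds h] with y hy
    rw [dslope_of_ne _ hy, slope_def_field, div_eq_inv_mul]

/-- Two functions continuous at `x₀` which agree off `x₀` near `x₀` agree at `x₀`. -/
lemma eq_of_eq_off_point {f g : ℝ → ℝ} {U : Set ℝ} {x₀ : ℝ} (hU : U ∈ 𝓝 x₀)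
    (hf : ContinuousAt f x₀) (hg : ContinuousAt g x₀)
    (h : ∀ x ∈ U, x ≠ x₀ → f x = g x) : f x₀ = g x₀ := by
  refine tendsto_nhds_unique (f := f) (l := 𝓝[≠] x₀) (hf.mono_left nhdsWithin_le_nhds) ?_
  refine (hg.mono_left nhdsWithin_le_nhds).congr' ?_
  filter_upwards [self_mem_nhdsWithin, mem_nhdsWithin_of_mem_nhds hU] with x hx hxU
  exact (h x hxU hx).symm

/-- A one-dimensional analytic Morse lemma: a phase with a nondegenerate minimum at `x₀` and no
other critical point is the square of a function `s` with positive derivative `σ`. -/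
lemma exists_morse_coordinate {φ m : ℝ → ℝ} {U : Set ℝ} {x₀ : ℝ} (hU : IsOpen U) (hx₀ : x₀ ∈ U)
    (hφ : AnalyticOnNhd ℝ φ U) (hφ₀ : φ x₀ = 0) (hpos : ∀ x ∈ U, x ≠ x₀ → 0 < φ x)
    (hm : AnalyticOnNhd ℝ m U) (hmpos : ∀ x ∈ U, 0 < m x)
    (hd : ∀ x ∈ U, HasDerivAt φ ((x - x₀) * m x) x) :
    ∃ s σ : ℝ → ℝ, AnalyticOnNhd ℝ σ U ∧ (∀ x ∈ U, HasDerivAt s (σ x) x) ∧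
      (∀ x ∈ U, s x ^ 2 = φ x) ∧ (∀ x ∈ U, 0 < σ x) ∧ σ x₀ = √(m x₀ / 2) ∧
      (∀ x ∈ U, x < x₀ → s x < 0) ∧ (∀ x ∈ U, x₀ < x → 0 < s x) := by
  set k : ℝ → ℝ := dslope (dslope φ x₀) x₀ with hk
  have hkan : AnalyticOnNhd ℝ k U := (hφ.dslope_self x₀).dslope_self x₀
  have hfac : ∀ x, φ x = (x - x₀) ^ 2 * k x := by
    intro x
    have h1 := sub_smul_dslope φ x₀ x
    have h2 := sub_smul_dslope (dslope φ x₀) x₀ x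
    have h3 : dslope φ x₀ x₀ = 0 := by
      rw [dslope_same, (hd x₀ hx₀).deriv]; simp
    simp only [smul_eq_mul, hφ₀, h3, sub_zero] at h1 h2
    rw [← h1, ← h2, hk]; ring
  have hUn : U ∈ 𝓝 x₀ := hU.mem_nhds hx₀
  have hm2 : ∀ x ∈ U, x ≠ x₀ → m x = 2 * k x + (x - x₀) * deriv k x := by
    intro x hx hne
    have h1 : HasDerivAt (fun y => (y - x₀) ^ 2 * k y)
        (2 * (x - x₀) * k x + (x - x₀) ^ 2 * deriv k x) x := by
      have := (((hasDerivAt_id x).sub_const x₀).pow 2).mul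
        (hkan x hx).differentiableAt.hasDerivAt
      refine this.congr_deriv ?_
      simp
    have h2 : (fun y => (y - x₀) ^ 2 * k y) = φ := funext fun y => (hfac y).symm
    rw [h2] at h1
    have h3 := (hd x hx).unique h1
    have : x - x₀ ≠ 0 := sub_ne_zero.2 hne
    apply mul_left_cancel₀ this
    rw [h3]; ring
  have hmk : m x₀ = 2 * k x₀ := by
    have := eq_of_eq_off_point (f := m) (g := fun x => 2 * k x + (x - x₀) * deriv k x) hUn
      (hm x₀ hx₀).continuousAt
      (by
        have h1 := (hkan x₀ hx₀).continuousAt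
        have h2 := (hkan.deriv x₀ hx₀).continuousAt
        fun_prop) hm2
    simpa using this
  have hkpos : ∀ x ∈ U, 0 < k x := by
    intro x hx
    by_cases h : x = x₀
    · subst h; linarith [hmpos x hx]
    · have h1 := hpos x hx h
      rw [hfac] at h1
      exact pos_of_mul_pos_right h1 (sq_nonneg _)
  set t : ℝ → ℝ := fun x => √(k x) with ht
  have htan : AnalyticOnNhd ℝ t U := fun x hx =>
    (Real.contDiffAt_sqrt (n := ⊤) (hkpos x hx).ne').analyticAt.comp (hkan x hx)
  have htpos : ∀ x ∈ U, 0 < t x := fun x hx => Real.sqrt_pos.2 (hkpos x hx)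
  set s : ℝ → ℝ := fun x => (x - x₀) * t x with hs
  have hsan : AnalyticOnNhd ℝ s U := fun x hx =>
    (analyticAt_id.sub analyticAt_const).mul (htan x hx)
  have hsd : ∀ x ∈ U, HasDerivAt s (deriv s x) x := fun x hx =>
    (hsan x hx).differentiableAt.hasDerivAt
  have hsq : ∀ x ∈ U, s x ^ 2 = φ x := by
    intro x hx
    rw [hfac x, hs, mul_pow, ht, Real.sq_sqrt (hkpos x hx).le]
  have hσ₀ : deriv s x₀ = t x₀ := by
    have := ((hasDerivAt_id x₀).sub_const x₀).mul (htan x₀ hx₀).differentiableAt.hasDerivAt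
    exact this.deriv.trans (by simp)
  have hσ : ∀ x ∈ U, x ≠ x₀ → 2 * t x * deriv s x = m x := by
    intro x hx hne
    have h1 := (hsd x hx).pow 2
    have h2 : (s ^ 2) =ᶠ[𝓝 x] φ := by
      filter_upwards [hU.mem_nhds hx] with y hy
      exact hsq y hy
    have h3 := (hd x hx).unique (h1.congr_of_eventuallyEq h2.symm)
    have : x - x₀ ≠ 0 := sub_ne_zero.2 hne
    apply mul_left_cancel₀ this
    rw [h3]; simp [hs]; ring
  refine ⟨s, deriv s, hsan.deriv, hsd, hsq, ?_, ?_, ?_, ?_⟩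
  · intro x hx
    by_cases h : x = x₀
    · subst h; rw [hσ₀]; exact htpos x hx
    · have h1 := hσ x hx h
      have h2 := hmpos x hx
      rw [← h1] at h2
      exact pos_of_mul_pos_right h2 (by linarith [htpos x hx])
  · rw [hσ₀, ht, hmk]; simp
  · intro x hx h
    exact mul_neg_of_neg_of_pos (by linarith) (htpos x hx)
  · intro x hx h
    exact mul_pos (by linarith) (htpos x hx)

/-! ### Sequences decaying faster than every power -/

/-- A sequence which is `O(n⁻ᴷ)` for every `K`. -/
def Negligible (f : ℕ → ℝ) : Prop :=
  ∀ K : ℕ, f =O[atTop] fun n : ℕ => 1 / (n : ℝ) ^ K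

namespace Negligible

lemma add {f g : ℕ → ℝ} (hf : Negligible f) (hg : Negligible g) :
    Negligible (fun n => f n + g n) := fun K => (hf K).add (hg K)

lemma const_mul {f : ℕ → ℝ} (hf : Negligible f) (c : ℝ) :
    Negligible (fun n => c * f n) := fun K => (hf K).const_mul_left c

lemma of_isBigO {f g : ℕ → ℝ} (hg : Negligible g) (h : f =O[atTop] g) : Negligible f :=
  fun K => h.trans (hg K)

lemma congr' {f g : ℕ → ℝ} (hf : Negligible f) (h : f =ᶠ[atTop] g) : Negligible g :=
  fun K => (hf K).congr' h .rfl

lemma sqrt_mul {f : ℕ → ℝ} (hf : Negligible f) :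
    Negligible (fun n : ℕ => √(n : ℝ) * f n) := by
  intro K
  have h1 : (fun n : ℕ => √(n : ℝ)) =O[atTop] fun n : ℕ => (n : ℝ) := by
    refine IsBigO.of_bound 1 ?_
    filter_upwards [eventually_ge_atTop 1] with n hn
    have hn' : (1 : ℝ) ≤ n := by exact_mod_cast hn
    rw [Real.norm_of_nonneg (Real.sqrt_nonneg _), Real.norm_of_nonneg (by linarith), one_mul]
    exact Real.sqrt_le_iff.2 ⟨by linarith, by nlinarith⟩
  refine (h1.mul (hf (K + 1))).congr' .rfl ?_
  filter_upwards [eventually_ge_atTop 1] with n hn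
  have hn' : (n : ℝ) ≠ 0 := by positivity
  field_simp
  ring

end Negligible

lemma negligible_exp_neg {η : ℝ} (hη : 0 < η) :
    Negligible (fun n : ℕ => Real.exp (-η * n)) := by
  intro K
  have h := ((isLittleO_exp_neg_mul_rpow_atTop hη (-(K : ℝ))).isBigO).comp_tendsto
    tendsto_natCast_atTop_atTop
  refine h.congr (fun n => rfl) (fun n => ?_)
  simp

/-! ### The Gaussian integral over a finite interval -/

lemma negligible_gaussian_sub {A B : ℝ} (hA : A < 0) (hB : 0 < B) :
    Negligible (fun n : ℕ =>
      √(n : ℝ) * (∫ u in A..B, Real.exp (-(n : ℝ) * u ^ 2)) - √π) := by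
  set η := min (A ^ 2) (B ^ 2) with hη
  have hηpos : 0 < η := lt_min (sq_pos_of_neg hA) (sq_pos_of_pos hB)
  set f : ℕ → ℝ := fun n => ∫ u in (Ioc A B)ᶜ, Real.exp (-(n : ℝ) * u ^ 2) with hf
  have hfn : Negligible f := by
    refine ((negligible_exp_neg hηpos).const_mul (Real.exp η * √π)).of_isBigO ?_
    refine IsBigO.of_bound 1 ?_
    filter_upwards [eventually_ge_atTop 1] with n hn
    have hn' : (1 : ℝ) ≤ n := by exact_mod_cast hn
    have h0 : 0 ≤ f n := setIntegral_nonneg measurableSet_Ioc.compl fun _ _ => (Real.exp_pos _).le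
    have hint : Integrable (fun u : ℝ => Real.exp (-1 * u ^ 2)) :=
      integrable_exp_neg_mul_sq one_pos
    have h1 : f n ≤ ∫ u in (Ioc A B)ᶜ,
        Real.exp (-((n : ℝ) - 1) * η) * Real.exp (-1 * u ^ 2) := by
      refine setIntegral_mono_on (integrable_exp_neg_mul_sq (by linarith)).integrableOn
        (hint.const_mul _).integrableOn measurableSet_Ioc.compl ?_
      intro u hu
      rw [← Real.exp_add, Real.exp_le_exp]
      have hηu : η ≤ u ^ 2 := by
        by_cases h : u ≤ A
        · exact (min_le_left _ _).trans (by nlinarith)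
        · have : B < u := by
            by_contra h'
            exact hu ⟨not_le.1 h, not_lt.1 h'⟩
          exact (min_le_right _ _).trans (by nlinarith)
      nlinarith
    have h2 : ∫ u in (Ioc A B)ᶜ, Real.exp (-((n : ℝ) - 1) * η) * Real.exp (-1 * u ^ 2)
        ≤ Real.exp (-((n : ℝ) - 1) * η) * √π := by
      refine (setIntegral_le_integral (hint.const_mul _)
        (Eventually.of_forall fun _ => by positivity)).trans ?_
      rw [integral_const_mul, integral_gaussian, div_one]
    have h3 : Real.exp (-((n : ℝ) - 1) * η) = Real.exp η * Real.exp (-η * n) := by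
      rw [← Real.exp_add]; ring_nf
    rw [Real.norm_of_nonneg h0, Real.norm_of_nonneg (by positivity), one_mul]
    refine (h1.trans h2).trans (le_of_eq ?_)
    rw [h3]; ring
  refine (hfn.sqrt_mul.const_mul (-1)).congr' ?_
  filter_upwards [eventually_ge_atTop 1] with n hn
  have hn' : (0 : ℝ) < n := by exact_mod_cast hn
  have h1 := integral_add_compl (measurableSet_Ioc (a := A) (b := B))
    (integrable_exp_neg_mul_sq hn')
  rw [integral_gaussian, ← intervalIntegral.integral_of_le (by linarith)] at h1
  have h2 : √(n : ℝ) * √(π / n) = √π := by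
    rw [← Real.sqrt_mul hn'.le, mul_div_cancel₀ _ hn'.ne']
  rw [← h2, ← h1]
  simp only [hf]
  ring

/-! ### Laplace integrals -/

/-- The normalized Laplace integral `√n ∫ₐᵇ e^{-nφ} q`. -/
noncomputable def laplaceIntegral (φ : ℝ → ℝ) (a b : ℝ) (q : ℝ → ℝ) (n : ℕ) : ℝ :=
  √(n : ℝ) * ∫ x in a..b, Real.exp (-(n : ℝ) * φ x) * q x

lemma laplaceIntegral_morse {φ s σ : ℝ → ℝ} {U : Set ℝ} {a b : ℝ} (hab : a ≤ b)
    (hU : Icc a b ⊆ U) (hσ : AnalyticOnNhd ℝ σ U) (hs : ∀ x ∈ U, HasDerivAt s (σ x) x)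
    (hsq : ∀ x ∈ U, s x ^ 2 = φ x) (hsa : s a < 0) (hsb : 0 < s b) :
    Negligible (fun n => laplaceIntegral φ a b σ n - √π) := by
  refine (negligible_gaussian_sub hsa hsb).congr' (Eventually.of_forall fun n => ?_)
  simp only [laplaceIntegral]
  rw [← uIcc_of_le hab] at hU
  rw [← intervalIntegral.integral_comp_mul_deriv (f := s) (f' := σ)
    (g := fun u => Real.exp (-(n : ℝ) * u ^ 2)) (fun x hx => hs x (hU hx))
    (hσ.continuousOn.mono hU) (by fun_prop)]
  congr 2
  refine intervalIntegral.integral_congr fun x hx => ?_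
  simp [hsq x (hU hx)]

section LaplaceExpansion

variable {φ m : ℝ → ℝ} {U : Set ℝ} {x₀ a b : ℝ}

lemma laplaceIntegral_step (hU : IsOpen U) (hax : a < x₀) (hxb : x₀ < b)
    (habU : Icc a b ⊆ U) (hφ : AnalyticOnNhd ℝ φ U) (hφ₀ : φ x₀ = 0)
    (hpos : ∀ x ∈ U, x ≠ x₀ → 0 < φ x)
    (hm : AnalyticOnNhd ℝ m U) (hmpos : ∀ x ∈ U, 0 < m x)
    (hd : ∀ x ∈ U, HasDerivAt φ ((x - x₀) * m x) x)
    {q : ℝ → ℝ} (hq : AnalyticOnNhd ℝ q U) :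
    ∃ q' : ℝ → ℝ, AnalyticOnNhd ℝ q' U ∧
      Negligible (fun n : ℕ => laplaceIntegral φ a b q n
        - (q x₀ * √(2 * π / m x₀) + 1 / (n : ℝ) * laplaceIntegral φ a b q' n)) := by
  have hab : a ≤ b := (hax.trans hxb).le
  have hx₀ : x₀ ∈ U := habU ⟨hax.le, hxb.le⟩
  have haU : a ∈ U := habU ⟨le_rfl, hab⟩
  have hbU : b ∈ U := habU ⟨hab, le_rfl⟩
  obtain ⟨s, σ, hσ, hs, hsq, hσpos, hσ₀, hsneg, hspos⟩ :=
    exists_morse_coordinate hU hx₀ hφ hφ₀ hpos hm hmpos hd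
  have hbase := laplaceIntegral_morse hab habU hσ hs hsq (hsneg a haU hax) (hspos b hbU hxb)
  set κ : ℝ := q x₀ / σ x₀ with hκ
  have hκπ : κ * √π = q x₀ * √(2 * π / m x₀) := by
    have : 2 * π / m x₀ = π / (m x₀ / 2) := by field_simp
    rw [this, Real.sqrt_div Real.pi_pos.le, hκ, hσ₀]; ring
  set p : ℝ → ℝ := fun x => q x - κ * σ x with hp
  have hp₀ : p x₀ = 0 := by
    simp only [hp, hκ]
    rw [div_mul_cancel₀ _ (hσpos x₀ hx₀).ne', sub_self]
  have hpan : AnalyticOnNhd ℝ p U := fun x hx =>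
    (hq x hx).sub (analyticAt_const.mul (hσ x hx))
  set r : ℝ → ℝ := fun x => dslope p x₀ x / m x with hr
  have hran : AnalyticOnNhd ℝ r U := fun x hx =>
    (hpan.dslope_self x₀ x hx).div (hm x hx) (hmpos x hx).ne'
  have hqr : ∀ x ∈ U, q x = κ * σ x + r x * ((x - x₀) * m x) := by
    intro x hx
    have h1 := sub_smul_dslope p x₀ x
    rw [hp₀, sub_zero, smul_eq_mul] at h1
    have h2 : r x * ((x - x₀) * m x) = (x - x₀) * dslope p x₀ x := by
      have := (hmpos x hx).ne'
      simp only [hr]; field_simp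
    rw [h2, h1, hp]; ring
  refine ⟨deriv r, hran.deriv, ?_⟩
  have hend : ∀ x ∈ U, x ≠ x₀ → Negligible (fun n : ℕ => Real.exp (-(n : ℝ) * φ x)) := by
    intro x hx hne
    refine (negligible_exp_neg (hpos x hx hne)).congr' (Eventually.of_forall fun n => ?_)
    simp only; congr 1; ring
  have hbd : Negligible (fun n : ℕ => √(n : ℝ) *
      (1 / (n : ℝ) * (r a * Real.exp (-(n : ℝ) * φ a) + -r b * Real.exp (-(n : ℝ) * φ b)))) := by
    refine Negligible.sqrt_mul (Negligible.of_isBigO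
      (((hend a haU hax.ne).const_mul (r a)).add ((hend b hbU hxb.ne').const_mul (-r b))) ?_)
    refine IsBigO.of_bound 1 ?_
    filter_upwards [eventually_ge_atTop 1] with n hn
    have hn' : (1 : ℝ) ≤ n := by exact_mod_cast hn
    rw [norm_mul]
    gcongr
    rw [Real.norm_of_nonneg (by positivity), div_le_one (by linarith)]
    exact hn'
  refine ((hbase.const_mul κ).add hbd).congr' ?_
  filter_upwards [eventually_ge_atTop 1] with n hn
  have hn' : (n : ℝ) ≠ 0 := by positivity
  have huI : uIcc a b ⊆ U := by rwa [uIcc_of_le hab]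
  have hφc : ContinuousOn φ (uIcc a b) := hφ.continuousOn.mono huI
  have hσc : ContinuousOn σ (uIcc a b) := hσ.continuousOn.mono huI
  have hrc : ContinuousOn r (uIcc a b) := hran.continuousOn.mono huI
  have hmc : ContinuousOn m (uIcc a b) := hm.continuousOn.mono huI
  have hdrc : ContinuousOn (deriv r) (uIcc a b) := hran.deriv.continuousOn.mono huI
  have hparts := intervalIntegral.integral_mul_deriv_eq_deriv_mul (a := a) (b := b)
    (u := r) (u' := deriv r) (v := fun x => -(1 / (n : ℝ)) * Real.exp (-(n : ℝ) * φ x))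
    (v' := fun x => Real.exp (-(n : ℝ) * φ x) * ((x - x₀) * m x))
    (fun x hx => (hran x (huI hx)).differentiableAt.hasDerivAt)
    (fun x hx => by
      refine ((((hd x (huI hx)).const_mul (-(n : ℝ))).exp).const_mul (-(1 / (n : ℝ)))).congr_deriv ?_
      field_simp)
    hdrc.intervalIntegrable
    (ContinuousOn.intervalIntegrable (by fun_prop))
  have hsplit : ∫ x in a..b, Real.exp (-(n : ℝ) * φ x) * q x =
      κ * (∫ x in a..b, Real.exp (-(n : ℝ) * φ x) * σ x) +
        ∫ x in a..b, r x * (Real.exp (-(n : ℝ) * φ x) * ((x - x₀) * m x)) := by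
    rw [← intervalIntegral.integral_const_mul, ← intervalIntegral.integral_add
      (ContinuousOn.intervalIntegrable (by fun_prop))
      (ContinuousOn.intervalIntegrable (by fun_prop))]
    refine intervalIntegral.integral_congr fun x hx => ?_
    simp only [hqr x (huI hx)]
    ring
  have hlast : ∫ x in a..b, deriv r x * (-(1 / (n : ℝ)) * Real.exp (-(n : ℝ) * φ x)) =
      -(1 / (n : ℝ)) * ∫ x in a..b, Real.exp (-(n : ℝ) * φ x) * deriv r x := by
    rw [← intervalIntegral.integral_const_mul]
    congr 1; ext x; ring
  simp only [laplaceIntegral]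
  rw [hsplit, hparts, hlast, ← hκπ]
  ring

lemma laplaceIntegral_isBigO_one (hU : IsOpen U) (hax : a < x₀) (hxb : x₀ < b)
    (habU : Icc a b ⊆ U) (hφ : AnalyticOnNhd ℝ φ U) (hφ₀ : φ x₀ = 0)
    (hpos : ∀ x ∈ U, x ≠ x₀ → 0 < φ x)
    (hm : AnalyticOnNhd ℝ m U) (hmpos : ∀ x ∈ U, 0 < m x)
    (hd : ∀ x ∈ U, HasDerivAt φ ((x - x₀) * m x) x)
    {q : ℝ → ℝ} (hq : AnalyticOnNhd ℝ q U) :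
    laplaceIntegral φ a b q =O[atTop] fun _ => (1 : ℝ) := by
  have hab : a ≤ b := (hax.trans hxb).le
  have hx₀ : x₀ ∈ U := habU ⟨hax.le, hxb.le⟩
  have haU : a ∈ U := habU ⟨le_rfl, hab⟩
  have hbU : b ∈ U := habU ⟨hab, le_rfl⟩
  obtain ⟨s, σ, hσ, hs, hsq, hσpos, hσ₀, hsneg, hspos⟩ :=
    exists_morse_coordinate hU hx₀ hφ hφ₀ hpos hm hmpos hd
  have hbase := laplaceIntegral_morse hab habU hσ hs hsq (hsneg a haU hax) (hspos b hbU hxb)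
  have hσ1 : laplaceIntegral φ a b σ =O[atTop] fun _ => (1 : ℝ) := by
    have h1 : (fun n => laplaceIntegral φ a b σ n - √π) =O[atTop] fun _ => (1 : ℝ) := by
      simpa using hbase 0
    have h2 : (fun _ : ℕ => √π) =O[atTop] fun _ => (1 : ℝ) := isBigO_const_const _ one_ne_zero _
    simpa using h1.add h2
  obtain ⟨C, hC⟩ := isCompact_Icc.exists_bound_of_continuousOn (f := fun x => q x / σ x)
    (s := Icc a b) ((hq.continuousOn.mono habU).div (hσ.continuousOn.mono habU)
      fun x hx => (hσpos x (habU hx)).ne')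
  refine IsBigO.trans (IsBigO.of_bound C (Eventually.of_forall fun n => ?_)) hσ1
  have huI : uIcc a b ⊆ U := by rwa [uIcc_of_le hab]
  have hφc : ContinuousOn φ (uIcc a b) := hφ.continuousOn.mono huI
  have hσc : ContinuousOn σ (uIcc a b) := hσ.continuousOn.mono huI
  have h1 : ‖∫ x in a..b, Real.exp (-(n : ℝ) * φ x) * q x‖ ≤
      ∫ x in a..b, C * (Real.exp (-(n : ℝ) * φ x) * σ x) := by
    refine intervalIntegral.norm_integral_le_of_norm_le hab (Eventually.of_forall fun x hx => ?_)
      (ContinuousOn.intervalIntegrable (by fun_prop))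
    have hx' : x ∈ Icc a b := Ioc_subset_Icc_self hx
    have h2 := hC x hx'
    have h3 := hσpos x (habU hx')
    rw [norm_div, Real.norm_of_nonneg h3.le, div_le_iff₀ h3] at h2
    rw [norm_mul, Real.norm_of_nonneg (Real.exp_pos _).le]
    calc _ ≤ Real.exp (-(n : ℝ) * φ x) * (C * σ x) := by gcongr
      _ = _ := by ring
  rw [intervalIntegral.integral_const_mul] at h1
  simp only [laplaceIntegral]
  rw [norm_mul, norm_mul, mul_left_comm]
  refine mul_le_mul_of_nonneg_left (h1.trans ?_) (norm_nonneg _)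
  have hC0 : 0 ≤ C := (norm_nonneg _).trans (hC a ⟨le_rfl, hab⟩)
  exact mul_le_mul_of_nonneg_left (le_abs_self _) hC0

/-- A family closed under a first-order recursion in `1/n` has a full expansion in `1/n`. -/
lemma isBigO_sub_sum_of_recursion {α : Type*} (E : α → ℕ → ℝ) (T : α → α) (κ : α → ℝ)
    (hbd : ∀ q, E q =O[atTop] fun _ => (1 : ℝ))
    (hrec : ∀ q, Negligible (fun n => E q n - (κ q + 1 / (n : ℝ) * E (T q) n))) (P : ℕ) (q : α) :
    (fun n : ℕ => E q n - ∑ p ∈ Finset.range P, κ (T^[p] q) / (n : ℝ) ^ p)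
      =O[atTop] fun n : ℕ => 1 / (n : ℝ) ^ P := by
  induction P generalizing q with
  | zero => simpa using hbd q
  | succ P ih =>
    have h1 := (isBigO_refl (fun n : ℕ => 1 / (n : ℝ)) atTop).mul (ih (T q))
    have h2 : (fun n : ℕ => 1 / (n : ℝ) * (1 / (n : ℝ) ^ P)) =
        fun n : ℕ => 1 / (n : ℝ) ^ (P + 1) := by
      ext n; rw [pow_succ', one_div_mul_one_div]
    rw [h2] at h1
    refine ((hrec q (P + 1)).add h1).congr_left fun n => ?_
    rw [Finset.sum_range_succ']
    have h3 : ∑ p ∈ Finset.range P, κ (T^[p + 1] q) / (n : ℝ) ^ (p + 1) =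
        1 / (n : ℝ) * ∑ p ∈ Finset.range P, κ (T^[p] (T q)) / (n : ℝ) ^ p := by
      rw [Finset.mul_sum]
      refine Finset.sum_congr rfl fun p _ => ?_
      rw [Function.iterate_succ_apply, one_div_mul_eq_div, div_div, pow_succ]
    rw [h3]
    simp
    ring

/-- **Laplace's method**, to all orders, for an analytic phase and an analytic amplitude. -/
theorem laplaceIntegral_expansion (hU : IsOpen U) (hax : a < x₀) (hxb : x₀ < b)
    (habU : Icc a b ⊆ U) (hφ : AnalyticOnNhd ℝ φ U) (hφ₀ : φ x₀ = 0)
    (hpos : ∀ x ∈ U, x ≠ x₀ → 0 < φ x)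
    (hm : AnalyticOnNhd ℝ m U) (hmpos : ∀ x ∈ U, 0 < m x)
    (hd : ∀ x ∈ U, HasDerivAt φ ((x - x₀) * m x) x)
    {q : ℝ → ℝ} (hq : AnalyticOnNhd ℝ q U) :
    ∃ c : ℕ → ℝ, c 0 = q x₀ * √(2 * π / m x₀) ∧ ∀ P : ℕ,
      (fun n : ℕ => laplaceIntegral φ a b q n - ∑ p ∈ Finset.range P, c p / (n : ℝ) ^ p)
        =O[atTop] fun n : ℕ => 1 / (n : ℝ) ^ P := by
  choose T hT hrec using fun q : {q : ℝ → ℝ // AnalyticOnNhd ℝ q U} =>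
    laplaceIntegral_step hU hax hxb habU hφ hφ₀ hpos hm hmpos hd q.2
  let T' : {q : ℝ → ℝ // AnalyticOnNhd ℝ q U} → {q : ℝ → ℝ // AnalyticOnNhd ℝ q U} :=
    fun q => ⟨T q, hT q⟩
  refine ⟨fun p => (T'^[p] ⟨q, hq⟩).1 x₀ * √(2 * π / m x₀), rfl, fun P => ?_⟩
  exact isBigO_sub_sum_of_recursion (fun q => laplaceIntegral φ a b q.1) T'
    (fun q => q.1 x₀ * √(2 * π / m x₀))
    (fun q => laplaceIntegral_isBigO_one hU hax hxb habU hφ hφ₀ hpos hm hmpos hd q.2)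
    hrec P ⟨q, hq⟩

end LaplaceExpansion

/-! ### Logarithm of an asymptotic expansion -/

lemma tendsto_one_div_natCast_pow (P : ℕ) :
    Tendsto (fun n : ℕ => 1 / (n : ℝ) ^ (P + 1)) atTop (𝓝 0) := by
  have h := (tendsto_one_div_atTop_nhds_zero_nat (𝕜 := ℝ)).pow (P + 1)
  simpa [div_pow] using h

lemma coeff_eq_zero_of_isBigO (P : ℕ) (d : ℕ → ℝ)
    (h : (fun n : ℕ => ∑ p ∈ Finset.range P, d p / (n : ℝ) ^ p)
      =O[atTop] fun n : ℕ => 1 / (n : ℝ) ^ P) :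
    ∀ p < P, d p = 0 := by
  induction P generalizing d with
  | zero => intro p hp; omega
  | succ P ih =>
    have hsum : ∀ n : ℕ, ∑ p ∈ Finset.range (P + 1), d p / (n : ℝ) ^ p =
        1 / (n : ℝ) * (∑ p ∈ Finset.range P, d (p + 1) / (n : ℝ) ^ p) + d 0 := by
      intro n
      rw [Finset.sum_range_succ', Finset.mul_sum]
      congr 1
      · refine Finset.sum_congr rfl fun p _ => ?_
        rw [one_div_mul_eq_div, div_div, pow_succ]
      · simp
    have hlim : Tendsto (fun n : ℕ => ∑ p ∈ Finset.range (P + 1), d p / (n : ℝ) ^ p)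
        atTop (𝓝 (d 0)) := by
      have h1 : Tendsto (fun n : ℕ => ∑ p ∈ Finset.range P, d (p + 1) / (n : ℝ) ^ (p + 1) + d 0)
          atTop (𝓝 (∑ p ∈ Finset.range P, d (p + 1) * 0 + d 0)) := by
        refine (tendsto_finsetSum _ fun p _ => ?_).add_const _
        simpa [div_eq_mul_inv] using (tendsto_one_div_natCast_pow p).const_mul (d (p + 1))
      simpa [Finset.sum_range_succ'] using h1
    have hd0 : d 0 = 0 := tendsto_nhds_unique hlim (h.trans_tendsto (tendsto_one_div_natCast_pow P))
    have hrest : ∀ p < P, d (p + 1) = 0 := by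
      refine ih (fun p => d (p + 1)) ?_
      refine ((isBigO_refl (fun n : ℕ => (n : ℝ)) atTop).mul h).congr' ?_ ?_
      · filter_upwards [eventually_ge_atTop 1] with n hn
        have hn' : (n : ℝ) ≠ 0 := by positivity
        rw [hsum, hd0]; field_simp; ring
      · filter_upwards [eventually_ge_atTop 1] with n hn
        have hn' : (n : ℝ) ≠ 0 := by positivity
        rw [pow_succ]; field_simp
    rintro (_ | p) hp
    · exact hd0
    · exact hrest p (by omega)

lemma exists_expansion_of_forall_order {V : ℕ → ℝ}
    (h : ∀ P : ℕ, ∃ e : ℕ → ℝ, (fun n : ℕ => V n - ∑ p ∈ Finset.range P, e p / (n : ℝ) ^ p)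
      =O[atTop] fun n : ℕ => 1 / (n : ℝ) ^ P) :
    ∃ d : ℕ → ℝ, ∀ P : ℕ, (fun n : ℕ => V n - ∑ p ∈ Finset.range P, d p / (n : ℝ) ^ p)
      =O[atTop] fun n : ℕ => 1 / (n : ℝ) ^ P := by
  choose e he using h
  have hstep : ∀ P, ∀ p < P, e (P + 1) p = e P p := by
    intro P p hp
    refine sub_eq_zero.1 (coeff_eq_zero_of_isBigO P (fun p => e (P + 1) p - e P p) ?_ p hp)
    have h1 : (fun n : ℕ => 1 / (n : ℝ) ^ (P + 1)) =O[atTop] fun n : ℕ => 1 / (n : ℝ) ^ P := by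
      refine IsBigO.of_bound 1 ?_
      filter_upwards [eventually_ge_atTop 1] with n hn
      have hn' : (1 : ℝ) ≤ n := by exact_mod_cast hn
      rw [Real.norm_of_nonneg (by positivity), Real.norm_of_nonneg (by positivity), one_mul]
      exact one_div_le_one_div_of_le (by positivity) (pow_le_pow_right₀ hn' (Nat.le_succ P))
    have h2 : (fun n : ℕ => e (P + 1) P / (n : ℝ) ^ P) =O[atTop]
        fun n : ℕ => 1 / (n : ℝ) ^ P := by
      simpa [div_eq_mul_inv] using
        (isBigO_refl (fun n : ℕ => 1 / (n : ℝ) ^ P) atTop).const_mul_left (e (P + 1) P)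
    refine (((he P).sub ((he (P + 1)).trans h1)).sub h2).congr_left fun n => ?_
    simp only [sub_div, Finset.sum_sub_distrib, Finset.sum_range_succ]
    ring
  have hall : ∀ p P, p + 1 ≤ P → e P p = e (p + 1) p := by
    intro p P hP
    induction P, hP using Nat.le_induction with
    | base => rfl
    | succ P hP ih => rw [hstep P p hP, ih]
  refine ⟨fun p => e (p + 1) p, fun P => (he P).congr_left fun n => ?_⟩
  congr 1
  refine Finset.sum_congr rfl fun p hp => ?_
  rw [hall p P (Finset.mem_range.1 hp)]

lemma tendsto_of_expansion {W c : ℕ → ℝ}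
    (hW : ∀ P : ℕ, (fun n : ℕ => W n - ∑ p ∈ Finset.range P, c p / (n : ℝ) ^ p)
      =O[atTop] fun n : ℕ => 1 / (n : ℝ) ^ P) : Tendsto W atTop (𝓝 (c 0)) := by
  have h := (hW 1).trans_tendsto (tendsto_one_div_natCast_pow 0)
  simpa using h.add_const (c 0)

lemma log_expansion {W c : ℕ → ℝ} (hc : 0 < c 0)
    (hW : ∀ P : ℕ, (fun n : ℕ => W n - ∑ p ∈ Finset.range P, c p / (n : ℝ) ^ p)
      =O[atTop] fun n : ℕ => 1 / (n : ℝ) ^ P) :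
    ∃ d : ℕ → ℝ, d 0 = Real.log (c 0) ∧ ∀ P : ℕ,
      (fun n : ℕ => Real.log (W n) - ∑ p ∈ Finset.range P, d p / (n : ℝ) ^ p)
        =O[atTop] fun n : ℕ => 1 / (n : ℝ) ^ P := by
  have hWlim := tendsto_of_expansion hW
  obtain ⟨d, hd⟩ : ∃ d : ℕ → ℝ, ∀ P : ℕ,
      (fun n : ℕ => Real.log (W n) - ∑ p ∈ Finset.range P, d p / (n : ℝ) ^ p)
        =O[atTop] fun n : ℕ => 1 / (n : ℝ) ^ P := by
    refine exists_expansion_of_forall_order fun P => ?_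
    rcases P with _ | P
    · refine ⟨0, ?_⟩
      simpa using (((Real.continuousAt_log hc.ne').tendsto.comp hWlim).isBigO_one ℝ)
    set f : ℝ → ℝ := fun x => ∑ p ∈ Finset.range (P + 1), c p * x ^ p with hf
    have hf0 : f 0 = c 0 := by simp [hf, Finset.sum_range_succ']
    have hfan : AnalyticAt ℝ f 0 :=
      Finset.analyticAt_fun_sum _ fun p _ => analyticAt_const.mul (analyticAt_id.pow p)
    obtain ⟨s, hs⟩ := hfan.log (by rwa [hf0])
    have hinv : Tendsto (fun n : ℕ => 1 / (n : ℝ)) atTop (𝓝 0) :=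
      tendsto_one_div_atTop_nhds_zero_nat
    have hfn : ∀ n : ℕ, f (1 / (n : ℝ)) = ∑ p ∈ Finset.range (P + 1), c p / (n : ℝ) ^ p := by
      intro n
      refine Finset.sum_congr rfl fun p _ => ?_
      rw [div_pow, one_pow, mul_one_div]
    refine ⟨s.coeff, ?_⟩
    have h1 : (fun n : ℕ => Real.log (W n) - Real.log (f (1 / (n : ℝ)))) =O[atTop]
        fun n : ℕ => 1 / (n : ℝ) ^ (P + 1) := by
      have hflim : Tendsto (fun n : ℕ => f (1 / (n : ℝ))) atTop (𝓝 (c 0)) := by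
        rw [← hf0]; exact hfan.continuousAt.tendsto.comp hinv
      have h2 := (Real.hasStrictDerivAt_log hc.ne').hasStrictFDerivAt.isBigO_sub.comp_tendsto
        (hWlim.prodMk_nhds hflim)
      refine IsBigO.trans h2 ((hW (P + 1)).congr_left fun n => ?_)
      simp only [Function.comp_apply, hfn]
    have h3 : (fun n : ℕ => Real.log (f (1 / (n : ℝ))) -
        ∑ p ∈ Finset.range (P + 1), s.coeff p / (n : ℝ) ^ p) =O[atTop]
        fun n : ℕ => 1 / (n : ℝ) ^ (P + 1) := by
      refine ((hs.isBigO_sub_partialSum_pow (P + 1)).comp_tendsto hinv).congr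
        (fun n => ?_) (fun n => ?_)
      · simp only [Function.comp_apply, zero_add, FormalMultilinearSeries.partialSum,
          FormalMultilinearSeries.apply_eq_pow_smul_coeff, smul_eq_mul]
        congr 1
        refine Finset.sum_congr rfl fun p _ => ?_
        rw [div_pow, one_pow, one_div_mul_eq_div]
      · simp
    exact (h1.add h3).congr_left fun n => by ring
  refine ⟨d, tendsto_nhds_unique (tendsto_of_expansion hd) ?_, hd⟩
  exact (Real.continuousAt_log hc.ne').tendsto.comp hWlim

/-! ### The phase of the spherical model -/

lemma r0_spec (l : ℝ) : r0 l ∈ Ioo (-1 : ℝ) 1 ∧ l * (1 - r0 l ^ 2) = r0 l := by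
  by_cases hl : l = 0
  · simp [r0, hl]
  set S := √(1 + 4 * l ^ 2) with hS
  have hl2 : 0 < l ^ 2 := by positivity
  have hS2 : S ^ 2 = 1 + 4 * l ^ 2 := Real.sq_sqrt (by positivity)
  have hS1 : 1 < S := by
    rw [hS, Real.lt_sqrt one_pos.le]; linarith
  have hr : r0 l = (-1 + S) / (2 * l) := by simp [r0, hl, hS]
  have hlr : 2 * l * r0 l = S - 1 := by rw [hr]; field_simp; ring
  have hspec : l * (1 - r0 l ^ 2) = r0 l := by
    apply mul_left_cancel₀ (mul_ne_zero four_ne_zero hl)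
    linear_combination (-(2 * l * r0 l) - S - 1) * hlr - hS2
  have hr0 : 0 < r0 l ^ 2 := by
    have : r0 l ≠ 0 := by
      intro h; rw [h] at hlr; linarith
    positivity
  have h1 : 0 < 1 - r0 l ^ 2 := by
    have h2 : (S - 1) / 2 * (1 - r0 l ^ 2) = r0 l ^ 2 := by
      rw [← hlr]; linear_combination r0 l * hspec
    refine pos_of_mul_pos_right (a := (S - 1) / 2) (by rw [h2]; exact hr0) (by linarith)
  exact ⟨⟨by nlinarith, by nlinarith⟩, hspec⟩

/-- The phase `h_λ(r₀(λ)) - h_λ(r)`. -/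
noncomputable def sphericalPhase (l r : ℝ) : ℝ :=
  hAtSaddle l - (l * r + 1 / 2 * Real.log (1 - r ^ 2))

/-- The derivative of the phase divided by `r - r₀(λ)`. -/
noncomputable def sphericalSlope (l r : ℝ) : ℝ :=
  (1 + r * r0 l) / ((1 - r ^ 2) * (1 - r0 l ^ 2))

lemma one_sub_sq_pos {r : ℝ} (hr : r ∈ Ioo (-1 : ℝ) 1) : 0 < 1 - r ^ 2 := by
  nlinarith [hr.1, hr.2]

lemma sphericalSlope_pos (l : ℝ) {r : ℝ} (hr : r ∈ Ioo (-1 : ℝ) 1) : 0 < sphericalSlope l r := by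
  have h0 := (r0_spec l).1
  refine div_pos ?_ (mul_pos (one_sub_sq_pos hr) (one_sub_sq_pos h0))
  nlinarith [mul_pos (sub_pos.2 hr.2) (sub_pos.2 h0.2),
    mul_pos (neg_lt_iff_pos_add.1 hr.1) (neg_lt_iff_pos_add.1 h0.1)]

lemma hasDerivAt_sphericalPhase (l : ℝ) {r : ℝ} (hr : r ∈ Ioo (-1 : ℝ) 1) :
    HasDerivAt (sphericalPhase l) ((r - r0 l) * sphericalSlope l r) r := by
  have h1 := one_sub_sq_pos hr
  have h2 := one_sub_sq_pos (r0_spec l).1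
  have h3 : HasDerivAt (fun r : ℝ => 1 - r ^ 2) (-(2 * r)) r := by
    simpa using (hasDerivAt_pow 2 r).const_sub 1
  have h4 := (((hasDerivAt_id r).const_mul l).add ((h3.log h1.ne').const_mul (1 / 2))).const_sub
    (hAtSaddle l)
  refine HasDerivAt.congr_deriv (f := sphericalPhase l) h4 ?_
  have h5 : l = r0 l / (1 - r0 l ^ 2) := by
    rw [eq_div_iff h2.ne']; exact (r0_spec l).2
  rw [sphericalSlope, mul_one]
  nth_rewrite 1 [h5]
  field_simp
  ring

lemma analyticOnNhd_one_sub_sq (U : Set ℝ) : AnalyticOnNhd ℝ (fun r : ℝ => 1 - r ^ 2) U :=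
  fun _ _ => analyticAt_const.sub (analyticAt_id.pow 2)

lemma analyticOnNhd_sphericalPhase (l : ℝ) :
    AnalyticOnNhd ℝ (sphericalPhase l) (Ioo (-1 : ℝ) 1) := fun r hr =>
  analyticAt_const.sub ((analyticAt_const.mul analyticAt_id).add
    (analyticAt_const.mul ((analyticOnNhd_one_sub_sq _ r hr).log (one_sub_sq_pos hr))))

lemma analyticOnNhd_sphericalSlope (l : ℝ) :
    AnalyticOnNhd ℝ (sphericalSlope l) (Ioo (-1 : ℝ) 1) := fun r hr =>
  (analyticAt_const.add (analyticAt_id.mul analyticAt_const)).div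
    ((analyticOnNhd_one_sub_sq _ r hr).mul analyticAt_const)
    (mul_pos (one_sub_sq_pos hr) (one_sub_sq_pos (r0_spec l).1)).ne'

lemma sphericalPhase_r0 (l : ℝ) : sphericalPhase l (r0 l) = 0 := by
  simp [sphericalPhase, hAtSaddle]

lemma strictMonoOn_sphericalPhase (l : ℝ) :
    StrictMonoOn (sphericalPhase l) (Ico (r0 l) 1) := by
  have h0 := (r0_spec l).1
  have hsub : Ico (r0 l) 1 ⊆ Ioo (-1 : ℝ) 1 := fun x hx => ⟨h0.1.trans_le hx.1, hx.2⟩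
  refine strictMonoOn_of_deriv_pos (convex_Ico _ _)
    ((analyticOnNhd_sphericalPhase l).continuousOn.mono hsub) fun x hx => ?_
  rw [interior_Ico] at hx
  have hxU := hsub (Ioo_subset_Ico_self hx)
  rw [(hasDerivAt_sphericalPhase l hxU).deriv]
  exact mul_pos (sub_pos.2 hx.1) (sphericalSlope_pos l hxU)

lemma strictAntiOn_sphericalPhase (l : ℝ) :
    StrictAntiOn (sphericalPhase l) (Ioc (-1) (r0 l)) := by
  have h0 := (r0_spec l).1
  have hsub : Ioc (-1) (r0 l) ⊆ Ioo (-1 : ℝ) 1 := fun x hx => ⟨hx.1, hx.2.trans_lt h0.2⟩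
  refine strictAntiOn_of_deriv_neg (convex_Ioc _ _)
    ((analyticOnNhd_sphericalPhase l).continuousOn.mono hsub) fun x hx => ?_
  rw [interior_Ioc] at hx
  have hxU := hsub (Ioo_subset_Ioc_self hx)
  rw [(hasDerivAt_sphericalPhase l hxU).deriv]
  exact mul_neg_of_neg_of_pos (sub_neg.2 hx.2) (sphericalSlope_pos l hxU)

lemma sphericalPhase_pos (l : ℝ) {r : ℝ} (hr : r ∈ Ioo (-1 : ℝ) 1) (hne : r ≠ r0 l) :
    0 < sphericalPhase l r := by
  have h0 := (r0_spec l).1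
  rw [← sphericalPhase_r0 l]
  rcases lt_or_gt_of_ne hne with h | h
  · exact strictAntiOn_sphericalPhase l ⟨hr.1, h.le⟩ ⟨h0.1, le_rfl⟩ h
  · exact strictMonoOn_sphericalPhase l ⟨le_rfl, h0.2⟩ ⟨h.le, hr.2⟩ h

/-! ### The integral of the spherical model -/

/-- The unnormalized integrand of the moment generating function. -/
noncomputable def sphericalIntegrand (l : ℝ) (n : ℕ) (r : ℝ) : ℝ :=
  Real.exp ((n : ℝ) * l * r) * (1 - r ^ 2) ^ (((n : ℝ) - 4) / 2)

lemma continuous_sphericalIntegrand (l : ℝ) {n : ℕ} (hn : 4 ≤ n) :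
    Continuous (sphericalIntegrand l n) := by
  have hn' : (4 : ℝ) ≤ n := by exact_mod_cast hn
  refine Continuous.mul (by fun_prop) (Continuous.rpow_const (by fun_prop) fun _ => Or.inr ?_)
  linarith

lemma sphericalIntegrand_eq (l : ℝ) (n : ℕ) {r : ℝ} (hr : r ∈ Ioo (-1 : ℝ) 1) :
    sphericalIntegrand l n r = Real.exp (n * hAtSaddle l) *
      (Real.exp (-(n : ℝ) * sphericalPhase l r) * ((1 - r ^ 2) ^ 2)⁻¹) := by
  have h1 := one_sub_sq_pos hr
  have h2 : (((1 - r ^ 2) ^ 2)⁻¹ : ℝ) = Real.exp (Real.log (1 - r ^ 2) * (-2)) := by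
    rw [← Real.rpow_def_of_pos h1, Real.rpow_neg h1.le]; norm_cast
  rw [sphericalIntegrand, Real.rpow_def_of_pos h1, h2, ← Real.exp_add, ← Real.exp_add,
    ← Real.exp_add, sphericalPhase]
  congr 1
  ring

lemma negligible_tail (l : ℝ) {c d η : ℝ} (hcd : c ≤ d) (hc : -1 ≤ c) (hd : d ≤ 1) (hη : 0 < η)
    (h : ∀ r ∈ Icc c d, r ∈ Ioo (-1 : ℝ) 1 → η ≤ sphericalPhase l r) :
    Negligible (fun n : ℕ => √(n : ℝ) * (Real.exp (-(n : ℝ) * hAtSaddle l) *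
      ∫ r in c..d, sphericalIntegrand l n r)) := by
  refine Negligible.sqrt_mul (((negligible_exp_neg hη).const_mul
    (Real.exp (4 * (|l| + η - hAtSaddle l)) * |d - c|)).of_isBigO ?_)
  refine IsBigO.of_bound 1 ?_
  filter_upwards [eventually_ge_atTop 5] with n hn
  have hn' : (5 : ℝ) ≤ n := by exact_mod_cast hn
  have hbound : ∀ r ∈ uIoc c d, ‖sphericalIntegrand l n r‖ ≤
      Real.exp (4 * |l| + (n - 4) * (hAtSaddle l - η)) := by
    intro r hr
    rw [uIoc_of_le hcd] at hr
    have hr1 : -1 < r := hc.trans_lt hr.1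
    rcases (hr.2.trans hd).lt_or_eq with hr2 | rfl
    · have hU : r ∈ Ioo (-1 : ℝ) 1 := ⟨hr1, hr2⟩
      have h1 := one_sub_sq_pos hU
      have h2 := h r (Ioc_subset_Icc_self hr) hU
      rw [sphericalIntegrand, Real.rpow_def_of_pos h1, ← Real.exp_add,
        Real.norm_of_nonneg (Real.exp_pos _).le, Real.exp_le_exp]
      have h3 : l * r ≤ |l| := by
        refine (le_abs_self _).trans ?_
        rw [abs_mul]
        exact mul_le_of_le_one_right (abs_nonneg _) (abs_le.2 ⟨hr1.le, hr2.le⟩)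
      rw [sphericalPhase] at h2
      nlinarith [mul_le_mul_of_nonneg_left h2 (by linarith : (0 : ℝ) ≤ n - 4)]
    · rw [sphericalIntegrand, one_pow, sub_self, Real.zero_rpow (by linarith), mul_zero, norm_zero]
      exact (Real.exp_pos _).le
  have h1 := intervalIntegral.norm_integral_le_of_norm_le_const hbound
  rw [norm_mul, Real.norm_of_nonneg (Real.exp_pos _).le, one_mul]
  refine ((mul_le_mul_of_nonneg_left h1 (Real.exp_pos _).le).trans (le_of_eq ?_)).trans
    (le_abs_self _)
  rw [← mul_assoc, ← Real.exp_add, mul_right_comm, ← Real.exp_add]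
  congr 2
  ring

lemma sphericalIntegral_expansion (l : ℝ) :
    ∃ c : ℕ → ℝ, c 0 = c0 l ∧ ∀ P : ℕ,
      (fun n : ℕ => √(n : ℝ) * (Real.exp (-(n : ℝ) * hAtSaddle l) *
          ∫ r in (-1 : ℝ)..1, sphericalIntegrand l n r)
        - ∑ p ∈ Finset.range P, c p / (n : ℝ) ^ p) =O[atTop] fun n : ℕ => 1 / (n : ℝ) ^ P := by
  have h0 := (r0_spec l).1
  obtain ⟨a, ha1, ha0⟩ := exists_between h0.1
  obtain ⟨b, hb0, hb1⟩ := exists_between h0.2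
  have haU : a ∈ Ioo (-1 : ℝ) 1 := ⟨ha1, ha0.trans h0.2⟩
  have hbU : b ∈ Ioo (-1 : ℝ) 1 := ⟨h0.1.trans hb0, hb1⟩
  have habU : Icc a b ⊆ Ioo (-1 : ℝ) 1 := fun x hx => ⟨ha1.trans_le hx.1, hx.2.trans_lt hb1⟩
  have hq : AnalyticOnNhd ℝ (fun r : ℝ => ((1 - r ^ 2) ^ 2)⁻¹) (Ioo (-1 : ℝ) 1) := fun r hr =>
    ((analyticOnNhd_one_sub_sq _ r hr).pow 2).inv (pow_pos (one_sub_sq_pos hr) 2).ne'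
  obtain ⟨c, hc0, hc⟩ := laplaceIntegral_expansion isOpen_Ioo ha0 hb0 habU
    (analyticOnNhd_sphericalPhase l) (sphericalPhase_r0 l) (fun x hx => sphericalPhase_pos l hx)
    (analyticOnNhd_sphericalSlope l) (fun x hx => sphericalSlope_pos l hx)
    (fun x hx => hasDerivAt_sphericalPhase l hx) hq
  have htail1 := negligible_tail l ha1.le le_rfl haU.2.le (sphericalPhase_pos l haU ha0.ne)
    fun r hr hrU => (strictAntiOn_sphericalPhase l).antitoneOn ⟨hrU.1, hr.2.trans ha0.le⟩
      ⟨ha1, ha0.le⟩ hr.2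
  have htail2 := negligible_tail l hb1.le hbU.1.le le_rfl (sphericalPhase_pos l hbU hb0.ne')
    fun r hr hrU => (strictMonoOn_sphericalPhase l).monotoneOn ⟨hb0.le, hb1⟩
      ⟨hb0.le.trans hr.1, hrU.2⟩ hr.1
  refine ⟨c, ?_, fun P => ?_⟩
  · rw [hc0, c0, mul_comm]
    have h1 := one_sub_sq_pos h0
    have h2 : sphericalSlope l (r0 l) = |(-(1 + r0 l ^ 2) / (1 - r0 l ^ 2) ^ 2)| := by
      rw [neg_div, abs_neg, abs_of_pos (by positivity), sphericalSlope]
      ring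
    rw [h2]
  · refine (((htail1.add htail2) P).add (hc P)).congr' ?_ .rfl
    filter_upwards [eventually_ge_atTop 4] with n hn
    have hcont := continuous_sphericalIntegrand l hn
    have hmid : Real.exp (-(n : ℝ) * hAtSaddle l) * ∫ r in a..b, sphericalIntegrand l n r =
        ∫ r in a..b, Real.exp (-(n : ℝ) * sphericalPhase l r) * ((1 - r ^ 2) ^ 2)⁻¹ := by
      rw [← intervalIntegral.integral_const_mul]
      refine intervalIntegral.integral_congr fun r hr => ?_
      rw [uIcc_of_le (ha0.trans hb0).le] at hr
      simp only [sphericalIntegrand_eq l n (habU hr)]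
      rw [← mul_assoc, ← Real.exp_add, neg_mul, neg_add_cancel, Real.exp_zero, one_mul]
    rw [laplaceIntegral, ← hmid, ← intervalIntegral.integral_add_adjacent_intervals
      (hcont.intervalIntegrable (-1) b) (hcont.intervalIntegrable b 1),
      ← intervalIntegral.integral_add_adjacent_intervals
      (hcont.intervalIntegrable (-1) a) (hcont.intervalIntegrable a b)]
    ring

lemma c0_pos (l : ℝ) : 0 < c0 l := by
  have h1 := one_sub_sq_pos (r0_spec l).1
  have h2 : -(1 + r0 l ^ 2) / (1 - r0 l ^ 2) ^ 2 ≠ 0 :=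
    div_ne_zero (by nlinarith [sq_nonneg (r0 l)]) (by positivity)
  have h3 := abs_pos.2 h2
  unfold c0
  positivity

lemma GammaBf_pos {n : ℕ} (hn : 3 ≤ n) : 0 < GammaBf n := by
  have hn' : (3 : ℝ) ≤ n := by exact_mod_cast hn
  exact div_pos (Real.Gamma_pos_of_pos (by linarith))
    (mul_pos (Real.sqrt_pos.2 Real.pi_pos) (Real.Gamma_pos_of_pos (by linarith)))

theorem stmt_16 (lam : ℝ) :
    ∃ R : ℕ → ℝ, R 0 = Real.log (c0 lam) ∧
      ∀ P : ℕ,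
        (fun n : ℕ =>
            Ln n lam
              - (hAtSaddle lam + (1 / (n : ℝ)) * Real.log (GammaBf n)
                  - (1 / (2 * (n : ℝ))) * Real.log (n : ℝ)
                  + (1 / (n : ℝ)) *
                      ∑ p ∈ Finset.range (P + 1),
                        R p / ((n : ℝ) ^ p * (p.factorial : ℝ))))
          =O[atTop] (fun n : ℕ => 1 / (n : ℝ) ^ (P + 2)) := by
  obtain ⟨c, hc0, hc⟩ := sphericalIntegral_expansion lam
  have hcpos : 0 < c 0 := hc0 ▸ c0_pos lam
  obtain ⟨d, hd0, hd⟩ := log_expansion hcpos hc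
  refine ⟨fun p => d p * p.factorial, by simp [hd0, hc0], fun P => ?_⟩
  have h1 := (isBigO_refl (fun n : ℕ => 1 / (n : ℝ)) atTop).mul (hd (P + 1))
  refine h1.congr' ?_ (Eventually.of_forall fun n => ?_)
  · filter_upwards [eventually_ge_atTop 3,
      (tendsto_of_expansion hc).eventually (lt_mem_nhds hcpos)] with n hn hWpos
    have hn' : (0 : ℝ) < n := by positivity
    have hI : (∫ r in (-1 : ℝ)..1, sphericalIntegrand lam n r) ≠ 0 := by
      intro h
      simp [h] at hWpos
    have hsum : ∑ p ∈ Finset.range (P + 1),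
        d p * (p.factorial : ℝ) / ((n : ℝ) ^ p * (p.factorial : ℝ)) =
          ∑ p ∈ Finset.range (P + 1), d p / (n : ℝ) ^ p :=
      Finset.sum_congr rfl fun p _ => mul_div_mul_right _ _ (by positivity)
    have hL : Ln n lam = 1 / (n : ℝ) * (Real.log (GammaBf n) +
        Real.log (∫ r in (-1 : ℝ)..1, sphericalIntegrand lam n r)) := by
      rw [← Real.log_mul (GammaBf_pos hn).ne' hI]; rfl
    rw [hL, hsum, Real.log_mul (Real.sqrt_pos.2 hn').ne' (mul_ne_zero (Real.exp_ne_zero _) hI),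
      Real.log_mul (Real.exp_ne_zero _) hI, Real.log_exp, Real.log_sqrt hn'.le]
    field_simp
    ring
  · simp only [one_div_mul_one_div, ← pow_succ']
end

section
/- For every c ∈ (0,1) and every integer p ≥ 0, there exist real numbers δ_{c,1}, …, δ_{c,p} such that, as n → ∞, Γ((n-1)/2)/(√π · Γ((n-2)/2)) · ∫_{c}^{1} (1-r²)^{(n-4)/2} dr = [ (1-c²)^{n/2} / ( (1-c²) √(1+c²) · λ_c σ_c √(2πn) ) ] · [ 1 + Σ_{k=1}^{p} δ_{c,k}/n^k + O(n^{-(p+1)}) ], where λ_c = c/(1-c²) and σ_c = (1-c²)/√(1+c²). -/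
open Real Filter Asymptotics

open Polynomial Topology

/-- `f n` agrees with a polynomial in `1 / n` up to an error `O(1 / n ^ N)`. -/
def HasInvExpansion (f : ℕ → ℝ) (N : ℕ) : Prop :=
  ∃ P : ℝ[X], (fun n : ℕ => f n - P.eval (n : ℝ)⁻¹) =O[atTop] fun n : ℕ => ((n : ℝ)⁻¹) ^ N

lemma tendsto_natCast_inv : Tendsto (fun n : ℕ => (n : ℝ)⁻¹) atTop (𝓝 0) :=
  tendsto_inv_atTop_zero.comp tendsto_natCast_atTop_atTop

lemma isBigO_natCast_inv_pow_of_le {M N : ℕ} (h : M ≤ N) :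
    (fun n : ℕ => ((n : ℝ)⁻¹) ^ N) =O[atTop] fun n : ℕ => ((n : ℝ)⁻¹) ^ M := by
  refine IsBigO.of_bound 1 ?_
  filter_upwards [eventually_ge_atTop 1] with n hn
  have hn' : (1 : ℝ) ≤ n := by exact_mod_cast hn
  rw [one_mul, norm_pow, norm_pow, Real.norm_of_nonneg (by positivity)]
  exact pow_le_pow_of_le_one (by positivity) (inv_le_one_of_one_le₀ hn') h

lemma tendsto_eval_natCast_inv (P : ℝ[X]) :
    Tendsto (fun n : ℕ => P.eval (n : ℝ)⁻¹) atTop (𝓝 (P.coeff 0)) := by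
  rw [P.coeff_zero_eq_eval_zero]
  exact (P.continuous.tendsto 0).comp tendsto_natCast_inv

lemma isBigO_eval_natCast_inv (P : ℝ[X]) :
    (fun n : ℕ => P.eval (n : ℝ)⁻¹) =O[atTop] fun _ => (1 : ℝ) :=
  (tendsto_eval_natCast_inv P).isBigO_one ℝ

namespace HasInvExpansion

variable {f g : ℕ → ℝ} {M N : ℕ}

lemma mono (hf : HasInvExpansion f N) (h : M ≤ N) : HasInvExpansion f M := by
  obtain ⟨P, hP⟩ := hf
  exact ⟨P, hP.trans (isBigO_natCast_inv_pow_of_le h)⟩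

lemma isBigO_one (hf : HasInvExpansion f N) : f =O[atTop] fun _ => (1 : ℝ) := by
  obtain ⟨P, hP⟩ := hf.mono (Nat.zero_le N)
  simp only [pow_zero] at hP
  simpa using hP.add (isBigO_eval_natCast_inv P)

lemma of_isBigO (hf : f =O[atTop] fun n : ℕ => ((n : ℝ)⁻¹) ^ N) : HasInvExpansion f N :=
  ⟨0, by simpa using hf⟩

lemma congr' (hf : HasInvExpansion f N) (h : f =ᶠ[atTop] g) : HasInvExpansion g N := by
  obtain ⟨P, hP⟩ := hf
  refine ⟨P, hP.congr' ?_ EventuallyEq.rfl⟩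
  filter_upwards [h] with n hn
  rw [hn]

lemma const (a : ℝ) (N : ℕ) : HasInvExpansion (fun _ => a) N :=
  ⟨C a, by simpa using isBigO_zero _ _⟩

lemma inv (N : ℕ) : HasInvExpansion (fun n : ℕ => (n : ℝ)⁻¹) N :=
  ⟨X, by simpa using isBigO_zero _ _⟩

lemma add (hf : HasInvExpansion f N) (hg : HasInvExpansion g N) :
    HasInvExpansion (fun n => f n + g n) N := by
  obtain ⟨P, hP⟩ := hf
  obtain ⟨Q, hQ⟩ := hg
  refine ⟨P + Q, (hP.add hQ).congr_left fun n => ?_⟩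
  rw [eval_add]
  ring

lemma mul (hf : HasInvExpansion f N) (hg : HasInvExpansion g N) :
    HasInvExpansion (fun n => f n * g n) N := by
  have hf1 := hf.isBigO_one
  obtain ⟨P, hP⟩ := hf
  obtain ⟨Q, hQ⟩ := hg
  refine ⟨P * Q, ?_⟩
  have h := (hf1.mul hQ).add ((isBigO_eval_natCast_inv Q).mul hP)
  simp only [one_mul] at h
  refine h.congr_left fun n => ?_
  rw [eval_mul]
  ring

lemma const_mul (a : ℝ) (hf : HasInvExpansion f N) : HasInvExpansion (fun n => a * f n) N :=
  (const a N).mul hf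

lemma sub (hf : HasInvExpansion f N) (hg : HasInvExpansion g N) :
    HasInvExpansion (fun n => f n - g n) N :=
  (hf.add (hg.const_mul (-1))).congr' (Eventually.of_forall fun n => by ring)

lemma pow (hf : HasInvExpansion f N) (k : ℕ) : HasInvExpansion (fun n => f n ^ k) N := by
  induction k with
  | zero => simpa using const 1 N
  | succ k ih => simpa only [pow_succ] using ih.mul hf

lemma inv_mul (hf : HasInvExpansion f N) :
    HasInvExpansion (fun n : ℕ => (n : ℝ)⁻¹ * f n) (N + 1) := by
  obtain ⟨P, hP⟩ := hf
  refine ⟨X * P, ?_⟩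
  refine ((isBigO_refl (fun n : ℕ => (n : ℝ)⁻¹) atTop).mul hP).congr (fun n => ?_) fun n => ?_
  · rw [eval_mul, eval_X]
    ring
  · ring

lemma exists_eq_add (hf : HasInvExpansion f (N + 1)) :
    ∃ a : ℝ, ∃ g : ℕ → ℝ, HasInvExpansion g N ∧ ∀ᶠ n : ℕ in atTop, f n = a + (n : ℝ)⁻¹ * g n := by
  obtain ⟨P, hP⟩ := hf
  refine ⟨P.coeff 0, fun n => n * (f n - P.coeff 0), ⟨P.divX, ?_⟩, ?_⟩
  · refine ((isBigO_refl (fun n : ℕ => (n : ℝ)) atTop).mul hP).congr' ?_ ?_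
    · filter_upwards [eventually_ge_atTop 1] with n hn
      have hn' : (n : ℝ) ≠ 0 := by positivity
      have := congrArg (eval (n : ℝ)⁻¹) P.X_mul_divX_add
      simp only [eval_add, eval_mul, eval_X, eval_C] at this
      rw [← this]
      field_simp
      ring
    · filter_upwards [eventually_ge_atTop 1] with n hn
      have hn' : (n : ℝ) ≠ 0 := by positivity
      rw [pow_succ', ← mul_assoc, mul_inv_cancel₀ hn', one_mul]
  · filter_upwards [eventually_ge_atTop 1] with n hn
    have hn' : (n : ℝ) ≠ 0 := by positivity
    field_simp
    ring

lemma exists_coeff (hf : HasInvExpansion f (N + 1)) {L : ℝ} (hL : Tendsto f atTop (𝓝 L)) :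
    ∃ a : ℕ → ℝ, (fun n : ℕ => f n - (L + ∑ k ∈ Finset.Icc 1 N, a k / (n : ℝ) ^ k))
      =O[atTop] fun n : ℕ => 1 / (n : ℝ) ^ (N + 1) := by
  obtain ⟨P, hP⟩ := hf
  have h0 : P.coeff 0 = L := by
    have h1 : Tendsto (fun n : ℕ => ((n : ℝ)⁻¹) ^ (N + 1)) atTop (𝓝 0) := by
      simpa using tendsto_natCast_inv.pow (N + 1)
    have h2 := hL.sub (tendsto_eval_natCast_inv P)
    have h3 := tendsto_nhds_unique h2 (hP.trans_tendsto h1)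
    linarith
  refine ⟨P.coeff, ?_⟩
  have key : (fun n : ℕ => ∑ k ∈ Finset.Icc (N + 1) (P.natDegree + N + 1),
      P.coeff k * ((n : ℝ)⁻¹) ^ k) =O[atTop] fun n : ℕ => ((n : ℝ)⁻¹) ^ (N + 1) := by
    refine IsBigO.fun_sum fun k hk => ?_
    exact (isBigO_natCast_inv_pow_of_le (Finset.mem_Icc.1 hk).1).const_mul_left _
  refine (hP.add key).congr (fun n => ?_) fun n => by simp
  rw [eval_eq_sum_range' (n := P.natDegree + N + 2) (by omega), ← h0]
  have hI : Finset.range (P.natDegree + N + 2)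
      = insert 0 (Finset.Icc 1 N ∪ Finset.Icc (N + 1) (P.natDegree + N + 1)) := by
    ext k
    simp only [Finset.mem_range, Finset.mem_insert, Finset.mem_union, Finset.mem_Icc]
    omega
  rw [hI, Finset.sum_insert (by simp), Finset.sum_union]
  · simp only [pow_zero, mul_one, div_eq_mul_inv, inv_pow]
    ring
  · rw [Finset.disjoint_left]
    intro k hk
    simp only [Finset.mem_Icc] at hk ⊢
    omega

lemma of_analyticAt {φ : ℝ → ℝ} (hφ : AnalyticAt ℝ φ 0) (N : ℕ) :
    HasInvExpansion (fun n : ℕ => φ (n : ℝ)⁻¹) N := by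
  obtain ⟨p, hp⟩ := hφ
  have h := (hp.isBigO_sub_partialSum_pow N).comp_tendsto tendsto_natCast_inv
  refine ⟨∑ k ∈ Finset.range N, C (p.coeff k) * X ^ k, ?_⟩
  refine (h.trans ?_).congr_left fun n => ?_
  · exact IsBigO.of_bound 1 (Eventually.of_forall fun n => by simp)
  · simp only [Function.comp_apply, zero_add, FormalMultilinearSeries.partialSum,
      FormalMultilinearSeries.apply_eq_pow_smul_coeff, eval_finsetSum, eval_mul, eval_C, eval_pow,
      eval_X, smul_eq_mul, mul_comm]

end HasInvExpansion

lemma isBigO_natCast_inv_pow_of_sub {f : ℕ → ℝ} {j : ℕ} (hf : Tendsto f atTop (𝓝 0))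
    (hd : (fun n => f (n + 2) - f n) =O[atTop] fun n : ℕ => ((n : ℝ)⁻¹) ^ (j + 2)) :
    f =O[atTop] fun n : ℕ => ((n : ℝ)⁻¹) ^ (j + 1) := by
  obtain ⟨K, hK, hb⟩ := hd.exists_pos
  obtain ⟨m, hm⟩ := eventually_atTop.1 hb.bound
  have nonpos : ∀ g : ℕ → ℝ, Tendsto g atTop (𝓝 0) →
      ∀ n, (∀ k ≥ n, g k ≤ g (k + 2)) → g n ≤ 0 := by
    intro g hg n hmono
    have h1 : Monotone fun k : ℕ => g (n + 2 * k) :=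
      monotone_nat_of_le_succ fun k => hmono (n + 2 * k) (by omega)
    have h2 : Tendsto (fun k : ℕ => g (n + 2 * k)) atTop (𝓝 0) :=
      hg.comp (tendsto_atTop_mono (fun k => by simp only [id]; omega) tendsto_id)
    exact h1.ge_of_tendsto h2 0
  have hpow : Tendsto (fun n : ℕ => 3 * K / 2 * ((n : ℝ)⁻¹) ^ (j + 1)) atTop (𝓝 0) := by
    simpa using (tendsto_natCast_inv.pow (j + 1)).const_mul (3 * K / 2)
  have step : ∀ n : ℕ, 1 ≤ n → K * ((n : ℝ)⁻¹) ^ (j + 2) ≤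
      3 * K / 2 * ((n : ℝ)⁻¹) ^ (j + 1) - 3 * K / 2 * (((n + 2 : ℕ) : ℝ)⁻¹) ^ (j + 1) := by
    intro n hn
    have hn' : (1 : ℝ) ≤ n := by exact_mod_cast hn
    push_cast
    have h1 : ((n + 2 : ℝ)⁻¹) ^ j ≤ ((n : ℝ)⁻¹) ^ j := by
      gcongr
      linarith
    have h2 : ((n + 2 : ℝ)⁻¹) ^ (j + 1) ≤ ((n : ℝ)⁻¹) ^ j * (n + 2 : ℝ)⁻¹ := by
      rw [pow_succ]
      gcongr
    have h3 : (n : ℝ)⁻¹ * (n : ℝ)⁻¹ ≤ 3 / 2 * ((n : ℝ)⁻¹ - (n + 2 : ℝ)⁻¹) := by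
      have : 3 / 2 * ((n : ℝ)⁻¹ - (n + 2 : ℝ)⁻¹) - (n : ℝ)⁻¹ * (n : ℝ)⁻¹
          = (2 * n - 2) / (n * n * (n + 2)) := by
        field_simp
        ring
      have : 0 ≤ (2 * n - 2 : ℝ) / (n * n * (n + 2)) := div_nonneg (by linarith) (by positivity)
      linarith
    calc K * ((n : ℝ)⁻¹) ^ (j + 2) = K * ((n : ℝ)⁻¹) ^ j * ((n : ℝ)⁻¹ * (n : ℝ)⁻¹) := by ring
      _ ≤ K * ((n : ℝ)⁻¹) ^ j * (3 / 2 * ((n : ℝ)⁻¹ - (n + 2 : ℝ)⁻¹)) := by gcongr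
      _ = 3 * K / 2 * ((n : ℝ)⁻¹) ^ (j + 1) - 3 * K / 2 * (((n : ℝ)⁻¹) ^ j * (n + 2 : ℝ)⁻¹) := by
        ring
      _ ≤ _ := by gcongr
  refine IsBigO.of_bound (3 * K / 2) ?_
  filter_upwards [eventually_ge_atTop (max 1 m)] with n hn
  have hdiff : ∀ k ≥ n, |f (k + 2) - f k| ≤ K * ((k : ℝ)⁻¹) ^ (j + 2) := by
    intro k hk
    have := hm k (by omega)
    rwa [Real.norm_eq_abs, Real.norm_of_nonneg (by positivity)] at this
  rw [Real.norm_eq_abs, Real.norm_of_nonneg (by positivity), abs_le]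
  constructor
  · have := nonpos (fun n => - f n - 3 * K / 2 * ((n : ℝ)⁻¹) ^ (j + 1))
      (by simpa using hf.neg.sub hpow) n fun k hk => by
        have h1 := step k (by omega)
        have h2 := abs_le.1 (hdiff k hk)
        linarith [h2.2]
    linarith
  · have := nonpos (fun n => f n - 3 * K / 2 * ((n : ℝ)⁻¹) ^ (j + 1))
      (by simpa using hf.sub hpow) n fun k hk => by
        have h1 := step k (by omega)
        have h2 := abs_le.1 (hdiff k hk)
        linarith [h2.1]
    linarith

lemma exists_natCast_add_two_inv_pow (k : ℕ) :
    ∃ θ : ℕ → ℝ, (∀ N, HasInvExpansion θ N) ∧ ∀ᶠ n : ℕ in atTop,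
      (((n + 2 : ℕ) : ℝ)⁻¹) ^ k
        = ((n : ℝ)⁻¹) ^ k * (1 - 2 * k * (n : ℝ)⁻¹ + ((n : ℝ)⁻¹) ^ 2 * θ n) := by
  have hw : ∀ N, HasInvExpansion (fun n : ℕ => (1 + 2 * (n : ℝ)⁻¹)⁻¹) N := fun N =>
    HasInvExpansion.of_analyticAt (φ := fun x => (1 + 2 * x)⁻¹)
      (by fun_prop (disch := norm_num)) N
  induction k with
  | zero => exact ⟨fun _ => 0, HasInvExpansion.const 0, by simp⟩
  | succ k ih =>
    obtain ⟨θ, hθ, h⟩ := ih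
    refine ⟨fun n : ℕ => 4 * k + 4 * (1 + 2 * (n : ℝ)⁻¹)⁻¹ * (1 - 2 * k * (n : ℝ)⁻¹)
      + (1 + 2 * (n : ℝ)⁻¹)⁻¹ * θ n, fun N => ?_, ?_⟩
    · exact ((HasInvExpansion.const _ N).add (((hw N).const_mul 4).mul
        ((HasInvExpansion.const 1 N).sub ((HasInvExpansion.inv N).const_mul _)))).add
        ((hw N).mul (hθ N))
    · filter_upwards [h, eventually_ge_atTop 1] with n hn hn1
      have hn' : (n : ℝ) ≠ 0 := by positivity
      have h2 : (n : ℝ) + 2 ≠ 0 := by positivity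
      rw [pow_succ, hn]
      push_cast
      have e : ((n : ℝ) + 2)⁻¹ = (n : ℝ)⁻¹ * (1 + 2 * (n : ℝ)⁻¹)⁻¹ := by
        field_simp
      have e2 : (1 + 2 * (n : ℝ)⁻¹)⁻¹
          = 1 - 2 * (n : ℝ)⁻¹ + 4 * ((n : ℝ)⁻¹) ^ 2 * (1 + 2 * (n : ℝ)⁻¹)⁻¹ := by
        field_simp
        ring
      rw [e, pow_succ]
      linear_combination ((n : ℝ)⁻¹) ^ k * (n : ℝ)⁻¹ * (1 - 2 * k * (n : ℝ)⁻¹) * e2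

lemma HasInvExpansion.of_sub (N : ℕ) : ∀ (j : ℕ) (f G : ℕ → ℝ), HasInvExpansion G N →
    Tendsto f atTop (𝓝 0) →
    (∀ᶠ n : ℕ in atTop, f (n + 2) - f n = ((n : ℝ)⁻¹) ^ (j + 2) * G n) →
    HasInvExpansion f (N + j + 1) := by
  induction N with
  | zero =>
    intro j f G hG hf h
    rw [zero_add]
    refine HasInvExpansion.of_isBigO (isBigO_natCast_inv_pow_of_sub hf ?_)
    have := (isBigO_refl (fun n : ℕ => ((n : ℝ)⁻¹) ^ (j + 2)) atTop).mul hG.isBigO_one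
    simp only [mul_one] at this
    exact this.congr' (h.mono fun n hn => hn.symm) EventuallyEq.rfl
  | succ N ih =>
    intro j f G hG hf h
    obtain ⟨a, G', hG', hGe⟩ := hG.exists_eq_add
    obtain ⟨θ, hθ, hθe⟩ := exists_natCast_add_two_inv_pow (j + 1)
    set b : ℝ := -a / (2 * (j + 1)) with hb
    have hb' : 2 * (j + 1) * b = -a := by
      rw [hb]
      field_simp
    have hpow : Tendsto (fun n : ℕ => b * ((n : ℝ)⁻¹) ^ (j + 1)) atTop (𝓝 0) := by
      simpa using (tendsto_natCast_inv.pow (j + 1)).const_mul b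
    have key := ih (j + 1) (fun n => f n - b * ((n : ℝ)⁻¹) ^ (j + 1)) (fun n => G' n - b * θ n)
      (hG'.sub ((hθ N).const_mul b)) (by simpa using hf.sub hpow) ?_
    · have h2 := key.add (((HasInvExpansion.inv (N + (j + 1) + 1)).pow (j + 1)).const_mul b)
      rw [show N + 1 + j + 1 = N + (j + 1) + 1 by ring]
      exact h2.congr' (Eventually.of_forall fun n => by ring)
    · filter_upwards [h, hGe, hθe] with n h1 h2 h3
      rw [h2] at h1
      rw [h3]
      push_cast
      linear_combination h1 + ((n : ℝ)⁻¹) ^ (j + 2) * hb'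

lemma HasInvExpansion.of_add_two_eq_mul {f ψ : ℕ → ℝ} {L : ℝ} (hf : Tendsto f atTop (𝓝 L))
    (hψ : ∀ N, HasInvExpansion ψ N)
    (h : ∀ᶠ n : ℕ in atTop, f (n + 2) = f n * (1 + ((n : ℝ)⁻¹) ^ 2 * ψ n)) (N : ℕ) :
    HasInvExpansion f N := by
  induction N with
  | zero => exact HasInvExpansion.of_isBigO (by simpa using hf.isBigO_one ℝ)
  | succ N ih =>
    have key := HasInvExpansion.of_sub N 0 (fun n => f n - L) (fun n => f n * ψ n)
      (ih.mul (hψ N)) (by simpa using hf.sub_const L) (by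
        filter_upwards [h] with n hn
        rw [hn]
        ring)
    exact (key.add (HasInvExpansion.const L _)).congr' (Eventually.of_forall fun n => by ring)

lemma analyticAt_sqrt_one_add_two_mul : AnalyticAt ℝ (fun x : ℝ => √(1 + 2 * x)) 0 :=
  ContDiffAt.analyticAt (ContDiffAt.sqrt (by fun_prop) (by norm_num))

lemma sq_Gamma_add_half_le {x : ℝ} (hx : 0 < x) :
    Real.Gamma (x + 1 / 2) ^ 2 ≤ Real.Gamma x * Real.Gamma (x + 1) := by
  have h := Real.Gamma_mul_add_mul_le_rpow_Gamma_mul_rpow_Gamma hx (add_pos hx one_pos)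
    (a := 1 / 2) (b := 1 / 2) (by norm_num) (by norm_num) (by norm_num)
  rw [show 1 / 2 * x + 1 / 2 * (x + 1) = x + 1 / 2 by ring, ← Real.sqrt_eq_rpow,
    ← Real.sqrt_eq_rpow] at h
  have h1 := Real.Gamma_pos_of_pos hx
  have h2 := Real.Gamma_pos_of_pos (add_pos hx one_pos)
  have h3 := Real.Gamma_pos_of_pos (add_pos hx (one_half_pos (α := ℝ)))
  calc Real.Gamma (x + 1 / 2) ^ 2 ≤ (√(Real.Gamma x) * √(Real.Gamma (x + 1))) ^ 2 := by gcongr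
    _ = _ := by rw [mul_pow, Real.sq_sqrt h1.le, Real.sq_sqrt h2.le]

lemma sq_Gamma_ratio_le {x : ℝ} (hx : 0 < x) :
    (Real.Gamma (x + 1 / 2) / Real.Gamma x) ^ 2 ≤ x := by
  have h := sq_Gamma_add_half_le hx
  have h1 := Real.Gamma_pos_of_pos hx
  rw [Real.Gamma_add_one hx.ne'] at h
  rw [div_pow, div_le_iff₀ (by positivity)]
  linarith

lemma le_sq_Gamma_ratio {x : ℝ} (hx : 1 / 2 < x) :
    x - 1 / 2 ≤ (Real.Gamma (x + 1 / 2) / Real.Gamma x) ^ 2 := by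
  have hx0 : 0 < x - 1 / 2 := by linarith
  have h := sq_Gamma_add_half_le hx0
  have h1 := Real.Gamma_pos_of_pos (show 0 < x by linarith)
  have h2 := Real.Gamma_add_one hx0.ne'
  rw [show x - 1 / 2 + 1 = x + 1 / 2 by ring] at h h2
  rw [sub_add_cancel] at h
  rw [div_pow, le_div_iff₀ (by positivity)]
  calc (x - 1 / 2) * Real.Gamma x ^ 2
      ≤ (x - 1 / 2) * (Real.Gamma (x - 1 / 2) * Real.Gamma (x + 1 / 2)) := by gcongr
    _ = Real.Gamma (x + 1 / 2) ^ 2 := by rw [h2]; ring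

/-- The ratio `Γ((n - 1) / 2) / Γ((n - 2) / 2)`, divided by `√n`. -/
noncomputable def gammaRatio (n : ℕ) : ℝ :=
  Real.Gamma (((n : ℝ) - 1) / 2) / Real.Gamma (((n : ℝ) - 2) / 2) / √n

lemma tendsto_gammaRatio : Tendsto gammaRatio atTop (𝓝 (√2)⁻¹) := by
  have hsq : Tendsto (fun n => gammaRatio n ^ 2) atTop (𝓝 (1 / 2)) := by
    have hl : Tendsto (fun n : ℕ => 1 / 2 - 3 / 2 * (n : ℝ)⁻¹) atTop (𝓝 (1 / 2)) := by
      simpa using (tendsto_natCast_inv.const_mul (3 / 2 : ℝ)).const_sub (1 / 2 : ℝ)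
    have hu : Tendsto (fun n : ℕ => 1 / 2 - (n : ℝ)⁻¹) atTop (𝓝 (1 / 2)) := by
      simpa using tendsto_natCast_inv.const_sub (1 / 2 : ℝ)
    refine tendsto_of_tendsto_of_tendsto_of_le_of_le' hl hu ?_ ?_
    · filter_upwards [eventually_ge_atTop 4] with n hn
      have hn' : (4 : ℝ) ≤ n := by exact_mod_cast hn
      have h := le_sq_Gamma_ratio (x := ((n : ℝ) - 2) / 2) (by linarith)
      rw [show ((n : ℝ) - 2) / 2 + 1 / 2 = ((n : ℝ) - 1) / 2 by ring] at h
      rw [gammaRatio, div_pow _ (√(n : ℝ)), Real.sq_sqrt (by positivity),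
        le_div_iff₀ (by positivity)]
      refine le_trans (le_of_eq ?_) h
      field_simp
      ring
    · filter_upwards [eventually_ge_atTop 4] with n hn
      have hn' : (4 : ℝ) ≤ n := by exact_mod_cast hn
      have h := sq_Gamma_ratio_le (x := ((n : ℝ) - 2) / 2) (by linarith)
      rw [show ((n : ℝ) - 2) / 2 + 1 / 2 = ((n : ℝ) - 1) / 2 by ring] at h
      rw [gammaRatio, div_pow _ (√(n : ℝ)), Real.sq_sqrt (by positivity),
        div_le_iff₀ (by positivity)]
      refine le_trans h (le_of_eq ?_)
      field_simp
  have h := hsq.sqrt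
  rw [show √(1 / 2 : ℝ) = (√2)⁻¹ by rw [one_div, Real.sqrt_inv]] at h
  refine h.congr' ?_
  filter_upwards [eventually_ge_atTop 4] with n hn
  have hn' : (4 : ℝ) ≤ n := by exact_mod_cast hn
  have h1 := Real.Gamma_pos_of_pos (show 0 < ((n : ℝ) - 1) / 2 by linarith)
  have h2 := Real.Gamma_pos_of_pos (show 0 < ((n : ℝ) - 2) / 2 by linarith)
  exact Real.sqrt_sq (by unfold gammaRatio; positivity)

lemma hasInvExpansion_gammaRatio (N : ℕ) : HasInvExpansion gammaRatio N := by
  have hs := analyticAt_sqrt_one_add_two_mul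
  have hφ : AnalyticAt ℝ (fun x : ℝ => (5 - 8 * x) / ((1 - 2 * x) ^ 2 * (1 + 2 * x) *
      ((1 - x) / (1 - 2 * x) / √(1 + 2 * x) + 1))) 0 := by
    fun_prop (disch := norm_num)
  refine HasInvExpansion.of_add_two_eq_mul tendsto_gammaRatio 
    (fun N => HasInvExpansion.of_analyticAt hφ N) ?_ N
  filter_upwards [eventually_ge_atTop 4] with n hn
  have hn' : (4 : ℝ) ≤ n := by exact_mod_cast hn
  have h1 := Real.Gamma_add_one (show ((n : ℝ) - 1) / 2 ≠ 0 by linarith)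
  have h2 := Real.Gamma_add_one (show ((n : ℝ) - 2) / 2 ≠ 0 by linarith)
  have hG := Real.Gamma_pos_of_pos (show 0 < ((n : ℝ) - 2) / 2 by linarith)
  have hx : (n : ℝ)⁻¹ ≤ 1 / 4 := by
    rw [one_div]
    gcongr
  have hx0 : 0 < (n : ℝ)⁻¹ := by positivity
  set x : ℝ := (n : ℝ)⁻¹ with hxdef
  have hsp : 0 < √(1 + 2 * x) := Real.sqrt_pos.2 (by linarith)
  have hss : √(1 + 2 * x) ^ 2 = 1 + 2 * x := Real.sq_sqrt (by linarith)
  have a1 : 0 < 1 - 2 * x := by linarith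
  have a2 : 0 < 1 - x := by linarith
  have a3 : 0 < 1 + 2 * x := by linarith
  have hρ : 1 + x ^ 2 * ((5 - 8 * x) / ((1 - 2 * x) ^ 2 * (1 + 2 * x) *
      ((1 - x) / (1 - 2 * x) / √(1 + 2 * x) + 1))) = (1 - x) / (1 - 2 * x) / √(1 + 2 * x) := by
    set ρ := (1 - x) / (1 - 2 * x) / √(1 + 2 * x) with hρdef
    have hρpos : 0 < ρ + 1 := by positivity
    have hρ2 : ρ ^ 2 * ((1 - 2 * x) ^ 2 * (1 + 2 * x)) = (1 - x) ^ 2 := by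
      rw [hρdef, div_pow, div_pow, hss]
      field_simp
      exact div_self (by linarith)
    have : x ^ 2 * ((5 - 8 * x) / ((1 - 2 * x) ^ 2 * (1 + 2 * x) * (ρ + 1))) = ρ - 1 := by
      rw [← mul_div_assoc, div_eq_iff (by positivity)]
      linear_combination -hρ2
    linarith
  rw [hρ]
  have hsq : √((n + 2 : ℕ) : ℝ) = √n * √(1 + 2 * x) := by
    rw [← Real.sqrt_mul (by positivity), hxdef]
    congr 1
    push_cast
    field_simp
  have hn0 : 0 < √(n : ℝ) := Real.sqrt_pos.2 (by linarith)
  unfold gammaRatio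
  rw [hsq]
  push_cast
  rw [show ((n : ℝ) + 2 - 1) / 2 = ((n : ℝ) - 1) / 2 + 1 by ring, h1,
    show ((n : ℝ) + 2 - 2) / 2 = ((n : ℝ) - 2) / 2 + 1 by ring, h2]
  have hr : ((n : ℝ) - 1) / (n - 2) = (1 - x) / (1 - 2 * x) := by
    have : (n : ℝ) - 2 ≠ 0 := by linarith
    rw [div_eq_div_iff this a1.ne', hxdef]
    field_simp
  rw [← hr]
  have : (n : ℝ) - 2 ≠ 0 := by linarith
  field_simp

/-- The tail integral `∫ r in c..1, (1 - r²) ^ m / r ^ j`, divided by `(1 - c²) ^ (m + 1)`. -/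
noncomputable def tailIntegral (c m : ℝ) (j : ℕ) : ℝ :=
  (∫ r in c..(1 : ℝ), (1 - r ^ 2) ^ m * (r ^ j)⁻¹) / (1 - c ^ 2) ^ (m + 1)

lemma tailIntegral_nonneg {c m : ℝ} (hc : c ∈ Set.Ioo (0 : ℝ) 1) (j : ℕ) :
    0 ≤ tailIntegral c m j := by
  obtain ⟨h0, h1⟩ := hc
  refine div_nonneg (intervalIntegral.integral_nonneg h1.le fun r hr => ?_)
    (Real.rpow_nonneg (by nlinarith) _)
  have hr0 : 0 < r := h0.trans_le hr.1
  exact mul_nonneg (Real.rpow_nonneg (by nlinarith [hr.2]) _) (by positivity)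

lemma mul_tailIntegral {c m : ℝ} (hc : c ∈ Set.Ioo (0 : ℝ) 1) (hm : 0 ≤ m)
    (j : ℕ) :
    2 * (m + 1) * tailIntegral c m j
      = (c ^ (j + 1))⁻¹ - (j + 1) * (1 - c ^ 2) * tailIntegral c (m + 1) (j + 2) := by
  obtain ⟨h0, h1⟩ := hc
  have hc2 : 0 < 1 - c ^ 2 := by nlinarith
  have hne : ∀ r ∈ Set.uIcc c 1, r ≠ 0 := fun r hr => by
    rw [Set.uIcc_of_le h1.le] at hr
    exact (h0.trans_le hr.1).ne'
  have hint : ∀ (s : ℝ) (k : ℕ), 0 ≤ s →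
      IntervalIntegrable (fun r : ℝ => (1 - r ^ 2) ^ s * (r ^ k)⁻¹) MeasureTheory.volume c 1 := by
    intro s k hs
    refine ContinuousOn.intervalIntegrable (ContinuousOn.mul ?_ ?_)
    · exact ContinuousOn.rpow_const (by fun_prop) fun _ _ => Or.inr hs
    · exact ContinuousOn.inv₀ (by fun_prop) fun r hr => pow_ne_zero _ (hne r hr)
  have hd : ∀ r ∈ Set.uIcc c 1, HasDerivAt (fun r : ℝ => (1 - r ^ 2) ^ (m + 1) * (r ^ (j + 1))⁻¹)
      (-(2 * (m + 1)) * ((1 - r ^ 2) ^ m * (r ^ j)⁻¹)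
        - (j + 1) * ((1 - r ^ 2) ^ (m + 1) * (r ^ (j + 2))⁻¹)) r := by
    intro r hr
    have hr0 := hne r hr
    have d1 : HasDerivAt (fun r : ℝ => 1 - r ^ 2) (-(2 * r)) r := by
      simpa using (hasDerivAt_pow 2 r).const_sub 1
    have d2 := d1.rpow_const (p := m + 1) (Or.inr (by linarith))
    have d3 := (hasDerivAt_pow (j + 1) r).inv (pow_ne_zero _ hr0)
    refine (d2.mul d3).congr_deriv ?_
    rw [add_sub_cancel_right, add_tsub_cancel_right]
    push_cast
    simp only [Pi.inv_apply]
    field_simp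
    ring
  have hI := intervalIntegral.integral_eq_sub_of_hasDerivAt hd
    (((hint m j hm).const_mul _).sub ((hint (m + 1) (j + 2) (by linarith)).const_mul _))
  rw [intervalIntegral.integral_sub ((hint m j hm).const_mul _)
    ((hint (m + 1) (j + 2) (by linarith)).const_mul _), intervalIntegral.integral_const_mul,
    intervalIntegral.integral_const_mul] at hI
  rw [one_pow, sub_self, Real.zero_rpow (by linarith), zero_mul, zero_sub] at hI
  unfold tailIntegral
  have hp : 0 < (1 - c ^ 2) ^ (m + 1) := Real.rpow_pos_of_pos hc2 _
  rw [Real.rpow_add_one hc2.ne' (m + 1)]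
  field_simp
  field_simp at hI
  linear_combination -hI

lemma eventually_mul_tailIntegral {c : ℝ} (hc : c ∈ Set.Ioo (0 : ℝ) 1) (s j : ℕ) :
    ∀ᶠ n : ℕ in atTop,
    n * tailIntegral c (((n : ℝ) - 4) / 2 + s) j = (1 + (2 * s - 2) * (n : ℝ)⁻¹)⁻¹ *
      ((c ^ (j + 1))⁻¹ - (j + 1) * (1 - c ^ 2) * ((n : ℝ)⁻¹ *
        (n * tailIntegral c (((n : ℝ) - 4) / 2 + (s + 1 : ℕ)) (j + 2)))) := by
  filter_upwards [eventually_ge_atTop 4] with n hn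
  have hn' : (4 : ℝ) ≤ n := by exact_mod_cast hn
  have hs : (0 : ℝ) ≤ s := by positivity
  have h := mul_tailIntegral hc (m := ((n : ℝ) - 4) / 2 + s) (by linarith) j
  push_cast
  rw [← add_assoc, inv_mul_cancel_left₀ (by positivity), ← h, eq_inv_mul_iff_mul_eq₀]
  · have : (n : ℝ) * (n : ℝ)⁻¹ = 1 := mul_inv_cancel₀ (by positivity)
    linear_combination
      (2 * s - 2) * tailIntegral c (((n : ℝ) - 4) / 2 + s) j * this
  · have : 0 < ((n : ℝ) + (2 * s - 2)) * (n : ℝ)⁻¹ := mul_pos (by linarith) (by positivity)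
    rw [add_mul, mul_inv_cancel₀ (by positivity)] at this
    exact this.ne'

lemma hasInvExpansion_tailIntegral {c : ℝ} (hc : c ∈ Set.Ioo (0 : ℝ) 1) (N : ℕ) :
    ∀ s j : ℕ,
    HasInvExpansion (fun n : ℕ => n * tailIntegral c (((n : ℝ) - 4) / 2 + s) j) N := by
  have hinv : ∀ (a : ℝ) (N : ℕ), HasInvExpansion (fun n : ℕ => (1 + a * (n : ℝ)⁻¹)⁻¹) N :=
    fun a N => HasInvExpansion.of_analyticAt (φ := fun x => (1 + a * x)⁻¹)
      (by fun_prop (disch := norm_num)) N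
  induction N with
  | zero =>
    intro s j
    refine HasInvExpansion.of_isBigO (IsBigO.of_bound (2 * (c ^ (j + 1))⁻¹) ?_)
    filter_upwards [eventually_ge_atTop 4] with n hn
    have hn' : (4 : ℝ) ≤ n := by exact_mod_cast hn
    have hs : (0 : ℝ) ≤ s := by positivity
    have h := mul_tailIntegral hc (m := ((n : ℝ) - 4) / 2 + s) (by linarith) j
    have h1 := tailIntegral_nonneg hc (m := ((n : ℝ) - 4) / 2 + s) j
    have h2 := tailIntegral_nonneg hc (m := ((n : ℝ) - 4) / 2 + s + 1) (j + 2)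
    have h3 : 0 ≤ (j + 1) * (1 - c ^ 2) *
        tailIntegral c (((n : ℝ) - 4) / 2 + s + 1) (j + 2) := by
      have : 0 ≤ 1 - c ^ 2 := by nlinarith [hc.1, hc.2]
      positivity
    rw [Real.norm_of_nonneg (by positivity), pow_zero, norm_one, mul_one]
    nlinarith [mul_nonneg hs h1, mul_nonneg (sub_nonneg.2 hn') h1]
  | succ N ih =>
    intro s j
    refine HasInvExpansion.congr' ?_ ((eventually_mul_tailIntegral hc s j).mono fun n hn => hn.symm)
    exact (hinv _ _).mul ((HasInvExpansion.const _ _).sub ((ih (s + 1) (j + 2)).inv_mul.const_mul _))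

lemma tendsto_tailIntegral {c : ℝ} (hc : c ∈ Set.Ioo (0 : ℝ) 1) :
    Tendsto (fun n : ℕ => n * tailIntegral c (((n : ℝ) - 4) / 2) 0) atTop (𝓝 c⁻¹) := by
  have h0 : Tendsto (fun n : ℕ => (n : ℝ)⁻¹ *
      (n * tailIntegral c (((n : ℝ) - 4) / 2 + (0 + 1 : ℕ)) (0 + 2))) atTop (𝓝 0) := by
    have h := (isBigO_refl (fun n : ℕ => (n : ℝ)⁻¹) atTop).mul
      (hasInvExpansion_tailIntegral hc 0 (0 + 1) (0 + 2)).isBigO_one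
    simp only [mul_one] at h
    exact h.trans_tendsto tendsto_natCast_inv
  have h1 : Tendsto (fun n : ℕ => (1 + (2 * (0 : ℕ) - 2) * (n : ℝ)⁻¹)⁻¹) atTop (𝓝 1) := by
    simpa using ((tendsto_natCast_inv.const_mul (2 * (0 : ℕ) - 2 : ℝ)).const_add 1).inv₀
      (by norm_num)
  have h2 := h1.mul ((h0.const_mul (((0 : ℕ) + 1) * (1 - c ^ 2))).const_sub (c ^ (0 + 1))⁻¹)
  rw [mul_zero, sub_zero, one_mul, zero_add, pow_one] at h2
  refine h2.congr' ?_
  filter_upwards [eventually_mul_tailIntegral hc 0 0] with n hn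
  rw [zero_add, pow_one] at hn
  rw [← hn, Nat.cast_zero, add_zero]

theorem stmt_17 (c : ℝ) (hc : c ∈ Set.Ioo (0 : ℝ) 1) (p : ℕ) :
    ∃ δ : ℕ → ℝ, ∃ err : ℕ → ℝ,
      err =O[atTop] (fun n : ℕ => 1 / (n : ℝ) ^ (p + 1)) ∧
      ∀ᶠ n : ℕ in atTop,
        Real.Gamma (((n : ℝ) - 1) / 2) / (Real.sqrt π * Real.Gamma (((n : ℝ) - 2) / 2)) *
            ∫ r in c..(1 : ℝ), (1 - r ^ 2) ^ (((n : ℝ) - 4) / 2)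
          = (1 - c ^ 2) ^ ((n : ℝ) / 2) /
                ((1 - c ^ 2) * Real.sqrt (1 + c ^ 2)
                  * ((c / (1 - c ^ 2)) * ((1 - c ^ 2) / Real.sqrt (1 + c ^ 2))
                      * Real.sqrt (2 * π * n)))
              * (1 + (∑ k ∈ Finset.Icc 1 p, δ k / (n : ℝ) ^ k) + err n) := by
  have h0 := hc.1
  have hc2 : 0 < 1 - c ^ 2 := by nlinarith [hc.1, hc.2]
  have hexp : HasInvExpansion
      (fun n : ℕ => √2 * c * (gammaRatio n * (n * tailIntegral c (((n : ℝ) - 4) / 2) 0)))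
      (p + 1) := by
    refine ((hasInvExpansion_gammaRatio _).mul ?_).const_mul _
    simpa using hasInvExpansion_tailIntegral hc (p + 1) 0 0
  have hlim : Tendsto
      (fun n : ℕ => √2 * c * (gammaRatio n * (n * tailIntegral c (((n : ℝ) - 4) / 2) 0)))
      atTop (𝓝 1) := by
    have h := (tendsto_gammaRatio.mul (tendsto_tailIntegral hc)).const_mul (√2 * c)
    have e : √2 * c * ((√2)⁻¹ * c⁻¹) = 1 := by field_simp
    rwa [e] at h
  obtain ⟨δ, hδ⟩ := hexp.exists_coeff hlim
  refine ⟨δ, _, hδ, ?_⟩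
  filter_upwards [eventually_ge_atTop 4] with n hn
  have hn' : (4 : ℝ) ≤ n := by exact_mod_cast hn
  have hG := Real.Gamma_pos_of_pos (show 0 < ((n : ℝ) - 2) / 2 by linarith)
  have hr : (1 - c ^ 2) ^ ((n : ℝ) / 2) = (1 - c ^ 2) ^ (((n : ℝ) - 4) / 2 + 1) * (1 - c ^ 2) := by
    rw [← Real.rpow_add_one hc2.ne']
    congr 1
    ring
  have hp : 0 < (1 - c ^ 2) ^ (((n : ℝ) - 4) / 2 + 1) := Real.rpow_pos_of_pos hc2 _
  have hs : √(2 * π * n) = √2 * √π * √n := by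
    rw [Real.sqrt_mul (by positivity), Real.sqrt_mul (by positivity)]
  have hsn : √(n : ℝ) * √n = n := Real.mul_self_sqrt (by positivity)
  have hs1 : 0 < √(1 + c ^ 2) := by positivity
  have hsp : 0 < √π := Real.sqrt_pos.2 Real.pi_pos
  have hsn0 : 0 < √(n : ℝ) := Real.sqrt_pos.2 (by linarith)
  rw [add_sub_cancel, hr, hs]
  unfold gammaRatio tailIntegral
  simp only [pow_zero, inv_one, mul_one]
  generalize (∫ r in c..(1 : ℝ), (1 - r ^ 2) ^ (((n : ℝ) - 4) / 2)) = I
  generalize (1 - c ^ 2) ^ (((n : ℝ) - 4) / 2 + 1) = A at *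
  generalize Real.Gamma (((n : ℝ) - 2) / 2) = B at *
  generalize Real.Gamma (((n : ℝ) - 1) / 2) = D at *
  generalize √(n : ℝ) = t at *
  rw [← hsn]
  field_simp
end
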